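/- arXiv:math/0506042 — 2 statements merged into one kernel-verified Lean document; each statement's English description precedes it below -/
import Mathlib

section
/- Let h be an orientation-preserving homeomorphism of the plane fixing only 0, with module at least 4. Then h is free in the sense of M. Brown: every closed topological disk D ⊂ ℝ² ∖ {0} with h(D) ∩ D = ∅ satisfies h^n(D) ∩ D = ∅ for all n ≠ 0. Consequently every point of ℝ² ∖ {0} is wandering, and the forward (and backward) orbit of every point converges to 0 or to infinity. -/
open Set

/-- A curve `γ` (defined on `[0,1]`) with values in `ℂ ∖ {0}` has degree `n` around `0`
if it lifts through the covering `exp : ℂ → ℂ ∖ {0}` to a path whose endpoints differ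
by `2πin`. -/
def HasDeg (γ : ℝ → ℂ) (n : ℤ) : Prop :=
  ∃ g : ℝ → ℂ, ContinuousOn g (Icc 0 1) ∧
    (∀ t ∈ Icc (0:ℝ) 1, γ t = Complex.exp (g t)) ∧
    g 1 - g 0 = ((2 * Real.pi * (n : ℝ) : ℝ) : ℂ) * Complex.I

/-- A loop in `ℝ² ∖ {0}`: a continuous closed curve on `[0,1]` avoiding the origin. -/
def IsLoopIn (γ : ℝ → ℂ) : Prop :=
  ContinuousOn γ (Icc 0 1) ∧ γ 0 = γ 1 ∧ ∀ t ∈ Icc (0:ℝ) 1, γ t ≠ 0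

/-- A decomposition of the closed curve `γ` into `l` subarcs, each of which is free for
`h` (disjoint from its image under `h`). The `h`-length of `γ` is the least such `l`. -/
def Decomp (h : ℂ → ℂ) (γ : ℝ → ℂ) (l : ℕ) : Prop :=
  ∃ t : ℕ → ℝ, t 0 = 0 ∧ t l = 1 ∧ (∀ i < l, t i ≤ t (i + 1)) ∧
    ∀ i < l, ∀ s ∈ Icc (t i) (t (i + 1)), ∀ s' ∈ Icc (t i) (t (i + 1)),
      h (γ s) ≠ γ s'

/-- Orientation preservation, encoded (via Kneser's theorem) as being isotopic to the
identity through bijections of the plane. -/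
def IsotopicToId (h : ℂ → ℂ) : Prop :=
  ∃ F : ℝ → ℂ → ℂ, Continuous (Function.uncurry F) ∧ F 0 = id ∧ F 1 = h ∧
    ∀ t : ℝ, Function.Bijective (F t)

open Filter

/-- A closed topological disk: a set homeomorphic to the closed unit disk. -/
def IsClosedDisk (D : Set ℂ) : Prop :=
  Nonempty (↥(Metric.closedBall (0:ℂ) 1) ≃ₜ ↥D)


open Set
open Filter

namespace FB
open Topology

/-- Homotopy lifting through `exp`. -/
lemma homotopy_log {A : Type*} [TopologicalSpace A] (F : unitInterval × A → ℂ)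
    (hF : Continuous F) (h0 : ∀ p, F p ≠ 0) (g0 : A → ℂ) (hg0 : Continuous g0)
    (h : ∀ a, F (0, a) = Complex.exp (g0 a)) :
    ∃ g : unitInterval × A → ℂ, Continuous g ∧ (∀ p, Complex.exp (g p) = F p) ∧
      ∀ a, g (0, a) = g0 a := by
  let F' : C(unitInterval × A, {z : ℂ // z ≠ 0}) :=
    ⟨fun p => ⟨F p, h0 p⟩, hF.subtype_mk _⟩
  let f : C(A, ℂ) := ⟨g0, hg0⟩
  have H0 : ∀ a, F' (0, a) = (fun z : ℂ ↦ (⟨_, z.exp_ne_zero⟩ : {z : ℂ // z ≠ 0})) (f a) := by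
    intro a
    exact Subtype.ext (h a)
  refine ⟨Complex.isCoveringMap_exp.liftHomotopy F' f H0, ContinuousMap.continuous _, ?_, ?_⟩
  · intro p
    have := congrFun (Complex.isCoveringMap_exp.liftHomotopy_lifts F' f H0) p
    exact congrArg Subtype.val this
  · intro a
    exact Complex.isCoveringMap_exp.liftHomotopy_zero F' f H0 a

/-- Logarithms on convex sets. -/
lemma convex_log {E : Type*} [AddCommGroup E] [Module ℝ E] [TopologicalSpace E]
    [IsTopologicalAddGroup E] [ContinuousSMul ℝ E] {X : Set E} (hX : Convex ℝ X)
    {f : E → ℂ} (hf : ContinuousOn f X) (h0 : ∀ x ∈ X, f x ≠ 0) :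
    ∃ g : E → ℂ, ContinuousOn g X ∧ ∀ x ∈ X, Complex.exp (g x) = f x := by
  classical
  rcases X.eq_empty_or_nonempty with rfl | ⟨x0, hx0⟩
  · exact ⟨0, by simp, by simp⟩
  have hmem : ∀ p : unitInterval × X, x0 + (p.1 : ℝ) • ((p.2 : E) - x0) ∈ X := fun p =>
    hX.add_smul_sub_mem hx0 p.2.2 p.1.2
  obtain ⟨g, hg, hge, -⟩ := homotopy_log
    (fun p : unitInterval × X => f (x0 + (p.1 : ℝ) • ((p.2 : E) - x0)))
    (hf.comp_continuous (by fun_prop) hmem) (fun p => h0 _ (hmem p))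
    (fun _ => Complex.log (f x0)) continuous_const
    (fun a => by simp [Complex.exp_log (h0 _ hx0)])
  refine ⟨fun x => if hx : x ∈ X then g (1, ⟨x, hx⟩) else 0, ?_, ?_⟩
  · rw [continuousOn_iff_continuous_restrict]
    have : X.domRestrict (fun x => if hx : x ∈ X then g (1, ⟨x, hx⟩) else 0)
        = fun x : X => g (1, x) := by
      ext x; simp
    rw [this]
    fun_prop
  · intro x hx
    have := hge (1, ⟨x, hx⟩)
    simp only [hx, dite_true]
    rw [this]; simp

lemma isDiscrete_exp : IsDiscrete {z : ℂ | Complex.exp z = 1} := by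
  have h : {z : ℂ | Complex.exp z = 1} =
      (fun z : ℂ ↦ (⟨_, z.exp_ne_zero⟩ : {z : ℂ // z ≠ 0})) ⁻¹' {⟨1, one_ne_zero⟩} := by
    ext z; simp [Subtype.ext_iff]
  rw [h]
  have := Complex.isCoveringMap_exp
  exact ⟨(this ⟨1, one_ne_zero⟩).1⟩

lemma exp_const {E : Type*} [TopologicalSpace E] {S : Set E} (hS : IsPreconnected S)
    {f g : E → ℂ} (hf : ContinuousOn f S) (hg : ContinuousOn g S)
    (h : ∀ x ∈ S, Complex.exp (f x) = Complex.exp (g x)) {x y : E} (hx : x ∈ S) (hy : y ∈ S) :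
    f x - g x = f y - g y := by
  refine hS.constant_of_mapsTo isDiscrete_exp (hf.sub hg) ?_ hx hy
  intro z hz
  exact Complex.exp_eq_exp_iff_exp_sub_eq_one.1 (h z hz)

/-- gluing on two relatively closed sets -/
lemma glue_closed {E F : Type*} [TopologicalSpace E] [TopologicalSpace F] {S C D : Set E}
    {f : E → F} (hC : IsClosed C) (hD : IsClosed D) (hS : S ⊆ C ∪ D)
    (h1 : ContinuousOn f (S ∩ C)) (h2 : ContinuousOn f (S ∩ D)) : ContinuousOn f S := by
  have key : ∀ C : Set E, IsClosed C → ContinuousOn f (S ∩ C) → ∀ x ∈ S,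
      ContinuousWithinAt f (S ∩ C) x := by
    intro C hC h x hx
    by_cases hxC : x ∈ C
    · exact h x ⟨hx, hxC⟩
    · have : 𝓝[S ∩ C] x = ⊥ := by
        rw [← notMem_closure_iff_nhdsWithin_eq_bot]
        intro hx'
        exact hxC (hC.closure_subset_iff.2 inter_subset_right hx')
      rw [ContinuousWithinAt, this]
      exact tendsto_bot
  intro x hx
  have : S = (S ∩ C) ∪ (S ∩ D) := by
    rw [← inter_union_distrib_left, inter_eq_left.2 hS]
  rw [this]
  exact continuousWithinAt_union.2 ⟨key C hC h1 x hx, key D hD h2 x hx⟩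

lemma first_hit {ν : ℝ → ℂ} (hν : Continuous ν) {X : Set ℂ} (hX : IsClosed X) {a b : ℝ}
    (hab : a ≤ b) (hb : ν b ∈ X) :
    ∃ s ∈ Icc a b, ν s ∈ X ∧ ∀ t, a ≤ t → t < s → ν t ∉ X := by
  have hc : IsCompact (Icc a b ∩ ν ⁻¹' X) := isCompact_Icc.inter_right (hX.preimage hν)
  obtain ⟨s, hs, hs'⟩ := hc.exists_isLeast ⟨b, ⟨hab, le_rfl⟩, hb⟩
  refine ⟨s, hs.1, hs.2, fun t hat hts ht => ?_⟩
  exact absurd (hs' ⟨⟨hat, hts.le.trans hs.1.2⟩, ht⟩) (not_le.2 hts)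

/-- exterior of a disc is preconnected -/
lemma exterior_preconnected (x : ℂ) (R : ℝ) (hR : 0 < R) :
    IsPreconnected {z : ℂ | R < dist z x} := by
  have : {z : ℂ | R < dist z x} =
      (fun w => x + Complex.exp w) '' {w : ℂ | Real.log R < w.re} := by
    ext z
    simp only [mem_setOf_eq, mem_image, Complex.dist_eq]
    constructor
    · intro h
      have h0 : z - x ≠ 0 := by
        intro h0; rw [h0, norm_zero] at h; linarith
      refine ⟨Complex.log (z - x), ?_, ?_⟩
      · rw [Complex.log_re]; exact Real.log_lt_log hR h
      · rw [Complex.exp_log h0]; ring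
    · rintro ⟨w, hw, rfl⟩
      rw [add_sub_cancel_left, Complex.norm_exp]
      exact (Real.log_lt_iff_lt_exp hR).1 hw
  rw [this]
  refine IsPreconnected.image ?_ _ (by fun_prop)
  exact (convex_halfSpace_re_gt _).isPreconnected

end FB

open Set
open Filter

namespace FB
open Topology

def HasLogs (X : Set ℂ) : Prop := ∀ f : ℂ → ℂ, ContinuousOn f X → (∀ z ∈ X, f z ≠ 0) →
  ∃ g : ℂ → ℂ, ContinuousOn g X ∧ ∀ z ∈ X, Complex.exp (g z) = f z

lemma HasLogs.convex {X : Set ℂ} (hX : Convex ℝ X) : HasLogs X :=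
  fun _ hf h0 => convex_log hX hf h0

lemma HasLogs.image {X : Set ℂ} (hX : HasLogs X) (H : ℂ ≃ₜ ℂ) : HasLogs (H '' X) := by
  intro f hf h0
  obtain ⟨g, hg, hge⟩ := hX (f ∘ H)
    (hf.comp H.continuous.continuousOn (mapsTo_image _ _)) (fun z hz => h0 _ ⟨z, hz, rfl⟩)
  refine ⟨g ∘ H.symm, hg.comp H.symm.continuous.continuousOn ?_, ?_⟩
  · rintro _ ⟨z, hz, rfl⟩; simpa using hz
  · rintro _ ⟨z, hz, rfl⟩; simpa using hge z hz

lemma HasLogs.union {X Y : Set ℂ} (hX : HasLogs X) (hY : HasLogs Y) (cX : IsClosed X)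
    (cY : IsClosed Y) {w : ℂ} (hwX : w ∈ X) (hwY : w ∈ Y) (hw : ∀ z ∈ X, z ∈ Y → z = w) :
    HasLogs (X ∪ Y) := by
  classical
  intro f hf h0
  obtain ⟨g1, c1, e1⟩ := hX f (hf.mono subset_union_left) (fun z hz => h0 z (Or.inl hz))
  obtain ⟨g2, c2, e2⟩ := hY f (hf.mono subset_union_right) (fun z hz => h0 z (Or.inr hz))
  have hk : Complex.exp (g1 w - g2 w) = 1 := by
    rw [Complex.exp_sub, e1 w hwX, e2 w hwY, div_self (h0 w (Or.inl hwX))]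
  set g : ℂ → ℂ := fun z => if z ∈ X then g1 z else g2 z + (g1 w - g2 w) with hg
  have hgX : ∀ z ∈ X, g z = g1 z := fun z hz => by simp [hg, hz]
  have hgY : ∀ z ∈ Y, g z = g2 z + (g1 w - g2 w) := fun z hz => by
    by_cases hzX : z ∈ X
    · have := hw z hzX hz
      subst this
      rw [hgX _ hzX]; ring
    · simp [hg, hzX]
  refine ⟨g, glue_closed cX cY subset_rfl ?_ ?_, ?_⟩
  · exact (c1.congr hgX).mono inter_subset_right
  · exact ((c2.add continuousOn_const).congr hgY).mono inter_subset_right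
  · rintro z (hz | hz)
    · rw [hgX z hz, e1 z hz]
    · rw [hgY z hz, Complex.exp_add, hk, e2 z hz, mul_one]

/-- `z - x` has no logarithm on the exterior of a disc. -/
lemma no_exterior_log (x : ℂ) (R : ℝ) (l : ℂ → ℂ) (hl : Continuous l)
    (h : ∀ z, R < dist z x → Complex.exp (l z) = z - x) : False := by
  set r := |R| + 1
  have hr : 0 < r := by positivity
  have hRr : R < r := lt_of_le_of_lt (le_abs_self R) (lt_add_one _)
  have := exp_const (S := (univ : Set ℝ)) isPreconnected_univ
    (f := fun s => l (x + r * Complex.exp (s * Complex.I)))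
    (g := fun s => Real.log r + s * Complex.I) (by fun_prop) (by fun_prop) (by
      intro s _
      rw [h]
      · rw [Complex.exp_add, ← Complex.ofReal_exp, Real.exp_log hr]; ring
      · rw [Complex.dist_eq, add_sub_cancel_left, norm_mul, Complex.norm_exp_ofReal_mul_I,
          Complex.norm_real, Real.norm_eq_abs, abs_of_pos hr, mul_one]; exact hRr)
    (mem_univ 0) (mem_univ (2 * Real.pi))
  have e : Complex.exp (((2 * Real.pi : ℝ) : ℂ) * Complex.I) = 1 := by
    push_cast; exact Complex.exp_two_pi_mul_I
  simp only [e, Complex.ofReal_zero, zero_mul, Complex.exp_zero] at this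
  have h2 : ((2 * Real.pi : ℝ) : ℂ) * Complex.I = 0 := by linear_combination this
  have h3 : ((2 * Real.pi : ℝ) : ℂ) ≠ 0 := by
    exact_mod_cast Real.two_pi_pos.ne'
  exact (mul_ne_zero h3 Complex.I_ne_zero) h2

lemma lemmaA_aux {X A B : Set ℂ} (hX : IsCompact X) (hL : HasLogs X) (oA : IsOpen A)
    (oB : IsOpen B) (hAB : Disjoint A B) (hcov : A ∪ B = Xᶜ) {x : ℂ} (hx : x ∈ B) {R : ℝ}
    (hR : {z : ℂ | R < dist z x} ⊆ A) : False := by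
  classical
  have hxX : x ∉ X := by
    have : x ∈ Xᶜ := hcov ▸ Or.inr hx
    exact this
  obtain ⟨g, cg, eg⟩ := hL (fun z => z - x) (by fun_prop)
    (fun z hz h => hxX (by rwa [sub_eq_zero.1 h] at hz))
  obtain ⟨G, hG⟩ := ContinuousMap.exists_restrict_eq hX.isClosed
    (⟨X.domRestrict g, cg.domRestrict⟩ : C(X, ℂ))
  have hG' : ∀ z ∈ X, G z = g z := fun z hz => by
    have := DFunLike.congr_fun hG ⟨z, hz⟩
    simpa using this
  have cov : ∀ z, z ∈ A ∨ z ∈ B ∨ z ∈ X := by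
    intro z
    by_cases hz : z ∈ X
    · exact Or.inr (Or.inr hz)
    · have : z ∈ A ∪ B := hcov ▸ hz
      rcases this with h | h <;> simp [h]
  have nX : ∀ z, z ∈ A ∪ B → z ∉ X := fun z hz => by rw [hcov] at hz; exact hz
  set f : ℂ → ℂ := fun z => if z ∈ B then Complex.exp (G z) else z - x with hf
  have f1 : ∀ z ∈ Aᶜ, f z = Complex.exp (G z) := by
    intro z hz
    by_cases hB : z ∈ B
    · simp [hf, hB]
    · have hzX : z ∈ X := by have := cov z; tauto
      simp [hf, hB, hG' z hzX, eg z hzX]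
  have f2 : ∀ z ∈ Bᶜ, f z = z - x := fun z hz => by simp [hf, show z ∉ B from hz]
  have cf : ContinuousOn f univ := by
    refine glue_closed oA.isClosed_compl oB.isClosed_compl ?_ ?_ ?_
    · intro z _
      by_contra hz
      simp only [mem_union, mem_compl_iff, not_or, not_not] at hz
      exact disjoint_left.1 hAB hz.1 hz.2
    · refine ContinuousOn.congr ?_ (fun z hz => f1 z hz.2)
      fun_prop
    · refine ContinuousOn.congr ?_ (fun z hz => f2 z hz.2)
      fun_prop
  have f0 : ∀ z ∈ univ, f z ≠ 0 := by
    intro z _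
    by_cases hB : z ∈ B
    · simp [hf, hB]
    · rw [f2 z hB]
      exact sub_ne_zero.2 (fun h => hB (h ▸ hx))
  obtain ⟨l, cl, el⟩ := convex_log convex_univ cf f0
  refine no_exterior_log x R l (continuousOn_univ.1 cl) (fun z hz => ?_)
  rw [el z (mem_univ _), f2 z (disjoint_left.1 hAB (hR hz))]

lemma lemmaA {X : Set ℂ} (hX : IsCompact X) (hL : HasLogs X) : IsPreconnected Xᶜ := by
  rintro U V oU oV hUV ⟨u, hu, huU⟩ ⟨v, hv, hvV⟩
  by_contra hne
  rw [not_nonempty_iff_eq_empty] at hne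
  have oX := hX.isClosed.isOpen_compl
  have hd : Disjoint (Xᶜ ∩ U) (Xᶜ ∩ V) := by
    rw [disjoint_left]
    rintro z ⟨hz, hzU⟩ ⟨_, hzV⟩
    have : z ∈ Xᶜ ∩ (U ∩ V) := ⟨hz, hzU, hzV⟩
    rw [hne] at this; exact this
  have hc : (Xᶜ ∩ U) ∪ (Xᶜ ∩ V) = Xᶜ := by
    rw [← inter_union_distrib_left, inter_eq_left.2 hUV]
  have key : ∀ x : ℂ, ∃ R > 0, {z : ℂ | R < dist z x} ⊆ Xᶜ := by
    intro x
    obtain ⟨R, hR⟩ := hX.isBounded.subset_closedBall x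
    refine ⟨max R 1, lt_max_of_lt_right one_pos, fun z hz hzX => ?_⟩
    have := hR hzX
    rw [Metric.mem_closedBall] at this
    exact absurd (lt_of_le_of_lt (le_max_left R 1) hz) (not_lt.2 this)
  have main : ∀ x : ℂ, ∃ R, {z : ℂ | R < dist z x} ⊆ Xᶜ ∩ U ∨ {z : ℂ | R < dist z x} ⊆ Xᶜ ∩ V := by
    intro x
    obtain ⟨R, hR, h⟩ := key x
    refine ⟨R, ?_⟩
    refine IsPreconnected.subset_or_subset (oX.inter oU) (oX.inter oV) hd (by rwa [hc])
      (exterior_preconnected x R hR)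
  obtain ⟨R, h | h⟩ := main v
  · exact lemmaA_aux hX hL (oX.inter oU) (oX.inter oV) hd hc ⟨hv, hvV⟩ h
  · obtain ⟨R', h' | h'⟩ := main u
    · -- both far regions intersect
      obtain ⟨z, hz⟩ : ∃ z : ℂ, R < dist z v ∧ R' < dist z u := by
        refine ⟨((|R| + |R'| + ‖u‖ + ‖v‖ + 1 : ℝ) : ℂ), ?_, ?_⟩
        · rw [Complex.dist_eq]
          have := norm_sub_norm_le ((|R| + |R'| + ‖u‖ + ‖v‖ + 1 : ℝ) : ℂ) v
          rw [Complex.norm_real, Real.norm_eq_abs, abs_of_pos (by positivity)] at this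
          have h1 := le_abs_self R
          have h2 := abs_nonneg R'
          have h3 := norm_nonneg u
          linarith
        · rw [Complex.dist_eq]
          have := norm_sub_norm_le ((|R| + |R'| + ‖u‖ + ‖v‖ + 1 : ℝ) : ℂ) u
          rw [Complex.norm_real, Real.norm_eq_abs, abs_of_pos (by positivity)] at this
          have h1 := le_abs_self R'
          have h2 := abs_nonneg R
          have h3 := norm_nonneg v
          linarith
      exact disjoint_left.1 hd (h' hz.2) (h hz.1)
    · exact lemmaA_aux hX hL (oX.inter oV) (oX.inter oU) hd.symm (by rw [union_comm, hc])
        ⟨hu, huU⟩ h'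

end FB

open Set
open Filter

namespace FB
open Topology

/-- log on a punctured plane of a function equal to 1 far away -/
lemma punctured_log {f : ℂ → ℂ} {b : ℂ} (hf : ContinuousOn f {b}ᶜ) (h0 : ∀ z, f z ≠ 0)
    {R : ℝ} (hR : ∀ z, R < dist z b → f z = 1) :
    ∃ g : ℂ → ℂ, ContinuousOn g {b}ᶜ ∧ ∀ z ∈ ({b}ᶜ : Set ℂ), Complex.exp (g z) = f z := by
  classical
  set F : ℂ → ℂ := fun w => if w = 0 then 1 else f (b + w⁻¹) with hF
  have cF : ContinuousOn F univ := by
    intro w _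
    apply ContinuousAt.continuousWithinAt
    by_cases hw : w = 0
    · subst hw
      have : F =ᶠ[𝓝 0] fun _ => 1 := by
        have hr : (0:ℝ) < (|R| + 1)⁻¹ := by positivity
        filter_upwards [Metric.ball_mem_nhds (0:ℂ) hr] with w hw
        by_cases h : w = 0
        · simp [hF, h]
        · simp only [hF, h, if_false]
          apply hR
          rw [Complex.dist_eq, add_sub_cancel_left, norm_inv]
          rw [mem_ball_zero_iff] at hw
          have hp : 0 < ‖w‖ := norm_pos_iff.2 h
          have : |R| + 1 < ‖w‖⁻¹ := by
            rwa [lt_inv_comm₀ (by positivity) hp]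
          have := le_abs_self R
          linarith
      exact continuousAt_const.congr this.symm
    · have h1 : F =ᶠ[𝓝 w] fun w => f (b + w⁻¹) := by
        filter_upwards [isOpen_ne.mem_nhds hw] with v hv
        have hv : v ≠ 0 := hv
        simp [hF, hv]
      refine ContinuousAt.congr ?_ h1.symm
      have h2 : ContinuousAt f (b + w⁻¹) :=
        hf.continuousAt (isOpen_compl_singleton.mem_nhds (by simp [hw]))
      have h3 : ContinuousAt (fun w : ℂ => b + w⁻¹) w :=
        continuousAt_const.add (continuousAt_inv₀ hw)
      exact ContinuousAt.comp (g := f) h2 h3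
  obtain ⟨l, cl, el⟩ := convex_log convex_univ cF (fun w _ => by
    by_cases h : w = 0
    · simp [hF, h]
    · simp only [hF, h, if_false]; exact h0 _)
  refine ⟨fun z => l (z - b)⁻¹, ?_, ?_⟩
  · refine (continuousOn_univ.1 cl).comp_continuousOn ?_
    refine ContinuousOn.inv₀ (by fun_prop) (fun z hz => sub_ne_zero.2 hz)
  · intro z hz
    have : z - b ≠ 0 := sub_ne_zero.2 hz
    simp only
    rw [el _ (mem_univ _)]
    simp [hF, this]

lemma lemmaB {V Q : Set ℂ} (oV : IsOpen V) (pV : IsPreconnected V) (bV : Bornology.IsBounded V)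
    (cQ : IsCompact Q) (pQ : IsPreconnected Qᶜ)
    (hQ : Q ⊆ V ∨ ∃ b ∈ Q, b ∉ V ∧ Q ⊆ insert b V) : IsPreconnected (V \ Q) := by
  classical
  rintro A' B' oA' oB' hAB ⟨a, ha, haA⟩ ⟨b', hb, hbB⟩
  by_contra hne
  rw [not_nonempty_iff_eq_empty] at hne
  have oVQ : IsOpen (V \ Q) := oV.sdiff cQ.isClosed
  set A := (V \ Q) ∩ A' with hA
  set B := (V \ Q) ∩ B' with hB
  have oA : IsOpen A := oVQ.inter oA'
  have oB : IsOpen B := oVQ.inter oB'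
  have hd : ∀ z ∈ A, z ∉ B := by
    rintro z ⟨hz, hzU⟩ ⟨_, hzV⟩
    have : z ∈ (V \ Q) ∩ (A' ∩ B') := ⟨hz, hzU, hzV⟩
    rw [hne] at this; exact this
  have hcov : ∀ z ∈ V, z ∉ Q → z ∉ A → z ∈ B := by
    intro z hz hzQ hzA
    rcases hAB ⟨hz, hzQ⟩ with h | h
    · exact absurd ⟨⟨hz, hzQ⟩, h⟩ hzA
    · exact ⟨⟨hz, hzQ⟩, h⟩
  -- V complement nonempty
  obtain ⟨R, hR⟩ := bV.subset_closedBall 0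
  have neVc : (Vᶜ : Set ℂ).Nonempty := by
    refine ⟨((|R| + 1 : ℝ) : ℂ), fun h => ?_⟩
    have := hR h
    rw [mem_closedBall_zero_iff, Complex.norm_real, Real.norm_eq_abs,
      abs_of_pos (by positivity)] at this
    have := le_abs_self R
    linarith
  by_cases neQ : Q.Nonempty
  swap
  · rw [not_nonempty_iff_eq_empty] at neQ
    subst neQ
    have := pV A' B' oA' oB' (by simpa using hAB) ⟨a, ha.1, haA⟩ ⟨b', hb.1, hbB⟩
    simp only [diff_empty] at hne
    rw [hne] at this
    exact not_nonempty_empty this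
  set dQ : ℂ → ℝ := fun z => Metric.infDist z Q
  set dV : ℂ → ℝ := fun z => Metric.infDist z Vᶜ
  have cdQ : Continuous dQ := Metric.continuous_infDist_pt Q
  have cdV : Continuous dV := Metric.continuous_infDist_pt Vᶜ
  have dQ0 : ∀ z, 0 ≤ dQ z := fun z => Metric.infDist_nonneg
  have dV0 : ∀ z, 0 ≤ dV z := fun z => Metric.infDist_nonneg
  have dQz : ∀ z, dQ z = 0 ↔ z ∈ Q := fun z => (cQ.isClosed.mem_iff_infDist_zero neQ).symm
  have dVz : ∀ z, dV z = 0 ↔ z ∉ V := fun z =>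
    (oV.isClosed_compl.mem_iff_infDist_zero neVc).symm
  have den : ∀ z ∈ V ∪ Qᶜ, dQ z + dV z ≠ 0 := by
    intro z hz h
    have h1 : dQ z = 0 := by linarith [dQ0 z, dV0 z]
    have h2 : dV z = 0 := by linarith [dQ0 z, dV0 z]
    rw [dQz] at h1; rw [dVz] at h2
    rcases hz with hz | hz
    · exact h2 hz
    · exact hz h1
  set χ : ℂ → ℝ := fun z => dQ z / (dQ z + dV z) with hχ
  have cχ : ContinuousOn χ (V ∪ Qᶜ) :=
    cdQ.continuousOn.div (cdQ.add cdV).continuousOn den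
  have χQ : ∀ z ∈ Q, χ z = 0 := fun z hz => by simp [hχ, (dQz z).2 hz]
  have χV : ∀ z, z ∉ Q → z ∉ V → χ z = 1 := fun z hz hzV => by
    have : dQ z ≠ 0 := fun h => hz ((dQz z).1 h)
    simp [hχ, (dVz z).2 hzV, this]
  set f1 : ℂ → ℝ := fun z => if z ∈ B then χ z else 0 with hf1
  set f2 : ℂ → ℝ := fun z => if z ∈ B then χ z - 1 else 0 with hf2
  have covAB : ∀ S : Set ℂ, S ⊆ Aᶜ ∪ Bᶜ := by
    intro S z _
    by_cases h : z ∈ A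
    · exact Or.inr (hd z h)
    · exact Or.inl h
  have c1 : ContinuousOn f1 V := by
    refine glue_closed oA.isClosed_compl oB.isClosed_compl (covAB V) ?_ ?_
    · refine (cχ.mono (inter_subset_left.trans subset_union_left)).congr ?_
      rintro z ⟨hz, hzA⟩
      by_cases h : z ∈ B
      · simp [hf1, h]
      · have : z ∈ Q := by
          by_contra hzQ
          exact h (hcov z hz hzQ hzA)
        simp [hf1, h, χQ z this]
    · refine (continuousOn_const (c := (0:ℝ))).congr ?_
      rintro z ⟨hz, hzB⟩
      simp [hf1, show z ∉ B from hzB]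
  have c2 : ContinuousOn f2 Qᶜ := by
    refine glue_closed oA.isClosed_compl oB.isClosed_compl (covAB _) ?_ ?_
    · refine ((cχ.mono (inter_subset_left.trans subset_union_right)).sub
        (continuousOn_const (c := (1:ℝ)))).congr ?_
      rintro z ⟨hz, hzA⟩
      by_cases h : z ∈ B
      · simp [hf2, h]
      · have : z ∉ V := by
          intro hzV
          exact h (hcov z hzV hz hzA)
        simp [hf2, h, χV z hz this]
    · refine (continuousOn_const (c := (0:ℝ))).congr ?_
      rintro z ⟨hz, hzB⟩
      simp [hf2, show z ∉ B from hzB]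
  set τ : ℂ := 2 * Real.pi * Complex.I with hτ
  have eτ : Complex.exp τ = 1 := Complex.exp_two_pi_mul_I
  have τ0 : τ ≠ 0 := Complex.two_pi_I_ne_zero
  set G : ℂ → ℂ := fun z => Complex.exp (τ * f1 z) with hG
  have G2 : ∀ z, G z = Complex.exp (τ * f2 z) := by
    intro z
    by_cases h : z ∈ B
    · simp only [hG, hf1, hf2, h, if_true]
      push_cast
      rw [mul_sub, mul_one, Complex.exp_sub, eτ, div_one]
    · simp [hG, hf1, hf2, h]
  have cG1 : ContinuousOn G V := by
    refine Complex.continuous_exp.comp_continuousOn ?_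
    exact continuousOn_const.mul (Complex.continuous_ofReal.comp_continuousOn c1)
  have cG2 : ContinuousOn G Qᶜ := by
    rw [show G = fun z => Complex.exp (τ * f2 z) from funext G2]
    refine Complex.continuous_exp.comp_continuousOn ?_
    exact continuousOn_const.mul (Complex.continuous_ofReal.comp_continuousOn c2)
  have cG : ContinuousOn G (V ∪ Qᶜ) :=
    cG1.union_of_isOpen cG2 oV cQ.isClosed.isOpen_compl
  have hl : ∃ l : ℂ → ℂ, ContinuousOn l (V ∪ Qᶜ) ∧
      ∀ z ∈ V ∪ Qᶜ, Complex.exp (l z) = G z := by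
    rcases hQ with hQ | ⟨b, hbQ, hbV, hQ⟩
    · have : V ∪ Qᶜ = univ := by
        ext z; simp only [mem_union, mem_compl_iff, mem_univ, iff_true]
        by_cases h : z ∈ Q
        · exact Or.inl (hQ h)
        · exact Or.inr h
      rw [this] at cG ⊢
      exact convex_log convex_univ cG (fun z _ => Complex.exp_ne_zero _)
    · have : V ∪ Qᶜ = {b}ᶜ := by
        ext z; simp only [mem_union, mem_compl_iff, mem_singleton_iff]
        constructor
        · rintro (h | h) rfl
          · exact hbV h
          · exact h hbQ
        · intro h
          by_cases h' : z ∈ Q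
          · exact Or.inl ((hQ h').resolve_left h)
          · exact Or.inr h'
      rw [this] at cG ⊢
      obtain ⟨R, hR⟩ := bV.subset_closedBall b
      refine punctured_log cG (fun z => Complex.exp_ne_zero _) (R := R) (fun z hz => ?_)
      have : z ∉ B := fun h => by
        have := hR h.1.1
        rw [Metric.mem_closedBall] at this
        linarith
      simp [hG, hf1, this]
  obtain ⟨l, cl, el⟩ := hl
  have e1 : τ * f1 a - l a = τ * f1 b' - l b' :=
    exp_const pV (f := fun z => τ * f1 z)
      (continuousOn_const.mul (Complex.continuous_ofReal.comp_continuousOn c1))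
      (cl.mono subset_union_left) (fun z hz => (el z (Or.inl hz)).symm) ha.1 hb.1
  have e2 : τ * f2 a - l a = τ * f2 b' - l b' :=
    exp_const pQ (f := fun z => τ * f2 z)
      (continuousOn_const.mul (Complex.continuous_ofReal.comp_continuousOn c2))
      (cl.mono subset_union_right) (fun z hz => by rw [el z (Or.inr hz), G2]) ha.2 hb.2
  have haB : a ∉ B := hd a ⟨ha, haA⟩
  have hbB' : b' ∈ B := ⟨hb, hbB⟩
  simp only [hf1, hf2, haB, hbB', if_true, if_false] at e1 e2
  push_cast at e1 e2
  apply τ0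
  linear_combination e2 - e1

def Tree (X : Set ℂ) : Prop := IsCompact X ∧ IsConnected X ∧ HasLogs X

lemma Tree.singleton (x : ℂ) : Tree {x} :=
  ⟨isCompact_singleton, isConnected_singleton, HasLogs.convex (convex_singleton x)⟩

lemma isCompact_seg (a b : ℂ) : IsCompact (segment ℝ a b) := by
  rw [segment_eq_image_lineMap]
  exact isCompact_Icc.image AffineMap.lineMap_continuous

lemma Tree.attach {X : Set ℂ} (hX : Tree X) {x y : ℂ} (hx : x ∈ X) :
    ∃ X', Tree X' ∧ X ⊆ X' ∧ X' ⊆ X ∪ segment ℝ y x ∧ y ∈ X' := by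
  set ν : ℝ → ℂ := fun t => AffineMap.lineMap y x t
  have cν : Continuous ν := AffineMap.lineMap_continuous
  obtain ⟨s, hs, hsX, hlt⟩ := first_hit cν hX.1.isClosed (a := 0) (b := 1) zero_le_one
    (by simpa [ν] using hx)
  have hseg : segment ℝ y (ν s) = ν '' Icc 0 s := by
    rw [segment_eq_image_lineMap]
    ext z
    constructor
    · rintro ⟨t, ht, rfl⟩
      refine ⟨t * s, ⟨mul_nonneg ht.1 hs.1, mul_le_of_le_one_left hs.1 ht.2⟩, ?_⟩
      simp [ν, AffineMap.lineMap_apply]; ring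
    · rintro ⟨t, ht, rfl⟩
      rcases eq_or_lt_of_le hs.1 with h0 | h0
      · have : t = 0 := by subst h0; exact le_antisymm ht.2 ht.1
        subst this
        exact ⟨0, ⟨le_rfl, zero_le_one⟩, by simp [ν]⟩
      · refine ⟨t / s, ⟨div_nonneg ht.1 hs.1, div_le_one_of_le₀ ht.2 hs.1⟩, ?_⟩
        have : (s : ℂ) ≠ 0 := by exact_mod_cast h0.ne'
        simp [ν, AffineMap.lineMap_apply]
        field_simp
  have hsub : segment ℝ y (ν s) ⊆ segment ℝ y x := by
    rw [hseg, segment_eq_image_lineMap]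
    exact image_mono (Icc_subset_Icc_right hs.2)
  refine ⟨X ∪ segment ℝ y (ν s), ⟨hX.1.union (isCompact_seg _ _), ?_, ?_⟩,
    subset_union_left, union_subset_union_right _ hsub, Or.inr (left_mem_segment _ _ _)⟩
  · refine hX.2.1.union ⟨ν s, hsX, right_mem_segment _ _ _⟩
      ⟨⟨y, left_mem_segment _ _ _⟩, (convex_segment _ _).isPreconnected⟩
  · refine hX.2.2.union (HasLogs.convex (convex_segment _ _)) hX.1.isClosed
      (isCompact_seg _ _).isClosed hsX (right_mem_segment _ _ _) ?_
    intro z hz hz'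
    rw [hseg] at hz'
    obtain ⟨t, ht, rfl⟩ := hz'
    rcases eq_or_lt_of_le ht.2 with h | h
    · rw [h]
    · exact absurd hz (hlt t ht.1 h)

lemma Tree.extend {U X : Set ℂ} (oU : IsOpen U) (pU : IsPreconnected U) (hX : Tree X)
    (hXU : X ⊆ U) {y : ℂ} (hy : y ∈ U) : ∃ X', Tree X' ∧ X ⊆ X' ∧ X' ⊆ U ∧ y ∈ X' := by
  obtain ⟨x, hx⟩ := hX.2.1.nonempty
  have key := pU.induction₂' (fun a b => (∃ X', Tree X' ∧ X ⊆ X' ∧ X' ⊆ U ∧ a ∈ X') →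
      ∃ X', Tree X' ∧ X ⊆ X' ∧ X' ⊆ U ∧ b ∈ X') ?_ (fun a b c _ _ _ h1 h2 h => h2 (h1 h))
      (hXU hx) hy
  · exact key ⟨X, hX, subset_rfl, hXU, hx⟩
  · intro a ha
    obtain ⟨r, hr, hrU⟩ := Metric.isOpen_iff.1 oU a ha
    apply mem_nhdsWithin_of_mem_nhds
    filter_upwards [Metric.ball_mem_nhds a hr] with b hb
    have gen : ∀ a' ∈ Metric.ball a r, ∀ b' ∈ Metric.ball a r,
        (∃ X', Tree X' ∧ X ⊆ X' ∧ X' ⊆ U ∧ a' ∈ X') →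
        ∃ X', Tree X' ∧ X ⊆ X' ∧ X' ⊆ U ∧ b' ∈ X' := by
      rintro a' ha' b' hb' ⟨X', hT, h1, h2, h3⟩
      obtain ⟨X'', hT', h1', h2', h3'⟩ := hT.attach (y := b') h3
      exact ⟨X'', hT', h1.trans h1', h2'.trans (union_subset h2
        (((convex_ball a r).segment_subset hb' ha').trans hrU)), h3'⟩
    exact ⟨gen a (Metric.mem_ball_self hr) b hb, gen b hb a (Metric.mem_ball_self hr)⟩

end FB

open Set
open Filter

namespace FB
open Topology

lemma last_exit {ν : ℝ → ℂ} (hν : Continuous ν) {O : Set ℂ} (hO : IsOpen O) {a b : ℝ}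
    (hab : a ≤ b) (ha : ν a ∈ O) (hb : ν b ∉ O) :
    ∃ t ∈ Icc a b, (∀ s ∈ Icc t b, ν s ∉ O) ∧ ∀ e > 0, ∃ s ∈ Icc a t, t - e < s ∧ ν s ∈ O := by
  set T := Icc a b ∩ ν ⁻¹' O
  have hne : T.Nonempty := ⟨a, ⟨le_rfl, hab⟩, ha⟩
  have hbd : BddAbove T := ⟨b, fun s hs => hs.1.2⟩
  set t := sSup T
  have hat : a ≤ t := le_csSup hbd ⟨⟨le_rfl, hab⟩, ha⟩
  have htb : t ≤ b := csSup_le hne (fun s hs => hs.1.2)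
  have happ : ∀ e > 0, ∃ s ∈ Icc a t, t - e < s ∧ ν s ∈ O := by
    intro e he
    obtain ⟨s, hs, hse⟩ := exists_lt_of_lt_csSup hne (show t - e < sSup T by linarith)
    exact ⟨s, ⟨hs.1.1, le_csSup hbd hs⟩, hse, hs.2⟩
  have hgt : ∀ s ∈ Ioc t b, ν s ∉ O := fun s hs h =>
    absurd (le_csSup hbd ⟨⟨hat.trans hs.1.le, hs.2⟩, h⟩) (not_le.2 hs.1)
  refine ⟨t, ⟨hat, htb⟩, fun s hs h => ?_, happ⟩
  rcases eq_or_lt_of_le hs.1 with rfl | hlt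
  · have hlt : t < b := lt_of_le_of_ne htb (fun h' => hb (h' ▸ h))
    have : ∀ᶠ s in 𝓝[>] t, ν s ∈ O ∧ s ≤ b := by
      refine Filter.Eventually.and ?_ ?_
      · exact mem_nhdsWithin_of_mem_nhds (hν.continuousAt.preimage_mem_nhds (hO.mem_nhds h))
      · exact mem_nhdsWithin_of_mem_nhds (Iic_mem_nhds hlt)
    obtain ⟨s, ⟨h1, h2⟩, h3⟩ := (this.and self_mem_nhdsWithin).exists
    exact hgt s ⟨h3, h2⟩ h1
  · exact hgt s ⟨hlt, hs.2⟩ h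

lemma first_entry {ν : ℝ → ℂ} (hν : Continuous ν) {O : Set ℂ} (hO : IsOpen O) {a b : ℝ}
    (hab : a ≤ b) (ha : ν a ∉ O) (hb : ν b ∈ O) :
    ∃ t ∈ Icc a b, (∀ s ∈ Icc a t, ν s ∉ O) ∧ ∀ e > 0, ∃ s ∈ Icc t b, s < t + e ∧ ν s ∈ O := by
  obtain ⟨t, ht, h1, h2⟩ := last_exit (ν := fun s => ν (-s)) (by fun_prop) hO
    (a := -b) (b := -a) (by linarith) (by simpa using hb) (by simpa using ha)
  refine ⟨-t, ⟨by linarith [ht.2], by linarith [ht.1]⟩, fun s hs => ?_, fun e he => ?_⟩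
  · simpa using h1 (-s) ⟨by linarith [hs.2], by linarith [hs.1]⟩
  · obtain ⟨s, hs, h3, h4⟩ := h2 e he
    exact ⟨-s, ⟨by linarith [hs.2], by linarith [hs.1]⟩, by linarith, h4⟩

lemma singleton_compl_preconnected (x : ℂ) : IsPreconnected ({x}ᶜ : Set ℂ) :=
  lemmaA isCompact_singleton (HasLogs.convex (convex_singleton x))

lemma remove_point {V : Set ℂ} (oV : IsOpen V) (pV : IsPreconnected V)
    (bV : Bornology.IsBounded V) (x : ℂ) : IsPreconnected (V \ {x}) := by
  by_cases hx : x ∈ V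
  · exact lemmaB oV pV bV isCompact_singleton (singleton_compl_preconnected x)
      (Or.inl (by simpa using hx))
  · rwa [sdiff_singleton_eq_self hx]

lemma step (H : ℂ ≃ₜ ℂ) {U N : Set ℂ} (oU : IsOpen U) (pU : IsPreconnected U)
    (cN : Convex ℝ N)
    (h1 : ∀ u ∈ U, ∀ v ∈ U, H u ≠ v) (h2 : ∀ u ∈ N, ∀ v ∈ N, H u ≠ v)
    (h3 : ∀ u ∈ N, ∀ v ∈ U, H u ≠ v) (h4 : ∀ u ∈ U, ∀ v ∈ U, H (H u) ≠ v)
    (h5 : ∀ u ∈ U, ∀ v ∈ N, H (H u) ≠ v)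
    {f0 c0 x0 z : ℂ} (hf0U : f0 ∈ U) (hf0N : f0 ∈ N) (hc0U : c0 ∈ U) (hc0N : H c0 ∈ N)
    (hx0 : x0 ∈ U) (hz : z ∈ U) {M : Set ℂ} (oM : IsOpen M) (hzM : z ∈ M) :
    ∃ Y : Set ℂ, IsCompact Y ∧ IsConnected Y ∧ Y ⊆ U ∪ N ∪ H '' U ∧ x0 ∈ Y ∧ z ∈ Y ∧
      (∃ z' ∈ M ∩ U, H z' ∈ Y) ∧ ∀ u ∈ Y, ∀ v ∈ Y, H u ≠ v := by
  -- the initial tree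
  obtain ⟨X1, tX1, hX1, hX1U, hX1z⟩ := (Tree.singleton x0).extend oU pU (by simpa using hx0) hz
  obtain ⟨X2, tX2, hX2, hX2U, hX2f⟩ := tX1.extend oU pU hX1U hf0U
  obtain ⟨X0, tX0, hX0, hX0U, hX0c⟩ := tX2.extend oU pU hX2U hc0U
  have x0X : x0 ∈ X0 := hX0 (hX2 (hX1 rfl))
  have zX : z ∈ X0 := hX0 (hX2 hX1z)
  have f0X : f0 ∈ X0 := hX0 hX2f
  -- the neighbourhood `V` of `H X0`, a finite union of balls
  have oHU : IsOpen (H '' U) := H.isOpenMap U oU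
  have cHX : IsCompact (H '' X0) := tX0.1.image H.continuous
  have conHX : IsConnected (H '' X0) := tX0.2.1.image H H.continuous.continuousOn
  obtain ⟨r, hr, hrU⟩ := cHX.exists_thickening_subset_open oHU (image_mono hX0U)
  obtain ⟨F, hFX, hFfin, hFcov⟩ := cHX.finite_cover_balls hr
  set V : Set ℂ := ⋃ w ∈ F, Metric.ball w r with hV
  have oV : IsOpen V := isOpen_biUnion fun w _ => Metric.isOpen_ball
  have HXV : H '' X0 ⊆ V := hFcov
  have VHU : V ⊆ H '' U := by
    intro y hy
    simp only [hV, mem_iUnion] at hy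
    obtain ⟨w, hw, hy⟩ := hy
    exact hrU (Metric.mem_thickening_iff.2 ⟨w, hFX hw, hy⟩)
  have pV : IsPreconnected V := by
    refine isPreconnected_of_forall (H x0) (fun y hy => ?_)
    have hy' := hy
    simp only [hV, mem_iUnion] at hy
    obtain ⟨w, hw, hy⟩ := hy
    refine ⟨H '' X0 ∪ Metric.ball w r, union_subset HXV (subset_biUnion_of_mem (u := fun w => Metric.ball w r) hw),
      Or.inl ⟨x0, x0X, rfl⟩, Or.inr hy, ?_⟩
    exact conHX.isPreconnected.union w (hFX hw) (Metric.mem_ball_self hr)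
      (convex_ball w r).isPreconnected
  have bV : Bornology.IsBounded V := by
    rw [hV, Bornology.isBounded_biUnion hFfin]
    exact fun w _ => Metric.isBounded_ball
  set W : Set ℂ := H ⁻¹' V with hW
  have oW : IsOpen W := oV.preimage H.continuous
  have WU : W ⊆ U := by
    intro y hy
    obtain ⟨u, hu, e⟩ := VHU hy
    rwa [← H.injective e]
  have pW : IsPreconnected W := by
    rw [hW, ← H.image_symm]
    exact pV.image _ H.symm.continuous.continuousOn
  have bW : Bornology.IsBounded W := by
    rw [hW, ← H.image_symm]
    exact ((bV.isCompact_closure.image H.symm.continuous).isBounded).subset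
      (image_mono subset_closure)
  have XW : X0 ⊆ W := fun y hy => HXV ⟨y, hy, rfl⟩
  have VU : ∀ y ∈ V, y ∉ U := by
    intro y hy hyU
    obtain ⟨u, hu, e⟩ := VHU hy
    exact h1 u hu y hyU e
  -- the segment
  set ν : ℝ → ℂ := fun t => AffineMap.lineMap f0 (H c0) t with hν
  have cν : Continuous ν := AffineMap.lineMap_continuous
  have νN : ∀ s ∈ Icc (0:ℝ) 1, ν s ∈ N := by
    intro s hs
    apply cN.segment_subset hf0N hc0N
    rw [segment_eq_image_lineMap]
    exact ⟨s, hs, rfl⟩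
  have ν0 : ν 0 = f0 := by simp [hν]
  have ν1 : ν 1 = H c0 := by simp [hν]
  have ν0V : ν 0 ∉ V := by rw [ν0]; exact fun h => VU _ h hf0U
  obtain ⟨s1, hs1, hs1V, hs1app⟩ := first_entry cν oV zero_le_one ν0V
    (by rw [ν1]; exact HXV ⟨c0, hX0c, rfl⟩)
  have bnV : ν s1 ∉ V := hs1V s1 ⟨hs1.1, le_rfl⟩
  have hs1lt : s1 < 1 := lt_of_le_of_ne hs1.2 (fun h => bnV (by
    rw [h, ν1]; exact HXV ⟨c0, hX0c, rfl⟩))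
  have evV : ∀ᶠ s in 𝓝[>] s1, ν s ∈ V := by
    have hcl : s1 ∈ closure (⋃ w ∈ F, {s | s1 ≤ s ∧ ν s ∈ Metric.ball w r}) := by
      rw [Metric.mem_closure_iff]
      intro e he
      obtain ⟨s, hs, h, hsV⟩ := hs1app e he
      simp only [hV, mem_iUnion] at hsV
      obtain ⟨w, hw, hsw⟩ := hsV
      refine ⟨s, ?_, ?_⟩
      · simp only [mem_iUnion]
        exact ⟨w, hw, hs.1, hsw⟩
      · rw [Real.dist_eq, abs_sub_lt_iff]
        constructor <;> linarith [hs.1]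
    rw [hFfin.closure_biUnion] at hcl
    simp only [mem_iUnion] at hcl
    obtain ⟨w, hw, hcl⟩ := hcl
    obtain ⟨e, ⟨he, hew⟩, -⟩ := Metric.mem_closure_iff.1 hcl 1 one_pos
    have inV : ∀ s, ν s ∈ Metric.ball w r → ν s ∈ V := fun s hs =>
      subset_biUnion_of_mem (u := fun w => Metric.ball w r) hw hs
    have hlt : s1 < e := lt_of_le_of_ne he (fun h => bnV (inV _ (h ▸ hew)))
    refine mem_nhdsGT_iff_exists_Ioc_subset.2 ⟨e, hlt, fun s hs => ?_⟩
    obtain ⟨e', ⟨he', hew'⟩, hd⟩ := Metric.mem_closure_iff.1 hcl (s - s1) (by linarith [hs.1])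
    rw [Real.dist_eq, abs_sub_lt_iff] at hd
    apply inV
    have hcv : Convex ℝ (ν ⁻¹' Metric.ball w r) :=
      (convex_ball w r).affine_preimage (AffineMap.lineMap f0 (H c0))
    exact hcv.ordConnected.out hew' hew ⟨by linarith [hd.2], hs.2⟩
  have evall : ∀ᶠ s in 𝓝[>] s1, ν s ∈ V ∧ ν s ≠ H x0 ∧ ν s ≠ H z ∧ s ≤ 1 := by
    have hx : ν s1 ≠ H x0 := fun h => bnV (h ▸ HXV ⟨x0, x0X, rfl⟩)
    have hz : ν s1 ≠ H z := fun h => bnV (h ▸ HXV ⟨z, zX, rfl⟩)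
    refine evV.and (Filter.Eventually.and ?_ (Filter.Eventually.and ?_ ?_))
    · exact mem_nhdsWithin_of_mem_nhds (cν.continuousAt.eventually_ne hx)
    · exact mem_nhdsWithin_of_mem_nhds (cν.continuousAt.eventually_ne hz)
    · exact mem_nhdsWithin_of_mem_nhds (Iic_mem_nhds hs1lt)
  obtain ⟨e, he, heV⟩ := mem_nhdsGT_iff_exists_Ioc_subset.1 evall
  have he : s1 < e := he
  have bnU : ν s1 ∉ W := by
    intro h
    obtain ⟨s, hs⟩ := (evV.and (mem_nhdsWithin_of_mem_nhds
      (cν.continuousAt.preimage_mem_nhds (oW.mem_nhds h)))).exists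
    exact VU _ hs.1 (WU hs.2)
  obtain ⟨ts, hts, htsW, htsapp⟩ := last_exit cν oW hs1.1 (by rw [ν0]; exact XW f0X) bnU
  -- the second tree
  set W' := (W \ {x0}) \ {z} with hW'
  have oW' : IsOpen W' := (oW.sdiff isClosed_singleton).sdiff isClosed_singleton
  have pW' : IsPreconnected W' := remove_point (oW.sdiff isClosed_singleton)
    (remove_point oW pW bW x0) (bW.subset sdiff_subset) z
  obtain ⟨z', ⟨hz'M, hz'W⟩, hz'n⟩ : ((M ∩ W) ∩ ({x0, z} : Set ℂ)ᶜ).Nonempty := by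
    refine (Set.Countable.dense_compl ℝ (toFinite ({x0, z} : Set ℂ)).countable).inter_open_nonempty _ (oM.inter oW) ⟨z, hzM, XW zX⟩
  have hz'W' : z' ∈ W' := by
    simp only [mem_compl_iff, mem_insert_iff, mem_singleton_iff, not_or] at hz'n
    exact ⟨⟨hz'W, hz'n.1⟩, hz'n.2⟩
  set c := H.symm (ν e) with hc
  have Hc : H c = ν e := by simp [hc]
  have hce := heV (⟨he, le_rfl⟩ : e ∈ Ioc s1 e)
  have hcW' : c ∈ W' := by
    refine ⟨⟨?_, fun h => ?_⟩, fun h => ?_⟩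
    · change H c ∈ V
      rw [Hc]; exact hce.1
    · have h : c = x0 := h
      exact hce.2.1 (by rw [← Hc, h])
    · have h : c = z := h
      exact hce.2.2.1 (by rw [← Hc, h])
  obtain ⟨P, tP, hPz, hPW', hPc⟩ := (Tree.singleton z').extend oW' pW'
    (by simpa using hz'W') hcW'
  have hPz' : z' ∈ P := hPz rfl
  have PW : P ⊆ W := fun y hy => (hPW' hy).1.1
  have cHP : IsCompact (H '' P) := tP.1.image H.continuous
  obtain ⟨s2, hs2, hs2P, hs2lt⟩ := first_hit cν cHP.isClosed he.le ⟨c, hPc, Hc⟩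
  set σ := ν '' Icc s1 s2 with hσ
  have cσ : IsCompact σ := isCompact_Icc.image cν
  have cvσ : Convex ℝ σ := (convex_Icc s1 s2).affine_image (AffineMap.lineMap f0 (H c0))
  set Q := P ∪ H.symm '' σ with hQ
  have cQ : IsCompact Q := tP.1.union (cσ.image H.symm.continuous)
  have lQ : HasLogs Q := by
    refine tP.2.2.union ((HasLogs.convex cvσ).image H.symm) tP.1.isClosed
      (cσ.image H.symm.continuous).isClosed (w := H.symm (ν s2)) ?_ ?_ ?_
    · obtain ⟨p, hp, e⟩ := hs2P
      rw [← e]; simpa using hp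
    · exact ⟨ν s2, ⟨s2, ⟨hs2.1, le_rfl⟩, rfl⟩, rfl⟩
    · rintro y hy ⟨_, ⟨t, ht, rfl⟩, rfl⟩
      rcases eq_or_lt_of_le ht.2 with h | h
      · rw [h]
      · exact absurd ⟨_, hy, by simp⟩ (hs2lt t ht.1 h)
  have inV : ∀ t, s1 < t → t ≤ s2 → ν t ∈ V := fun t h h' => (heV ⟨h, h'.trans hs2.2⟩).1
  have pWQ : IsPreconnected (W \ Q) := by
    refine lemmaB oW pW bW cQ (lemmaA cQ lQ) (Or.inr ⟨H.symm (ν s1), ?_, ?_, ?_⟩)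
    · exact Or.inr ⟨ν s1, ⟨s1, ⟨le_rfl, hs2.1⟩, rfl⟩, rfl⟩
    · change H (H.symm (ν s1)) ∉ V
      simpa using bnV
    · rintro y (hy | ⟨_, ⟨t, ht, rfl⟩, rfl⟩)
      · exact Or.inr (PW hy)
      · rcases eq_or_lt_of_le ht.1 with h | h
        · left; rw [h]
        · right
          change H (H.symm (ν t)) ∈ V
          simpa using inV t h ht.2
  have s2le : s2 ≤ 1 := hs2.2.trans hce.2.2.2
  -- choose the parameter
  have tsP : ν ts ∈ Pᶜ := fun h => htsW ts ⟨le_rfl, hts.2⟩ (PW h)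
  obtain ⟨d, hd, hdP⟩ := Metric.isOpen_iff.1 (tP.1.isClosed.isOpen_compl.preimage cν) ts tsP
  obtain ⟨s', hs', hs'd, hs'W⟩ := htsapp d hd
  have s'P : ∀ s ∈ Icc s' ts, ν s ∉ P := by
    intro s hs
    apply hdP
    rw [Metric.mem_ball, Real.dist_eq, abs_sub_lt_iff]
    constructor <;> linarith [hs.1, hs.2]
  have oWQ : IsOpen (W \ Q) := oW.sdiff cQ.isClosed
  have nQ : ∀ y ∈ X0, (y = x0 ∨ y = z) → y ∈ W \ Q := by
    intro y hy hy'
    refine ⟨XW hy, ?_⟩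
    rintro (h | ⟨_, ⟨t, ht, rfl⟩, h⟩)
    · rcases hy' with rfl | rfl
      · exact (hPW' h).1.2 rfl
      · exact (hPW' h).2 rfl
    · have hyt : ν t = H y := by rw [← h]; simp
      rcases eq_or_lt_of_le ht.1 with h' | h'
      · subst h'
        exact bnV (hyt ▸ HXV ⟨y, hy, rfl⟩)
      · have := heV (⟨h', ht.2.trans hs2.2⟩ : t ∈ Ioc s1 e)
        rcases hy' with rfl | rfl
        · exact this.2.1 hyt
        · exact this.2.2.1 hyt
  have s'01 : s' ∈ Icc (0:ℝ) 1 := ⟨hs'.1, hs'.2.trans (hts.2.trans hs1.2)⟩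
  have fQ : ν s' ∈ W \ Q := by
    refine ⟨hs'W, ?_⟩
    rintro (h | ⟨_, ⟨t, ht, rfl⟩, h⟩)
    · exact s'P s' ⟨le_rfl, hs'.2⟩ h
    · exact h2 (ν s') (νN s' s'01) (ν t) (νN t ⟨hs1.1.trans ht.1, ht.2.trans s2le⟩)
        (by rw [← h]; simp)
  obtain ⟨K0, tK0, hK0, hK0W, hK0z⟩ := (Tree.singleton x0).extend oWQ pWQ
    (by simpa using nQ x0 x0X (Or.inl rfl)) (nQ z zX (Or.inr rfl))
  obtain ⟨K, tK, hK, hKW, hKf⟩ := tK0.extend oWQ pWQ hK0W fQ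
  have s's2 : s' ≤ s2 := hs'.2.trans (hts.2.trans hs2.1)
  set L := ν '' Icc s' s2 with hL
  have Lmem : ∀ y ∈ L, ∃ s ∈ Icc s' s2, ν s = y ∧ y ∈ N := by
    rintro y ⟨s, hs, rfl⟩
    exact ⟨s, hs, rfl, νN s ⟨s'01.1.trans hs.1, hs.2.trans s2le⟩⟩
  have KU : ∀ y ∈ K, y ∈ U := fun y hy => WU (hKW hy).1
  refine ⟨K ∪ L ∪ H '' P, ?_, ?_, ?_, ?_, ?_, ?_, ?_⟩
  · exact (tK.1.union (isCompact_Icc.image cν)).union cHP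
  · refine IsConnected.union ?_ (IsConnected.union ?_ tK.2.1 ?_)
      (tP.2.1.image H H.continuous.continuousOn)
    · exact ⟨ν s2, Or.inr ⟨s2, ⟨s's2, le_rfl⟩, rfl⟩, hs2P⟩
    · exact ⟨ν s', hKf, s', ⟨le_rfl, s's2⟩, rfl⟩
    · exact (isConnected_Icc s's2).image ν cν.continuousOn
  · rintro y ((hy | hy) | ⟨p, hp, rfl⟩)
    · exact Or.inl (Or.inl (KU y hy))
    · obtain ⟨s, hs, -, hyN⟩ := Lmem y hy
      exact Or.inl (Or.inr hyN)
    · exact Or.inr ⟨p, WU (PW hp), rfl⟩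
  · exact Or.inl (Or.inl (hK (hK0 rfl)))
  · exact Or.inl (Or.inl (hK hK0z))
  · exact ⟨z', ⟨hz'M, WU hz'W⟩, Or.inr ⟨z', hPz', rfl⟩⟩
  · rintro u ((hu | hu) | ⟨p, hp, rfl⟩) v ((hv | hv) | ⟨p', hp', rfl⟩) huv
    · exact h1 u (KU u hu) v (KU v hv) huv
    · obtain ⟨s, hs, rfl, -⟩ := Lmem v hv
      rcases le_or_gt s s1 with h | h
      · apply hs1V s ⟨s'01.1.trans hs.1, h⟩
        rw [← huv]
        exact (hKW hu).1
      · exact (hKW hu).2 (Or.inr ⟨ν s, ⟨s, ⟨h.le, hs.2⟩, rfl⟩, by rw [← huv]; simp⟩)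
    · exact (hKW hu).2 (Or.inl (by rwa [H.injective huv]))
    · obtain ⟨s, hs, -, huN⟩ := Lmem u hu
      exact h3 u huN v (KU v hv) huv
    · obtain ⟨s, hs, -, huN⟩ := Lmem u hu
      obtain ⟨s, hs, -, hvN⟩ := Lmem v hv
      exact h2 u huN v hvN huv
    · obtain ⟨s, hs, rfl, -⟩ := Lmem u hu
      have huP : ν s ∈ P := by rwa [H.injective huv]
      rcases le_or_gt s ts with h | h
      · exact s'P s ⟨hs.1, h⟩ huP
      · rcases le_or_gt s s1 with h' | h'
        · exact htsW s ⟨h.le, h'⟩ (PW huP)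
        · exact VU _ (inV s h' hs.2) (WU (PW huP))
    · exact h4 p (WU (PW hp)) v (KU v hv) huv
    · obtain ⟨s, hs, -, hvN⟩ := Lmem v hv
      exact h5 p (WU (PW hp)) v hvN huv
    · exact h1 p (WU (PW hp)) p' (WU (PW hp')) (H.injective huv)

end FB

open Set
open Filter

namespace FB
open Topology

/-- the derivative-like logarithm `ρ` -/
def IsRho (H : ℂ → ℂ) (ρ : ℂ → ℂ → ℂ) : Prop :=
  ContinuousOn (Function.uncurry ρ) {p : ℂ × ℂ | p.1 ≠ p.2} ∧ (∀ z w, ρ z w = ρ w z) ∧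
    ∀ z w, z ≠ w → Complex.exp (ρ z w) * (z - w) = H z - H w

lemma IsRho.cont {E : Type*} [TopologicalSpace E] {H : ℂ → ℂ} {ρ : ℂ → ℂ → ℂ} (h : IsRho H ρ)
    {f g : E → ℂ} {S : Set E} (hf : ContinuousOn f S) (hg : ContinuousOn g S)
    (hne : ∀ x ∈ S, f x ≠ g x) : ContinuousOn (fun x => ρ (f x) (g x)) S :=
  h.1.comp (hf.prodMk hg) (fun x hx => hne x hx)

lemma lemmaW {H : ℂ → ℂ} {ρ : ℂ → ℂ → ℂ} (cH : Continuous H) (hρ : IsRho H ρ)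
    (hfix : ∀ z, H z ≠ z) {n : ℝ} (hn : 2 ≤ n) {C δ : ℝ → ℂ} (cC : ContinuousOn C (Icc 0 n))
    (hC : ∀ t ∈ Icc 0 (n - 1), C (t + 1) = H (C t)) (cδ : Continuous δ)
    (δ0 : δ 0 = C n) (δ1 : δ 1 = C 0)
    (d1 : ∀ a b, 0 ≤ a → b ≤ n → 1 ≤ b - a → b - a ≤ n - 1 → C a ≠ C b)
    (d2 : ∀ b ∈ Icc 1 (n - 1), ∀ u, C b ≠ δ u) (d3 : ∀ u u', H (δ u) ≠ δ u') : False := by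
  have epi : Complex.exp (Real.pi * Complex.I) = -1 := Complex.exp_pi_mul_I
  -- θ
  obtain ⟨θ, cθ, eθ⟩ := convex_log (X := (univ : Set ℂ)) convex_univ (f := fun z => H z - z)
    (by fun_prop) (fun z _ => sub_ne_zero.2 (hfix z))
  have cθ : Continuous θ := continuousOn_univ.1 cθ
  have eθ : ∀ z, Complex.exp (θ z) = H z - z := fun z => eθ z (mem_univ z)
  have eρ : ∀ z, Complex.exp (ρ (H z) z) * (H z - z) = H (H z) - H z := fun z =>
    hρ.2.2 _ _ (hfix z)
  obtain ⟨μ, hμ⟩ : ∃ μ, ∀ z, θ (H z) = θ z + ρ (H z) z + μ := by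
    refine ⟨θ (H 0) - (θ 0 + ρ (H 0) 0), fun z => ?_⟩
    have := exp_const (S := (univ : Set ℂ)) isPreconnected_univ (f := fun z => θ (H z))
      (g := fun z => θ z + ρ (H z) z) (by fun_prop)
      (cθ.continuousOn.add (hρ.cont cH.continuousOn continuousOn_id (fun z _ => hfix z)))
      (fun z _ => by
        rw [Complex.exp_add, eθ, eθ, ← eρ]; ring) (mem_univ z) (mem_univ 0)
    linear_combination this
  have eμ : Complex.exp μ = 1 := by
    have h1 : Complex.exp μ = Complex.exp (θ (H 0) - (θ 0 + ρ (H 0) 0)) := by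
      congr 1; rw [hμ 0]; ring
    have hne : H 0 - 0 ≠ 0 := sub_ne_zero.2 (hfix 0)
    rw [h1, Complex.exp_sub, Complex.exp_add, eθ, eθ, ← eρ, mul_comm, div_self]
    exact mul_ne_zero hne (Complex.exp_ne_zero _)
  -- φ
  set R : Set (ℝ × ℝ) := {p | 0 ≤ p.1 ∧ p.2 ≤ n ∧ 1 ≤ p.2 - p.1 ∧ p.2 - p.1 ≤ n - 1} with hR
  have cvR : Convex ℝ R := by
    rintro ⟨a, b⟩ ⟨h1, h2, h3, h4⟩ ⟨a', b'⟩ ⟨h1', h2', h3', h4'⟩ s t hs ht hst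
    simp only at h1 h2 h3 h4 h1' h2' h3' h4'
    have ht' : t = 1 - s := by linarith
    subst ht'
    refine ⟨?_, ?_, ?_, ?_⟩ <;> simp only [Prod.smul_mk, Prod.mk_add_mk, smul_eq_mul] <;> nlinarith
  have cC' : ∀ {E : Type} [TopologicalSpace E] {S : Set E} {f : E → ℝ}, ContinuousOn f S →
      (∀ x ∈ S, f x ∈ Icc 0 n) → ContinuousOn (fun x => C (f x)) S := fun hf h =>
    cC.comp hf h
  obtain ⟨φ₀, cφ₀, eφ₀⟩ := convex_log cvR (f := fun p => C p.2 - C p.1)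
    (by
      refine (cC' continuous_snd.continuousOn ?_).sub (cC' continuous_fst.continuousOn ?_)
      · rintro p ⟨h1, h2, h3, h4⟩
        exact ⟨by linarith, h2⟩
      · rintro p ⟨h1, h2, h3, h4⟩
        exact ⟨h1, by linarith⟩)
    (fun p hp => sub_ne_zero.2 (d1 p.1 p.2 hp.1 hp.2.1 hp.2.2.1 hp.2.2.2).symm)
  have mR : ∀ a b, 0 ≤ a → b ≤ n → 1 ≤ b - a → b - a ≤ n - 1 → (a, b) ∈ R :=
    fun a b h1 h2 h3 h4 => ⟨h1, h2, h3, h4⟩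
  obtain ⟨φ, cφ, eφ, F1⟩ : ∃ φ : ℝ × ℝ → ℂ, ContinuousOn φ R ∧
      (∀ p ∈ R, Complex.exp (φ p) = C p.2 - C p.1) ∧
      ∀ a ∈ Icc 0 (n - 1), φ (a, a + 1) = θ (C a) := by
    have h01 : Complex.exp (φ₀ (0, 1)) = Complex.exp (θ (C 0)) := by
      rw [eφ₀ _ (mR 0 1 le_rfl (by linarith) (by norm_num) (by linarith)), eθ]
      have := hC 0 ⟨le_rfl, by linarith⟩
      rw [zero_add] at this
      rw [this]
    refine ⟨fun p => φ₀ p - (φ₀ (0, 1) - θ (C 0)), cφ₀.sub continuousOn_const, fun p hp => ?_, ?_⟩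
    · rw [Complex.exp_sub, Complex.exp_sub, h01, div_self (Complex.exp_ne_zero _), div_one,
        eφ₀ p hp]
    · intro a ha
      have := exp_const (S := Icc 0 (n - 1)) isPreconnected_Icc
        (f := fun a => φ₀ (a, a + 1)) (g := fun a => θ (C a))
        (cφ₀.comp (by fun_prop) (fun a ha => mR _ _ ha.1 (by linarith [ha.2]) (by linarith)
          (by linarith)))
        (cθ.comp_continuousOn (cC.mono (Icc_subset_Icc_right (by linarith))))
        (fun a ha => by
          rw [eφ₀ _ (mR _ _ ha.1 (by linarith [ha.2]) (by linarith) (by linarith)), eθ]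
          simp only
          rw [hC a ha]) ha (⟨le_rfl, by linarith⟩ : (0:ℝ) ∈ Icc 0 (n - 1))
      simp only [zero_add] at this
      simp only
      linear_combination this
  have hn1 : C n = H (C (n - 1)) := by
    have := hC (n - 1) ⟨by linarith, le_rfl⟩
    rwa [sub_add_cancel] at this
  have hC01 : C 1 = H (C 0) := by
    have := hC 0 ⟨le_rfl, by linarith⟩
    rwa [zero_add] at this
  have F2 : φ (1, n) = φ (0, n - 1) + ρ (C (n - 1)) (C 0) + μ := by
    have := exp_const (S := Icc 1 (n - 1)) isPreconnected_Icc
      (f := fun b => φ (1, b + 1)) (g := fun b => φ (0, b) + ρ (C b) (C 0))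
      (cφ.comp (by fun_prop) (fun b hb => mR _ _ zero_le_one (by linarith [hb.2])
        (by linarith [hb.1]) (by linarith [hb.2])))
      ((cφ.comp (by fun_prop) (fun b hb => mR _ _ le_rfl (by linarith [hb.2])
        (by linarith [hb.1]) (by linarith [hb.2]))).add
        (hρ.cont (cC.mono (Icc_subset_Icc (by linarith) (by linarith))) continuousOn_const
          (fun b hb => (d1 0 b le_rfl (by linarith [hb.2]) (by linarith [hb.1])
            (by linarith [hb.2])).symm)))
      (fun b hb => by
        rw [Complex.exp_add, eφ _ (mR _ _ zero_le_one (by linarith [hb.2])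
          (by linarith [hb.1]) (by linarith [hb.2])), eφ _ (mR _ _ le_rfl (by linarith [hb.2])
          (by linarith [hb.1]) (by linarith [hb.2]))]
        simp only
        rw [hC b ⟨by linarith [hb.1], hb.2⟩, hC01, ← hρ.2.2 _ _ (d1 0 b le_rfl (by linarith [hb.2])
          (by linarith [hb.1]) (by linarith [hb.2])).symm]
        ring)
      (⟨by linarith, le_rfl⟩ : n - 1 ∈ Icc 1 (n - 1)) (⟨le_rfl, by linarith⟩ : (1:ℝ) ∈ Icc 1 (n - 1))
    simp only [sub_add_cancel] at this
    have h1 := F1 1 ⟨zero_le_one, by linarith⟩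
    have h0 := F1 0 ⟨le_rfl, by linarith⟩
    rw [zero_add] at h0
    have h2 := hμ (C 0)
    rw [← hC01] at h2
    rw [h1, h0, h2] at this
    linear_combination this
  -- ψ
  set B : Set (ℝ × ℝ) := Icc 1 (n - 1) ×ˢ univ with hB
  obtain ⟨ψ₀, cψ₀, eψ₀⟩ := convex_log ((convex_Icc (𝕜 := ℝ) 1 (n - 1)).prod convex_univ)
    (f := fun p : ℝ × ℝ => C p.1 - δ p.2)
    (by
      refine (cC' continuous_fst.continuousOn ?_).sub (by fun_prop)
      rintro p ⟨h1, h2⟩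
      exact ⟨by linarith [h1.1], by linarith [h1.2]⟩)
    (fun p hp => sub_ne_zero.2 (d2 p.1 hp.1 p.2))
  have i1 : (1:ℝ) ∈ Icc 1 (n - 1) := ⟨le_rfl, by linarith⟩
  have in1 : n - 1 ∈ Icc 1 (n - 1) := ⟨by linarith, le_rfl⟩
  have m0 : ∀ b ∈ Icc 1 (n - 1), ((0, b) : ℝ × ℝ) ∈ R := fun b hb =>
    mR _ _ le_rfl (by linarith [hb.2]) (by linarith [hb.1]) (by linarith [hb.2])
  have mn : ∀ b ∈ Icc 1 (n - 1), ((b, n) : ℝ × ℝ) ∈ R := fun b hb =>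
    mR _ _ (by linarith [hb.1]) le_rfl (by linarith [hb.2]) (by linarith [hb.1])
  obtain ⟨ψ, cψ, eψ, F3⟩ : ∃ ψ : ℝ × ℝ → ℂ, ContinuousOn ψ B ∧
      (∀ p ∈ B, Complex.exp (ψ p) = C p.1 - δ p.2) ∧
      ∀ b ∈ Icc 1 (n - 1), ψ (b, 1) = φ (0, b) := by
    have hb1 : ∀ b ∈ Icc 1 (n - 1), Complex.exp (ψ₀ (b, 1)) = Complex.exp (φ (0, b)) := by
      intro b hb
      rw [eψ₀ (b, 1) ⟨hb, mem_univ _⟩, eφ _ (m0 b hb), δ1]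
    refine ⟨fun p => ψ₀ p - (ψ₀ (1, 1) - φ (0, 1)), cψ₀.sub continuousOn_const, fun p hp => ?_, ?_⟩
    · rw [Complex.exp_sub, Complex.exp_sub, hb1 1 i1, div_self (Complex.exp_ne_zero _), div_one,
        eψ₀ p hp]
    · intro b hb
      have := exp_const (S := Icc 1 (n - 1)) isPreconnected_Icc
        (f := fun b => ψ₀ (b, 1)) (g := fun b => φ (0, b))
        (cψ₀.comp (by fun_prop) (fun b hb => ⟨hb, mem_univ _⟩))
        (cφ.comp (by fun_prop) m0) hb1 hb i1
      simp only at this ⊢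
      linear_combination this
  obtain ⟨c, hc⟩ : ∃ c, ∀ b ∈ Icc 1 (n - 1), ψ (b, 0) = φ (b, n) + c := by
    refine ⟨ψ (1, 0) - φ (1, n), fun b hb => ?_⟩
    have := exp_const (S := Icc 1 (n - 1)) isPreconnected_Icc
      (f := fun b => ψ (b, 0)) (g := fun b => φ (b, n) + Real.pi * Complex.I)
      (cψ.comp (by fun_prop) (fun b hb => ⟨hb, mem_univ _⟩))
      ((cφ.comp (by fun_prop) mn).add continuousOn_const)
      (fun b hb => by
        rw [eψ (b, 0) ⟨hb, mem_univ _⟩, Complex.exp_add, epi, eφ _ (mn b hb), δ0]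
        ring) hb i1
    linear_combination this
  have ec : Complex.exp c = -1 := by
    have h1 : Complex.exp c = Complex.exp (ψ (1, 0) - φ (1, n)) := by
      congr 1; rw [hc 1 i1]; ring
    have h2 := eψ (1, 0) ⟨i1, mem_univ _⟩
    have h3 := eφ _ (mn 1 i1)
    have h4 : Complex.exp (φ (1, n)) ≠ 0 := Complex.exp_ne_zero _
    rw [h1, Complex.exp_sub, div_eq_iff h4, h2, h3, δ0]
    ring
  -- χ
  set χ : ℝ → ℂ := fun u => ψ (n - 1, u) + ρ (C (n - 1)) (δ u) + μ with hχ
  have cχ : Continuous χ := by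
    rw [← continuousOn_univ]
    refine (ContinuousOn.add ?_ ?_).add continuousOn_const
    · exact cψ.comp (by fun_prop) (fun u _ => ⟨in1, mem_univ _⟩)
    · exact hρ.cont continuousOn_const cδ.continuousOn (fun u _ => d2 _ in1 u)
  have eχ : ∀ u, Complex.exp (χ u) = C n - H (δ u) := by
    intro u
    rw [hχ]
    simp only
    rw [Complex.exp_add, Complex.exp_add, eμ, eψ (n - 1, u) ⟨in1, mem_univ _⟩, hn1,
      ← hρ.2.2 _ _ (d2 _ in1 u)]
    ring
  have χ1 : χ 1 = φ (1, n) := by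
    rw [hχ]; simp only; rw [F3 _ in1, F2, δ1]
  have χ0 : χ 0 = θ (C n) + c := by
    have h1 := F1 (n - 1) ⟨by linarith, le_rfl⟩
    rw [sub_add_cancel] at h1
    have h2 := hμ (C (n - 1))
    rw [← hn1] at h2
    rw [hχ]; simp only
    rw [hc _ in1, h1, δ0, h2, hρ.2.1]; ring
  -- ω
  obtain ⟨ω, cω, eω⟩ := convex_log (X := (univ : Set (ℝ × ℝ))) convex_univ
    (f := fun p => δ p.1 - H (δ p.2)) (by fun_prop) (fun p _ => sub_ne_zero.2 (d3 _ _).symm)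
  have cω : Continuous ω := continuousOn_univ.1 cω
  have eω : ∀ p, Complex.exp (ω p) = δ p.1 - H (δ p.2) := fun p => eω p (mem_univ p)
  have G1 := exp_const (S := (univ : Set ℝ)) isPreconnected_univ (f := fun u => ω (0, u)) (g := χ)
    (by fun_prop) cχ.continuousOn (fun u _ => by rw [eω, eχ, δ0]) (mem_univ 0) (mem_univ 1)
  have G2 := exp_const (S := (univ : Set ℝ)) isPreconnected_univ (f := fun u => ω (u, u))
    (g := fun u => θ (δ u) + Real.pi * Complex.I)
    (by fun_prop) (by fun_prop) (fun u _ => by rw [eω, Complex.exp_add, epi, eθ]; ring)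
    (mem_univ 0) (mem_univ 1)
  have G3 := exp_const (S := (univ : Set ℝ)) isPreconnected_univ (f := fun u => ω (u, 1))
    (g := fun u => ψ (1, u) + Real.pi * Complex.I)
    (by fun_prop) ((cψ.comp (by fun_prop) (fun u _ => ⟨i1, mem_univ _⟩)).add continuousOn_const)
    (fun u _ => by
      rw [eω, Complex.exp_add, epi, eψ (1, u) ⟨i1, mem_univ _⟩, δ1, hC01]; ring)
    (mem_univ 0) (mem_univ 1)
  have h0 := F1 0 ⟨le_rfl, by linarith⟩
  rw [zero_add] at h0
  rw [χ0, χ1] at G1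
  rw [δ0, δ1] at G2
  rw [F3 1 i1, hc 1 i1, h0] at G3
  have : 2 * c = 0 := by linear_combination G2 - G1 - G3
  have hc0 : c = 0 := by simpa using this
  rw [hc0, Complex.exp_zero] at ec
  norm_num at ec

end FB

open Set
open Filter

namespace FB
open Topology

def EF (Λ : AddSubgroup ℂ) (H : ℂ ≃ₜ ℂ) (S : Set ℂ) : Prop := ∀ u ∈ S, ∀ v ∈ S, H u - v ∉ Λ

lemma EF.mono {Λ : AddSubgroup ℂ} {H : ℂ ≃ₜ ℂ} {S T : Set ℂ} (h : EF Λ H T) (hST : S ⊆ T) :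
    EF Λ H S := fun u hu v hv => h u (hST hu) v (hST hv)

structure Setup (Λ : AddSubgroup ℂ) (H : ℂ ≃ₜ ℂ) : Prop where
  closed : IsClosed (Λ : Set ℂ)
  equi : ∀ z, ∀ l ∈ Λ, H (z + l) = H z + l
  free : ∀ z, H z - z ∉ Λ
  rho : ∃ ρ, IsRho H ρ

def NoRet (Λ : AddSubgroup ℂ) (H : ℂ ≃ₜ ℂ) (n : ℕ) : Prop :=
  ∀ K : Set ℂ, IsCompact K → IsPathConnected K → EF Λ H K →
    ∀ x ∈ K, ∀ y ∈ K, H^[n] x - y ∉ Λ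

def Rel (Λ : AddSubgroup ℂ) (H H' : ℂ ≃ₜ ℂ) : Prop :=
  (∃ l ∈ Λ, ∀ z, H' z = H z + l) ∨ ∃ l ∈ Λ, ∀ z, H' z = H.symm z + l

section
variable {Λ : AddSubgroup ℂ} {H H' : ℂ ≃ₜ ℂ}

lemma Setup.symm_equi (S : Setup Λ H) (z : ℂ) {l : ℂ} (hl : l ∈ Λ) :
    H.symm (z + l) = H.symm z + l := by
  apply H.injective
  rw [S.equi _ l hl]; simp

lemma Setup.iter_equi (S : Setup Λ H) (n : ℕ) (z : ℂ) {l : ℂ} (hl : l ∈ Λ) :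
    H^[n] (z + l) = H^[n] z + l := by
  induction n generalizing z with
  | zero => rfl
  | succ n ih => rw [Function.iterate_succ_apply, Function.iterate_succ_apply, S.equi _ l hl, ih]

lemma Rel.setup (S : Setup Λ H) (R : Rel Λ H H') : Setup Λ H' := by
  obtain ⟨ρ, hρ⟩ := S.rho
  rcases R with ⟨l, hl, h⟩ | ⟨l, hl, h⟩
  · refine ⟨S.closed, fun z m hm => ?_, fun z hz => ?_, ρ, hρ.1, hρ.2.1, fun z w hzw => ?_⟩
    · rw [h, h, S.equi z m hm]; ring
    · apply S.free z
      rw [h] at hz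
      have := Λ.sub_mem hz hl
      rwa [show H z + l - z - l = H z - z by ring] at this
    · rw [h, h, hρ.2.2 z w hzw]; ring
  · refine ⟨S.closed, fun z m hm => ?_, fun z hz => ?_,
      fun z w => -ρ (H.symm z) (H.symm w), ?_, fun z w => ?_, fun z w hzw => ?_⟩
    · rw [h, h, S.symm_equi z hm]; ring
    · apply S.free (H.symm z)
      rw [h] at hz
      have := Λ.neg_mem (Λ.sub_mem hz hl)
      rw [H.apply_symm_apply]
      rwa [show -(H.symm z + l - z - l) = z - H.symm z by ring] at this
    · refine ContinuousOn.neg (hρ.cont (S := {p : ℂ × ℂ | p.1 ≠ p.2}) (f := fun p => H.symm p.1)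
        (g := fun p => H.symm p.2) ?_ ?_ ?_)
      · exact (H.symm.continuous.comp continuous_fst).continuousOn
      · exact (H.symm.continuous.comp continuous_snd).continuousOn
      · exact fun p hp e => hp (H.symm.injective e)
    · simp only
      rw [hρ.2.1]
    · have := hρ.2.2 (H.symm z) (H.symm w) (fun e => hzw (H.symm.injective e))
      simp only [H.apply_symm_apply] at this
      rw [h, h, ← this, Complex.exp_neg, ← mul_assoc, inv_mul_cancel₀ (Complex.exp_ne_zero _)]
      ring

lemma Rel.ef_imp (S : Setup Λ H) (R : Rel Λ H H') {K : Set ℂ} (hK : EF Λ H K) : EF Λ H' K := by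
  rcases R with ⟨l, hl, h⟩ | ⟨l, hl, h⟩
  · intro u hu v hv hm
    apply hK u hu v hv
    rw [h] at hm
    have := Λ.sub_mem hm hl
    rwa [show H u + l - v - l = H u - v by ring] at this
  · intro u hu v hv hm
    rw [h] at hm
    have h1 : H.symm u - v ∈ Λ := by
      have := Λ.sub_mem hm hl
      rwa [show H.symm u + l - v - l = H.symm u - v by ring] at this
    apply hK v hv u hu
    have h2 : u = H v + (H.symm u - v) := by
      rw [← S.equi _ _ h1]; simp
    have h3 : H v - u = -(H.symm u - v) := by linear_combination -h2
    rw [h3]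
    exact Λ.neg_mem h1

lemma Rel.symm (S : Setup Λ H) (R : Rel Λ H H') : Rel Λ H' H := by
  rcases R with ⟨l, hl, h⟩ | ⟨l, hl, h⟩
  · exact Or.inl ⟨-l, Λ.neg_mem hl, fun z => by rw [h]; ring⟩
  · refine Or.inr ⟨l, hl, fun z => ?_⟩
    have : H' (H z + l) = z + l + l := by rw [h, S.symm_equi _ hl]; simp
    have h2 : H.symm (H z) = z := by simp
    have h3 : H'.symm z = H z - l := by
      apply H'.injective
      rw [H'.apply_symm_apply, sub_eq_add_neg, (Rel.setup S (Or.inr ⟨l, hl, h⟩)).equi _ _ (Λ.neg_mem hl), h, h2]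
      ring
    rw [h3]; ring

lemma Rel.noRetK (S : Setup Λ H) (R : Rel Λ H H') {n : ℕ} {K : Set ℂ}
    (hn : ∀ x ∈ K, ∀ y ∈ K, H^[n] x - y ∉ Λ) : ∀ x ∈ K, ∀ y ∈ K, H'^[n] x - y ∉ Λ := by
  intro x hx y hy hm
  rcases R with ⟨l, hl, h⟩ | ⟨l, hl, h⟩
  · have key : ∀ n, H'^[n] x - H^[n] x ∈ Λ := by
      intro n
      induction n with
      | zero => simp
      | succ n ih =>
        rw [Function.iterate_succ_apply', Function.iterate_succ_apply', h]
        have := S.equi (H^[n] x) _ ih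
        rw [add_sub_cancel] at this
        rw [this]
        have := Λ.add_mem ih hl
        convert this using 1; ring
    apply hn x hx y hy
    have := Λ.sub_mem hm (key n)
    convert this using 1; ring
  · have key : ∀ n, H^[n] (H'^[n] x) - x ∈ Λ := by
      intro n
      induction n with
      | zero => simp
      | succ n ih =>
        rw [Function.iterate_succ_apply' H', Function.iterate_succ_apply, h, S.equi _ _ hl,
          H.apply_symm_apply, S.iter_equi n _ hl]
        have := Λ.add_mem ih hl
        convert this using 1; ring
    apply hn y hy x hx
    have h1 := S.iter_equi n y hm
    rw [add_sub_cancel] at h1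
    have h2 := key n
    rw [h1] at h2
    have := Λ.sub_mem h2 hm
    convert this using 1; ring

lemma Rel.noRet (S : Setup Λ H) (R : Rel Λ H H') {n : ℕ} (hn : NoRet Λ H n) : NoRet Λ H' n :=
  fun K cK pK eK => R.noRetK S (hn K cK pK (Rel.ef_imp (Rel.setup S R) (R.symm S) eK))

/-- Growth along a segment. -/
lemma growth (S : Setup Λ H) {K : Set ℂ} (cK : IsCompact K) (eK : EF Λ H K) {x : ℂ} (hx : x ∈ K) :
    ∃ H', Rel Λ H H' ∧ ∃ σ : ℝ → ℂ, Continuous σ ∧ σ 0 ∈ K ∧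
      (∀ t < 1, EF Λ H' (K ∪ σ '' Icc 0 t)) ∧ ∃ p ∈ K ∪ σ '' Ico 0 1, H' p = σ 1 := by
  set τ : ℝ → ℂ := fun t => AffineMap.lineMap x (H x) t with hτ
  have cτ : Continuous τ := AffineMap.lineMap_continuous
  have τ0 : τ 0 = x := by simp [hτ]
  have τ1 : τ 1 = H x := by simp [hτ]
  set G : Set (ℂ × ℂ) := {p | H p.1 - p.2 ∈ Λ ∨ H p.2 - p.1 ∈ Λ} with hG
  have clG : IsClosed G := by
    have h1 : IsClosed {p : ℂ × ℂ | H p.1 - p.2 ∈ Λ} :=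
      S.closed.preimage (f := fun p : ℂ × ℂ => H p.1 - p.2)
        ((H.continuous.comp continuous_fst).sub continuous_snd)
    have h2 : IsClosed {p : ℂ × ℂ | H p.2 - p.1 ∈ Λ} :=
      S.closed.preimage (f := fun p : ℂ × ℂ => H p.2 - p.1)
        ((H.continuous.comp continuous_snd).sub continuous_fst)
    exact h1.union h2
  set B1 : Set ℝ := Prod.snd '' ((K ×ˢ Icc (0:ℝ) 1) ∩ {p | (p.1, τ p.2) ∈ G}) with hB1
  set B2 : Set ℝ := Prod.snd '' ((Icc (0:ℝ) 1 ×ˢ Icc (0:ℝ) 1) ∩ {p | p.1 ≤ p.2 ∧ (τ p.1, τ p.2) ∈ G})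
    with hB2
  have cB1 : IsCompact B1 := by
    refine IsCompact.image ?_ continuous_snd
    refine (cK.prod isCompact_Icc).inter_right (clG.preimage (f := fun p : ℂ × ℝ => (p.1, τ p.2)) (by fun_prop))
  have cB2 : IsCompact B2 := by
    refine IsCompact.image ?_ continuous_snd
    refine (isCompact_Icc.prod isCompact_Icc).inter_right (IsClosed.inter ?_
      (clG.preimage (f := fun p : ℝ × ℝ => (τ p.1, τ p.2)) (by fun_prop)))
    exact isClosed_le continuous_fst continuous_snd
  have i01 : (1:ℝ) ∈ Icc (0:ℝ) 1 := ⟨zero_le_one, le_rfl⟩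
  obtain ⟨T, hT, hTmin⟩ := (cB1.union cB2).exists_isLeast ⟨1, Or.inl ⟨(x, 1), ⟨⟨hx, i01⟩, by
    left; simp [τ1]⟩, rfl⟩⟩
  have hT01 : T ∈ Icc (0:ℝ) 1 := by
    rcases hT with ⟨p, hp, rfl⟩ | ⟨p, hp, rfl⟩
    · exact hp.1.2
    · exact hp.1.2
  have nB : ∀ t, t < T → t ∉ B1 ∪ B2 := fun t ht h => absurd (hTmin h) (not_le.2 ht)
  have hTpos : 0 < T := by
    rcases eq_or_lt_of_le hT01.1 with h | h
    · exfalso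
      rw [← h] at hT
      rcases hT with ⟨⟨p, t⟩, ⟨hp, hpG⟩, ht⟩ | ⟨⟨s, t⟩, ⟨hp, hst, hpG⟩, ht⟩
      · simp only at ht; subst ht
        simp only [hG, mem_ofPred_eq, τ0] at hpG
        rcases hpG with h | h
        · exact eK p hp.1 x hx h
        · exact eK x hx p hp.1 h
      · simp only at ht; subst ht
        simp only at hst
        have hs0 : s = 0 := le_antisymm hst hp.1.1
        subst hs0
        simp only [hG, mem_ofPred_eq, τ0, or_self] at hpG
        exact eK x hx x hx hpG
    · exact h
  have ef : ∀ t < T, EF Λ H (K ∪ τ '' Icc 0 t) := by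
    intro t ht u hu v hv huv
    rcases hu with hu | ⟨s, hs, rfl⟩ <;> rcases hv with hv | ⟨s', hs', rfl⟩
    · exact eK u hu v hv huv
    · exact nB s' (hs'.2.trans_lt ht) (Or.inl ⟨(u, s'), ⟨⟨hu, hs'.1, hs'.2.trans (ht.le.trans hT01.2)⟩,
        Or.inl huv⟩, rfl⟩)
    · exact nB s (hs.2.trans_lt ht) (Or.inl ⟨(v, s), ⟨⟨hv, hs.1, hs.2.trans (ht.le.trans hT01.2)⟩,
        Or.inr huv⟩, rfl⟩)
    · have i1 : s ∈ Icc (0:ℝ) 1 := ⟨hs.1, hs.2.trans (ht.le.trans hT01.2)⟩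
      have i2 : s' ∈ Icc (0:ℝ) 1 := ⟨hs'.1, hs'.2.trans (ht.le.trans hT01.2)⟩
      rcases le_total s s' with h | h
      · exact nB s' (hs'.2.trans_lt ht) (Or.inr ⟨(s, s'), ⟨⟨i1, i2⟩, h, Or.inl huv⟩, rfl⟩)
      · exact nB s (hs.2.trans_lt ht) (Or.inr ⟨(s', s), ⟨⟨i2, i1⟩, h, Or.inr huv⟩, rfl⟩)
  obtain ⟨p, hp, hpG⟩ : ∃ p ∈ K ∪ τ '' Ico 0 T, (p, τ T) ∈ G := by
    rcases hT with ⟨⟨p, t⟩, ⟨hp, hpG⟩, ht⟩ | ⟨⟨s, t⟩, ⟨hp, hst, hpG⟩, ht⟩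
    · simp only at ht; subst ht
      exact ⟨p, Or.inl hp.1, hpG⟩
    · simp only at ht; subst ht
      refine ⟨τ s, Or.inr ⟨s, ⟨hp.1.1, lt_of_le_of_ne hst ?_⟩, rfl⟩, hpG⟩
      rintro h
      rw [h] at hpG
      rcases hpG with h | h
      · exact S.free _ h
      · exact S.free _ h
  set σ : ℝ → ℂ := fun t => τ (T * t) with hσ
  have sub : ∀ t, σ '' Icc 0 t ⊆ τ '' Icc 0 (T * t) := by
    rintro t _ ⟨s, hs, rfl⟩
    exact ⟨T * s, ⟨mul_nonneg hT01.1 hs.1, mul_le_mul_of_nonneg_left hs.2 hT01.1⟩, rfl⟩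
  have ef' : ∀ t < 1, EF Λ H (K ∪ σ '' Icc 0 t) := by
    intro t ht
    exact (ef (T * t) (by nlinarith)).mono (union_subset_union_right _ (sub t))
  have hp' : p ∈ K ∪ σ '' Ico 0 1 := by
    rcases hp with hp | ⟨s, hs, rfl⟩
    · exact Or.inl hp
    · refine Or.inr ⟨s / T, ⟨div_nonneg hs.1 hT01.1, (div_lt_one hTpos).2 hs.2⟩, ?_⟩
      simp only [hσ]
      congr 1; field_simp
  have hσ1 : σ 1 = τ T := by simp [hσ]
  have hσ0 : σ 0 ∈ K := by simp [hσ, τ0, hx]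
  have cσ : Continuous σ := by fun_prop
  rcases hpG with h | h
  · have R : Rel Λ H (H.trans (Homeomorph.addRight (-(H p - τ T)))) :=
      Or.inl ⟨-(H p - τ T), Λ.neg_mem h, fun z => rfl⟩
    refine ⟨_, R, σ, cσ, hσ0, fun t ht => R.ef_imp S (ef' t ht), p, hp', ?_⟩
    simp [hσ1]
  · simp only at h
    have R : Rel Λ H (H.symm.trans (Homeomorph.addRight (H (τ T) - p))) :=
      Or.inr ⟨_, h, fun z => rfl⟩
    refine ⟨_, R, σ, cσ, hσ0, fun t ht => R.ef_imp S (ef' t ht), p, hp', ?_⟩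
    have := S.symm_equi p h
    rw [add_sub_cancel, H.symm_apply_apply] at this
    rw [hσ1]; exact this.symm

end

lemma joinedIn_real {S : Set ℂ} {x y : ℂ} (h : JoinedIn S x y) :
    ∃ α : ℝ → ℂ, Continuous α ∧ α 0 = x ∧ α 1 = y ∧ ∀ t, α t ∈ S := by
  obtain ⟨γ, hγ⟩ := h
  refine ⟨γ.extend, γ.continuous_extend, γ.extend_zero, γ.extend_one, fun t => ?_⟩
  have : γ.extend t ∈ range γ := by rw [← γ.extend_range]; exact mem_range_self t
  obtain ⟨s, hs⟩ := this
  rw [← hs]; exact hγ s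

lemma joinedIn_of_real {S : Set ℂ} {α : ℝ → ℂ} (cα : Continuous α) {a b : ℝ}
    (h : ∀ t ∈ uIcc a b, α t ∈ S) : JoinedIn S (α a) (α b) := by
  refine JoinedIn.ofLine (f := fun t => α (a + t * (b - a))) (by fun_prop) (by simp) (by simp) ?_
  rintro _ ⟨t, ht, rfl⟩
  apply h
  rw [← segment_eq_uIcc, segment_eq_image']
  exact ⟨t, ht, by simp⟩

end FB

open Set
open Filter

namespace FB
open Topology

section
variable {Λ : AddSubgroup ℂ} {H H' : ℂ ≃ₜ ℂ}

lemma growth' (S : Setup Λ H) {K : Set ℂ} (cK : IsCompact K) (eK : EF Λ H K) {n : ℕ}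
    (hr : ∃ x ∈ K, ∃ y ∈ K, H^[n] x - y ∈ Λ) :
    ∃ H', Rel Λ H H' ∧ (∃ x ∈ K, ∃ y ∈ K, H'^[n] x - y ∈ Λ) ∧
      ∃ σ : ℝ → ℂ, Continuous σ ∧ σ 0 ∈ K ∧
      (∀ t < 1, EF Λ H' (K ∪ σ '' Icc 0 t)) ∧ ∃ p ∈ K ∪ σ '' Ico 0 1, H' p = σ 1 := by
  obtain ⟨x, hx, y, hy, hxy⟩ := hr
  obtain ⟨H', R, h⟩ := growth S cK eK hx
  refine ⟨H', R, ?_, h⟩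
  by_contra hne
  push Not at hne
  exact (R.symm S).noRetK (R.setup S) hne x hx y hy hxy

lemma pathConn_grow {K : Set ℂ} (pK : IsPathConnected K) {σ : ℝ → ℂ} (cσ : Continuous σ)
    (h0 : σ 0 ∈ K) {t : ℝ} (ht : 0 ≤ t) : IsPathConnected (K ∪ σ '' Icc 0 t) := by
  refine pK.union ?_ ⟨σ 0, h0, 0, ⟨le_rfl, ht⟩, rfl⟩
  exact ((convex_Icc 0 t).isPathConnected ⟨0, le_rfl, ht⟩).image cσ

lemma grow_two {K : Set ℂ} (cK : IsCompact K) (pK : IsPathConnected K) {σ : ℝ → ℂ}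
    (cσ : Continuous σ) (h0 : σ 0 ∈ K) (ef : ∀ t < 1, EF Λ H (K ∪ σ '' Icc 0 t)) {u v : ℂ}
    (hu : u ∈ K ∪ σ '' Ico 0 1) (hv : v ∈ K ∪ σ '' Ico 0 1) :
    ∃ L, IsCompact L ∧ IsPathConnected L ∧ EF Λ H L ∧ u ∈ L ∧ v ∈ L ∧ L ⊆ K ∪ σ '' Ico 0 1 := by
  have key : ∀ u ∈ K ∪ σ '' Ico 0 1, ∃ t, 0 ≤ t ∧ t < 1 ∧ u ∈ K ∪ σ '' Icc 0 t := by
    rintro u (hu | ⟨s, hs, rfl⟩)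
    · exact ⟨0, le_rfl, one_pos, Or.inl hu⟩
    · exact ⟨s, hs.1, hs.2, Or.inr ⟨s, ⟨hs.1, le_rfl⟩, rfl⟩⟩
  obtain ⟨t, ht0, ht1, hut⟩ := key u hu
  obtain ⟨s, hs0, hs1, hvs⟩ := key v hv
  have mono : ∀ a b : ℝ, a ≤ b → K ∪ σ '' Icc 0 a ⊆ K ∪ σ '' Icc 0 b := fun a b hab =>
    union_subset_union_right _ (image_mono (Icc_subset_Icc_right hab))
  refine ⟨K ∪ σ '' Icc 0 (max t s), cK.union (isCompact_Icc.image cσ),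
    pathConn_grow pK cσ h0 (ht0.trans (le_max_left _ _)), ef _ (max_lt ht1 hs1),
    mono _ _ (le_max_left _ _) hut, mono _ _ (le_max_right _ _) hvs,
    union_subset_union_right _ (image_mono ?_)⟩
  exact fun r hr => ⟨hr.1, hr.2.trans_lt (max_lt ht1 hs1)⟩

end

/-- concatenation -/
lemma concat_cont {α β : ℝ → ℂ} (cα : Continuous α) (cβ : Continuous β) (h : α 1 = β 0) :
    Continuous (fun t : ℝ => if t ≤ 1 / 2 then α (2 * t) else β (2 * t - 1)) := by
  refine Continuous.if_le (by fun_prop) (by fun_prop) continuous_id continuous_const ?_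
  rintro t ht
  rw [ht]; norm_num [h]

/-- the invariant curve generated by a path from `x` to `H x` -/
noncomputable def inv_curve (H : ℂ → ℂ) (c : ℝ → ℂ) (t : ℝ) : ℂ := H^[⌊t⌋₊] (c (t - ⌊t⌋₊))

lemma inv_curve_eq {H : ℂ → ℂ} {c : ℝ → ℂ} (h : c 1 = H (c 0)) (m : ℕ) {t : ℝ}
    (ht : t ∈ Icc (m : ℝ) (m + 1)) : inv_curve H c t = H^[m] (c (t - m)) := by
  rcases eq_or_lt_of_le ht.2 with e | hlt
  · have : ⌊t⌋₊ = m + 1 := by rw [e]; exact_mod_cast Nat.floor_natCast (m + 1)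
    rw [inv_curve, this, e]
    simp [h]
  · have : ⌊t⌋₊ = m := by
      rw [Nat.floor_eq_iff (by linarith [ht.1, (Nat.cast_nonneg m : (0:ℝ) ≤ m)])]
      exact ⟨ht.1, hlt⟩
    rw [inv_curve, this]

lemma inv_curve_cont {H : ℂ → ℂ} (cH : Continuous H) {c : ℝ → ℂ} (cc : Continuous c)
    (h : c 1 = H (c 0)) (n : ℕ) : ContinuousOn (inv_curve H c) (Icc (0:ℝ) n) := by
  induction n with
  | zero =>
    simp only [Nat.cast_zero, Icc_self]
    exact continuousOn_singleton _ _
  | succ n ih =>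
    refine glue_closed (C := Icc (0:ℝ) n) (D := Icc (n:ℝ) (n + 1)) isClosed_Icc isClosed_Icc ?_ ?_ ?_
    · intro t ht
      push_cast at ht
      rcases le_total t n with h | h
      · exact Or.inl ⟨ht.1, h⟩
      · exact Or.inr ⟨h, ht.2⟩
    · exact ih.mono inter_subset_right
    · refine ContinuousOn.congr (f := fun t => H^[n] (c (t - n))) ?_
        (fun t ht => inv_curve_eq h n ht.2)
      exact ((cH.iterate n).comp (by fun_prop)).continuousOn

lemma inv_curve_succ {H : ℂ → ℂ} {c : ℝ → ℂ} {t : ℝ} (ht : 0 ≤ t) :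
    inv_curve H c (t + 1) = H (inv_curve H c t) := by
  rw [inv_curve, inv_curve, Nat.floor_add_one ht, Function.iterate_succ_apply']
  congr 3; push_cast; ring

lemma inv_curve_mem {H : ℂ → ℂ} {c : ℝ → ℂ} {A : Set ℂ}
    (h1 : ∀ t, 0 ≤ t → t < 1 / 2 → c t ∈ A) (h2 : ∀ t, 1 / 2 ≤ t → t ≤ 1 → c t ∈ H '' A)
    {t : ℝ} (ht : 0 ≤ t) : ∃ a ∈ A, inv_curve H c t = H^[⌊t + 1 / 2⌋₊] a := by
  have hm := Nat.floor_le ht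
  have hm' := Nat.lt_floor_add_one t
  rcases lt_or_ge (t - ⌊t⌋₊) (1 / 2) with h | h
  · have e : ⌊t + 1 / 2⌋₊ = ⌊t⌋₊ := by
      rw [Nat.floor_eq_iff (by positivity)]
      constructor <;> linarith
    exact ⟨_, h1 _ (by linarith) h, by rw [e, inv_curve]⟩
  · have e : ⌊t + 1 / 2⌋₊ = ⌊t⌋₊ + 1 := by
      rw [Nat.floor_eq_iff (by positivity)]
      push_cast
      constructor <;> linarith
    obtain ⟨a, ha, hae⟩ := h2 (t - ⌊t⌋₊) h (by linarith)
    exact ⟨a, ha, by rw [e, inv_curve, ← hae, Function.iterate_succ_apply]⟩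

theorem thmP (n : ℕ) : ∀ {H : ℂ ≃ₜ ℂ}, Setup ⊥ H → 1 ≤ n → NoRet ⊥ H n := by
  induction n using Nat.strong_induction_on with
  | _ n ih =>
  intro H S hn K cK pK eK x₀ hx₀ y₀ hy₀ hxy₀
  rcases eq_or_lt_of_le hn with rfl | hn2
  · exact eK x₀ hx₀ y₀ hy₀ hxy₀
  obtain ⟨G, R, ⟨x, hx, y, hy, hxy⟩, σ, cσ, σ0, ef, p, hp, hGp⟩ :=
    growth' S cK eK ⟨x₀, hx₀, y₀, hy₀, hxy₀⟩
  have SG := R.setup S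
  set A := K ∪ σ '' Ico 0 1 with hA
  have KA : K ⊆ A := subset_union_left
  have dis : ∀ j, 1 ≤ j → j < n → ∀ u ∈ A, ∀ v ∈ A, G^[j] u ≠ v := by
    intro j hj hjn u hu v hv e
    obtain ⟨L, cL, pL, eL, huL, hvL, -⟩ := grow_two cK pK cσ σ0 ef hu hv
    apply ih j hjn SG hj L cL pL eL u huL v hvL
    rw [e, sub_self]; exact zero_mem _
  have join : ∀ u ∈ A, ∀ v ∈ A, JoinedIn A u v := by
    intro u hu v hv
    obtain ⟨L, cL, pL, eL, huL, hvL, hLA⟩ := grow_two cK pK cσ σ0 ef hu hv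
    exact (pL.joinedIn u huL v hvL).mono hLA
  have hxy' : G^[n] x = y := by
    rw [AddSubgroup.mem_bot] at hxy; exact sub_eq_zero.1 hxy
  obtain ⟨a, ca, a0, a1, amem⟩ := joinedIn_real (pK.joinedIn x hx (σ 0) σ0)
  obtain ⟨β, cβ, β0, β1, βmem⟩ := joinedIn_real (join p hp x (KA hx))
  obtain ⟨δ, cδ, δ0, δ1, δmem⟩ := joinedIn_real (pK.joinedIn y hy x hx)
  set α : ℝ → ℂ := fun t : ℝ => if t ≤ 1 / 2 then a (2 * t) else σ (2 * t - 1) with hα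
  have cα : Continuous α := concat_cont ca cσ a1
  have α0 : α 0 = x := by simp [hα, a0]
  have α1 : α 1 = σ 1 := by norm_num [hα]
  have αmem : ∀ t, t < 1 → α t ∈ A := by
    intro t ht
    by_cases h : t ≤ 1 / 2
    · simp only [hα, h, if_true]; exact KA (amem _)
    · simp only [hα, h, if_false]
      push Not at h
      exact Or.inr ⟨2 * t - 1, ⟨by linarith, by linarith⟩, rfl⟩
  set c : ℝ → ℂ := fun t : ℝ => if t ≤ 1 / 2 then α (2 * t) else G (β (2 * t - 1)) with hc
  have cc : Continuous c := concat_cont cα (G.continuous.comp cβ) (by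
    rw [α1]; simp [β0, hGp])
  have c0 : c 0 = x := by simp [hc, α0]
  have c1 : c 1 = G (c 0) := by rw [c0]; norm_num [hc, β1]
  have h1 : ∀ t, 0 ≤ t → t < 1 / 2 → c t ∈ A := by
    intro t _ ht
    simp only [hc, ht.le, if_true]
    exact αmem _ (by linarith)
  have h2 : ∀ t, 1 / 2 ≤ t → t ≤ 1 → c t ∈ G '' A := by
    intro t ht _
    rcases eq_or_lt_of_le ht with h | h
    · refine ⟨p, hp, ?_⟩
      rw [← h]; simp [hc, α1, hGp]
    · simp only [hc, not_le.2 h, if_false]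
      exact ⟨_, βmem _, rfl⟩
  set C := inv_curve G c with hC
  have C0 : C 0 = x := by simp [hC, inv_curve, c0]
  have Cn : C n = y := by simp [hC, inv_curve, c0, hxy']
  have hnR : (2:ℝ) ≤ n := by exact_mod_cast hn2
  have inj : ∀ m, Function.Injective G^[m] := fun m => G.injective.iterate m
  obtain ⟨ρ, hρ⟩ := SG.rho
  refine lemmaW G.continuous hρ (fun z hz => SG.free z (by rw [hz, sub_self]; exact zero_mem _))
    hnR (C := C) (δ := δ) (inv_curve_cont G.continuous cc c1 n)
    (fun t ht => inv_curve_succ ht.1) cδ (by rw [δ0, Cn]) (by rw [δ1, C0]) ?_ ?_ ?_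
  · intro s t hs ht h3 h4 e
    obtain ⟨u, hu, eu⟩ := inv_curve_mem h1 h2 hs
    obtain ⟨v, hv, ev⟩ := inv_curve_mem h1 h2 (show 0 ≤ t by linarith)
    have hs' : (0:ℝ) ≤ s + 1 / 2 := by linarith
    have ht' : (0:ℝ) ≤ t + 1 / 2 := by linarith
    have l1 : ⌊s + 1 / 2⌋₊ + 1 ≤ ⌊t + 1 / 2⌋₊ := by
      apply Nat.le_floor
      push_cast
      linarith [Nat.floor_le hs']
    have l2 : ⌊t + 1 / 2⌋₊ < ⌊s + 1 / 2⌋₊ + n := by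
      rw [Nat.floor_lt ht']
      push_cast
      linarith [Nat.lt_floor_add_one (s + 1 / 2)]
    obtain ⟨j, hj⟩ := Nat.exists_eq_add_of_le l1
    have e2 : G^[⌊s + 1 / 2⌋₊] u = G^[⌊s + 1 / 2⌋₊] (G^[1 + j] v) := by
      rw [← eu, ← Function.iterate_add_apply, ← add_assoc, ← hj, ← ev]; exact e
    exact dis (1 + j) (by omega) (by omega) v hv u hu (inj _ e2).symm
  · intro b hb u e
    obtain ⟨v, hv, ev⟩ := inv_curve_mem h1 h2 (show 0 ≤ b by linarith [hb.1])
    have hb' : (0:ℝ) ≤ b + 1 / 2 := by linarith [hb.1]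
    have l1 : 1 ≤ ⌊b + 1 / 2⌋₊ := by
      apply Nat.le_floor
      push_cast
      linarith [hb.1]
    have l2 : ⌊b + 1 / 2⌋₊ < n := by
      rw [Nat.floor_lt hb']
      linarith [hb.2]
    exact dis _ l1 l2 v hv (δ u) (KA (δmem u)) (by rw [← ev]; exact e)
  · intro u u' e
    exact dis 1 le_rfl hn2 _ (KA (δmem u)) _ (KA (δmem u')) e

end FB

open Set
open Filter

namespace FB
open Topology

section
variable {Λ : AddSubgroup ℂ} {G : ℂ ≃ₜ ℂ}

lemma Setup.isOpen_rel {f g : ℂ → ℂ} (S : Setup Λ G) (cf : Continuous f) (cg : Continuous g) :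
    IsOpen {p : ℂ × ℂ | f p.1 - g p.2 ∉ Λ} :=
  S.closed.isOpen_compl.preimage
    (f := fun p : ℂ × ℂ => f p.1 - g p.2) (by fun_prop)

lemma ef_nhds (S : Setup Λ G) {Y O : Set ℂ} (cY : IsCompact Y) (eY : EF Λ G Y) (oO : IsOpen O)
    (hYO : Y ⊆ O) : ∃ U, IsOpen U ∧ Y ⊆ U ∧ U ⊆ O ∧ EF Λ G U := by
  obtain ⟨u, v, ou, ov, hu, hv, huv⟩ := generalized_tube_lemma cY cY
    (S.isOpen_rel (f := G) (g := id) G.continuous continuous_id)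
    (fun p hp => eY p.1 hp.1 p.2 hp.2)
  refine ⟨u ∩ v ∩ O, (ou.inter ov).inter oO, subset_inter (subset_inter hu hv) hYO,
    inter_subset_right, fun a ha b hb => ?_⟩
  exact huv (show (a, b) ∈ u ×ˢ v from ⟨ha.1.1, hb.1.2⟩)

lemma ef_nhds_conn (S : Setup Λ G) {Y O : Set ℂ} (cY : IsCompact Y) (nY : IsConnected Y)
    (eY : EF Λ G Y) (oO : IsOpen O)
    (hYO : Y ⊆ O) : ∃ U, IsOpen U ∧ IsPreconnected U ∧ Y ⊆ U ∧ U ⊆ O ∧ EF Λ G U := by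
  obtain ⟨U, oU, hYU, hUO, eU⟩ := ef_nhds S cY eY oO hYO
  obtain ⟨y, hy⟩ := nY.nonempty
  refine ⟨connectedComponentIn U y, oU.connectedComponentIn, isPreconnected_connectedComponentIn,
    nY.isPreconnected.subset_connectedComponentIn hy hYU,
    (connectedComponentIn_subset _ _).trans hUO, eU.mono (connectedComponentIn_subset _ _)⟩

lemma joined_open {U : Set ℂ} (oU : IsOpen U) (pU : IsPreconnected U) {u v : ℂ} (hu : u ∈ U)
    (hv : v ∈ U) : JoinedIn U u v :=
  ((oU.isConnected_iff_isPathConnected).1 ⟨⟨u, hu⟩, pU⟩).joinedIn u hu v hv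

lemma ef_image (S : Setup Λ G) {K : Set ℂ} (eK : EF Λ G K) : EF Λ G (G '' K) := by
  rintro _ ⟨u, hu, rfl⟩ _ ⟨v, hv, rfl⟩ h
  apply eK u hu v hv
  have : G (G u) = G v + (G (G u) - G v) := by ring
  rw [← S.equi _ _ h] at this
  have := G.injective this
  rw [this]; simpa using h

lemma sub_mem_of_image (S : Setup Λ G) {a b : ℂ} (h : G a - G b ∈ Λ) :
    a = b + (G a - G b) := by
  apply G.injective
  rw [S.equi _ _ h]; ring

lemma ef_translate (S : Setup Λ G) {K : Set ℂ} (eK : EF Λ G K) {l : ℂ} (hl : l ∈ Λ) :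
    EF Λ G ((fun z => z + l) '' K) := by
  rintro _ ⟨u, hu, rfl⟩ _ ⟨v, hv, rfl⟩ h
  apply eK u hu v hv
  simp only [S.equi _ _ hl] at h
  simpa using h

lemma ef_singleton (S : Setup Λ G) (z : ℂ) : EF Λ G {z} := by
  rintro _ rfl _ rfl
  exact S.free _

def Mod3 (Λ : AddSubgroup ℂ) (H : ℂ ≃ₜ ℂ) : Prop :=
  ∀ S1 S2 S3 : Set ℂ, EF Λ H S1 → EF Λ H S2 → EF Λ H S3 → ∀ w0 w1 w2 w3 : ℂ,
    JoinedIn S1 w0 w1 → JoinedIn S2 w1 w2 → JoinedIn S3 w2 w3 → w3 - w0 ∈ Λ → w3 = w0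

lemma Mod3.two (S : Setup Λ G) (M : Mod3 Λ G) {S1 S2 : Set ℂ} (h1 : EF Λ G S1) (h2 : EF Λ G S2)
    {w0 w1 w2 : ℂ} (j1 : JoinedIn S1 w0 w1) (j2 : JoinedIn S2 w1 w2) (h : w2 - w0 ∈ Λ) :
    w2 = w0 :=
  M S1 S2 {w2} h1 h2 (ef_singleton S w2) w0 w1 w2 w2 j1 j2 (JoinedIn.refl rfl) h

lemma Mod3.one (S : Setup Λ G) (M : Mod3 Λ G) {S1 : Set ℂ} (h1 : EF Λ G S1)
    {w0 w1 : ℂ} (j1 : JoinedIn S1 w0 w1) (h : w1 - w0 ∈ Λ) : w1 = w0 :=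
  M.two S h1 (ef_singleton S w1) j1 (JoinedIn.refl rfl) h

lemma Setup.bot (S : Setup Λ G) : Setup ⊥ G := by
  refine ⟨by simp, fun z l hl => ?_, fun z hz => ?_, S.rho⟩
  · rw [AddSubgroup.mem_bot] at hl; simp [hl]
  · rw [AddSubgroup.mem_bot] at hz; exact S.free z (by rw [hz]; exact Λ.zero_mem)

lemma EF.bot {K : Set ℂ} (h : EF Λ G K) : EF ⊥ G K := by
  intro u hu v hv hz
  rw [AddSubgroup.mem_bot] at hz; exact h u hu v hv (by rw [hz]; exact Λ.zero_mem)

lemma noRet_eq (S : Setup Λ G) {K : Set ℂ} (cK : IsCompact K) (pK : IsPathConnected K)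
    (eK : EF Λ G K) {n : ℕ} (hn : 1 ≤ n) {x y : ℂ} (hx : x ∈ K) (hy : y ∈ K) : G^[n] x ≠ y := by
  intro h
  exact thmP n S.bot hn K cK pK eK.bot x hx y hy (by rw [h, sub_self]; exact zero_mem _)

lemma Mod3.rel {H : ℂ ≃ₜ ℂ} (S : Setup Λ H) (M : Mod3 Λ H) (R : Rel Λ H G) : Mod3 Λ G := by
  intro S1 S2 S3 e1 e2 e3
  have R' := R.symm S
  have S' := R.setup S
  exact M S1 S2 S3 (R'.ef_imp S' e1) (R'.ef_imp S' e2) (R'.ef_imp S' e3)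

lemma noRet_two {H : ℂ ≃ₜ ℂ} (S : Setup Λ H) (M : Mod3 Λ H) : NoRet Λ H 2 := by
  intro K cK pK eK x₀ hx₀ y₀ hy₀ hxy₀
  obtain ⟨G, R, ⟨x, hx, y, hy, hxy⟩, σ, cσ, σ0, ef, p, hp, hGp⟩ :=
    growth' S cK eK ⟨x₀, hx₀, y₀, hy₀, hxy₀⟩
  have SG := R.setup S
  have MG := M.rel S R
  have eKG := R.ef_imp S eK
  obtain ⟨s, hs0, hs1, hps⟩ : ∃ s, 0 ≤ s ∧ s < 1 ∧ p ∈ K ∪ σ '' Icc 0 s := by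
    rcases hp with hp | ⟨s, hs, rfl⟩
    · exact ⟨0, le_rfl, one_pos, Or.inl hp⟩
    · exact ⟨s, hs.1, hs.2, Or.inr ⟨s, ⟨hs.1, le_rfl⟩, rfl⟩⟩
  have claim : ∀ s, 0 ≤ s → s < 1 → p ∈ K ∪ σ '' Icc 0 s → ∃ O, EF Λ G O ∧
      ∃ r, s ≤ r ∧ r < 1 ∧ ∀ w ∈ K ∪ σ '' Icc 0 s, JoinedIn O (σ r) (G w) := by
    intro s hs0 hs1 hps
    have pc := pathConn_grow pK cσ σ0 hs0
    have cc : IsCompact (K ∪ σ '' Icc 0 s) := cK.union (isCompact_Icc.image cσ)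
    obtain ⟨O, oO, hO, -, eO⟩ := ef_nhds SG (cc.image G.continuous) (ef_image SG (ef s hs1))
      isOpen_univ (subset_univ _)
    have h1 : σ 1 ∈ O := hO ⟨p, hps, hGp⟩
    obtain ⟨ε, hε, hb⟩ := Metric.isOpen_iff.1 (oO.preimage cσ) 1 h1
    refine ⟨O, eO, max s (1 - ε / 2), le_max_left _ _, max_lt hs1 (by linarith), fun w hw => ?_⟩
    have j1 : JoinedIn O (σ (max s (1 - ε / 2))) (σ 1) := by
      apply joinedIn_of_real cσ
      intro t ht
      rw [uIcc_of_le (max_lt hs1 (by linarith)).le] at ht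
      apply hb
      rw [Metric.mem_ball, Real.dist_eq, abs_lt]
      have := (le_max_right _ _).trans ht.1
      constructor <;> linarith [ht.2]
    rw [← hGp] at j1
    refine j1.trans ?_
    exact (((pc.image G.continuous).joinedIn _ ⟨p, hps, rfl⟩ _ ⟨w, hw, rfl⟩)).mono hO
  have mono : ∀ a b : ℝ, a ≤ b → K ∪ σ '' Icc 0 a ⊆ K ∪ σ '' Icc 0 b := fun a b hab =>
    union_subset_union_right _ (image_mono (Icc_subset_Icc_right hab))
  obtain ⟨O3, e3, r3, hr3, hr31, J3⟩ := claim s hs0 hs1 hps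
  obtain ⟨O2, e2, r2, hr2, hr21, J2⟩ := claim r3 (hs0.trans hr3) hr31 (mono _ _ hr3 hps)
  have r30 := hs0.trans hr3
  have r20 := r30.trans hr2
  have J1 : JoinedIn (K ∪ σ '' Icc 0 r2) y (σ r2) :=
    (pathConn_grow pK cσ σ0 r20).joinedIn _ (Or.inl hy) _ (Or.inr ⟨r2, ⟨r20, le_rfl⟩, rfl⟩)
  have J2' := J2 (σ r3) (Or.inr ⟨r3, ⟨r30, le_rfl⟩, rfl⟩)
  have J3' : JoinedIn (G '' O3) (G (σ r3)) (G (G x)) := by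
    obtain ⟨γ, hγ⟩ := J3 x (Or.inl hx)
    exact ⟨γ.map G.continuous, fun t => ⟨γ t, hγ t, rfl⟩⟩
  have := MG _ _ _ (ef r2 hr21) e2 (ef_image SG e3) _ _ _ _ J1 J2' J3' hxy
  exact noRet_eq SG cK pK eKG (n := 2) (by norm_num) hx hy this

structure St (Λ : AddSubgroup ℂ) (G : ℂ ≃ₜ ℂ) (x0 : ℂ) (U : Set ℂ) (z : ℂ) (N : Set ℂ) : Prop where
  oU : IsOpen U
  pU : IsPreconnected U
  eU : EF Λ G U
  x0U : x0 ∈ U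
  zU : z ∈ U
  oN : IsOpen N
  cN : Convex ℝ N
  eN : EF Λ G N
  b : ∀ u ∈ N, ∀ v ∈ U, G u - v ∉ Λ
  c : ∀ u ∈ U, ∀ v ∈ N, G (G u) - v ∉ Λ
  d : (N ∩ U).Nonempty
  e : ∃ c0 ∈ U, G c0 ∈ N

lemma ef2_open (h2 : NoRet Λ G 2) {U : Set ℂ} (oU : IsOpen U) (pU : IsPreconnected U)
    (eU : EF Λ G U) : ∀ u ∈ U, ∀ v ∈ U, G (G u) - v ∉ Λ := by
  intro u hu v hv
  obtain ⟨γ, hγ⟩ := joined_open oU pU hu hv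
  haveI : PathConnectedSpace unitInterval := isPathConnected_iff_pathConnectedSpace.1
    ((convex_Icc (0:ℝ) 1).isPathConnected ⟨0, by simp⟩)
  have hs : range γ ⊆ U := by rintro _ ⟨t, rfl⟩; exact hγ t
  exact h2 (range γ) (isCompact_range γ.continuous) (isPathConnected_range γ.continuous)
    (eU.mono hs) u ⟨0, by simp⟩ v ⟨1, by simp⟩

lemma St.step (S : Setup Λ G) (M : Mod3 Λ G) (h2 : NoRet Λ G 2) {x0 z : ℂ} {U N O : Set ℂ}
    (T : St Λ G x0 U z N) (oO : IsOpen O) (hO : G z ∈ O) :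
    ∃ U' N' z', St Λ G x0 U' z' N' ∧ z' ∈ O := by
  have EF2 := ef2_open h2 T.oU T.pU T.eU
  obtain ⟨f0, hf0N, hf0U⟩ := T.d
  obtain ⟨c0, hc0U, hc0N⟩ := T.e
  have jU : ∀ u ∈ U, ∀ v ∈ U, JoinedIn U u v := fun u hu v hv => joined_open T.oU T.pU hu hv
  have jN : ∀ u ∈ N, ∀ v ∈ N, JoinedIn N u v := fun u hu v hv =>
    joined_open T.oN T.cN.isPreconnected hu hv
  have eGU := ef_image S T.eU
  have jG : ∀ u ∈ U, ∀ v ∈ U, JoinedIn (G '' U) (G u) (G v) := by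
    intro u hu v hv
    obtain ⟨γ, hγ⟩ := jU u hu v hv
    exact ⟨γ.map G.continuous, fun t => ⟨γ t, hγ t, rfl⟩⟩
  have key : ∀ u ∈ U ∪ N ∪ G '' U, ∀ v ∈ U ∪ N ∪ G '' U, G u - v ∈ Λ → G u = v := by
    rintro u ((hu | hu) | ⟨u', hu', rfl⟩) v ((hv | hv) | ⟨v', hv', rfl⟩) h
    · exact absurd h (T.eU u hu v hv)
    · have h' : v - G u ∈ Λ := by have := Λ.neg_mem h; rwa [neg_sub] at this
      exact (M.two S eGU T.eN (jG u hu c0 hc0U) (jN _ hc0N v hv) h').symm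
    · have e := sub_mem_of_image S h
      congr 1
      exact M.one S T.eU (jU v' hv' u hu) (by rw [e]; simpa using h)
    · exact absurd h (T.b u hu v hv)
    · exact absurd h (T.eN u hu v hv)
    · have e := sub_mem_of_image S h
      congr 1
      exact M.two S T.eU T.eN (jU v' hv' f0 hf0U) (jN f0 hf0N u hu) (by rw [e]; simpa using h)
    · exact absurd h (EF2 u' hu' v hv)
    · exact absurd h (T.c u' hu' v hv)
    · exact absurd h (eGU _ ⟨u', hu', rfl⟩ _ ⟨v', hv', rfl⟩)
  have ne : ∀ {a b : ℂ}, a - b ∉ Λ → a ≠ b := by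
    rintro a _ h rfl
    exact h (by simp)
  have oGU : IsOpen (G '' U) := G.isOpenMap _ T.oU
  obtain ⟨B, oB, hBz, hBO, eB⟩ := ef_nhds S isCompact_singleton (ef_singleton S (G z))
    (oGU.inter oO) (singleton_subset_iff.2 ⟨⟨z, T.zU, rfl⟩, hO⟩)
  obtain ⟨ε, hε, hb⟩ := Metric.isOpen_iff.1 oB _ (singleton_subset_iff.1 hBz)
  set N' := Metric.ball (G z) ε with hN'
  have hN'G : N' ⊆ G '' U := fun w hw => (hBO (hb hw)).1
  have hzM : z ∈ G ⁻¹' N' := Metric.mem_ball_self hε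
  obtain ⟨Y, cY, nY, hYs, hx0Y, hzY, ⟨z', hz', hz'Y⟩, hYY⟩ :=
    FB.step G T.oU T.pU T.cN (fun u hu v hv => ne (T.eU u hu v hv))
      (fun u hu v hv => ne (T.eN u hu v hv)) (fun u hu v hv => ne (T.b u hu v hv))
      (fun u hu v hv => ne (EF2 u hu v hv)) (fun u hu v hv => ne (T.c u hu v hv))
      hf0U hf0N hc0U hc0N T.x0U T.zU (Metric.isOpen_ball.preimage G.continuous) hzM
  have eY : EF Λ G Y := fun u hu v hv h => hYY u hu v hv (key u (hYs hu) v (hYs hv) h)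
  obtain ⟨U', oU', pU', hYU', hU'O, eU'⟩ := ef_nhds_conn S cY nY eY
    ((T.oU.union T.oN).union oGU) hYs
  refine ⟨U', N', G z', ⟨oU', pU', eU', hYU' hx0Y, hYU' hz'Y, Metric.isOpen_ball,
    convex_ball _ _, eB.mono hb, ?_, ?_, ⟨G z', hz'.1, hYU' hz'Y⟩,
    z, hYU' hzY, Metric.mem_ball_self hε⟩, (hBO (hb hz'.1)).2⟩
  · intro u hu v hv h
    obtain ⟨u', hu', rfl⟩ := hN'G hu
    rcases hU'O hv with (hv | hv) | hv
    · exact EF2 u' hu' v hv h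
    · exact T.c u' hu' v hv h
    · exact eGU _ ⟨u', hu', rfl⟩ v hv h
  · intro u hu v hv h
    obtain ⟨v', hv', rfl⟩ := hN'G hv
    have h' : G u - v' ∈ Λ := by
      rw [sub_mem_of_image S h]; simpa using h
    rcases hU'O hu with (hu | hu) | ⟨u', hu', rfl⟩
    · exact T.eU u hu v' hv' h'
    · exact T.b u hu v' hv' h'
    · exact EF2 u' hu' v' hv' h'

theorem noRet {H : ℂ ≃ₜ ℂ} (S : Setup Λ H) (M : Mod3 Λ H) {n : ℕ} (hn : 1 ≤ n) : NoRet Λ H n := by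
  intro K cK pK eK x₀ hx₀ y₀ hy₀ hxy₀
  obtain ⟨G, R, ⟨x, hx, y, hy, hxy⟩, σ, cσ, σ0, ef, p, hp, hGp⟩ :=
    growth' S cK eK ⟨x₀, hx₀, y₀, hy₀, hxy₀⟩
  have SG := R.setup S
  have MG := M.rel S R
  have eKG := R.ef_imp S eK
  have h2 := noRet_two SG MG
  obtain ⟨s, hs0, hs1, hps⟩ : ∃ s, 0 ≤ s ∧ s < 1 ∧ p ∈ K ∪ σ '' Icc 0 s := by
    rcases hp with hp | ⟨s, hs, rfl⟩
    · exact ⟨0, le_rfl, one_pos, Or.inl hp⟩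
    · exact ⟨s, hs.1, hs.2, Or.inr ⟨s, ⟨hs.1, le_rfl⟩, rfl⟩⟩
  have mono : ∀ a b : ℝ, a ≤ b → K ∪ σ '' Icc 0 a ⊆ K ∪ σ '' Icc 0 b := fun a b hab =>
    union_subset_union_right _ (image_mono (Icc_subset_Icc_right hab))
  have pA : p ∈ K ∪ σ '' Ico 0 1 := hp
  have two : ∀ u ∈ K ∪ σ '' Ico 0 1, ∀ v ∈ K ∪ σ '' Ico 0 1, G (G u) - v ∉ Λ := by
    intro u hu v hv
    obtain ⟨L, cL, pL, eL, huL, hvL, -⟩ := grow_two cK pK cσ σ0 ef hu hv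
    exact h2 L cL pL eL u huL v hvL
  have one : ∀ u ∈ K ∪ σ '' Ico 0 1, ∀ v ∈ K ∪ σ '' Ico 0 1, G u - v ∉ Λ := by
    intro u hu v hv
    obtain ⟨L, cL, pL, eL, huL, hvL, -⟩ := grow_two cK pK cσ σ0 ef hu hv
    exact eL u huL v hvL
  have split : ∀ u ∈ K ∪ σ '' Icc 0 1, u ∈ K ∪ σ '' Ico 0 1 ∨ u = σ 1 := by
    rintro u (hu | ⟨t, ht, rfl⟩)
    · exact Or.inl (Or.inl hu)
    · rcases eq_or_lt_of_le ht.2 with rfl | h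
      · exact Or.inr rfl
      · exact Or.inl (Or.inr ⟨t, ⟨ht.1, h⟩, rfl⟩)
  have c1 : IsCompact (K ∪ σ '' Icc 0 1) := cK.union (isCompact_Icc.image cσ)
  have hB1 : ∀ v ∈ K ∪ σ '' Icc 0 1, G (σ 1) - v ∉ Λ := by
    intro v hv
    rcases split v hv with hv | rfl
    · rw [← hGp]; exact two p pA v hv
    · exact SG.free _
  have hC1 : ∀ u ∈ K ∪ σ '' Icc 0 1, G (G u) - σ 1 ∉ Λ := by
    intro u hu h
    rw [← hGp] at h
    have h' : G u - p ∈ Λ := by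
      rw [sub_mem_of_image SG h]; simpa using h
    rcases split u hu with hu | rfl
    · exact one u hu p pA h'
    · rw [← hGp] at h'; exact two p pA p pA h'
  obtain ⟨N1, V1, oN1, oV1, hN1, hV1, hNV1⟩ := generalized_tube_lemma (isCompact_singleton (x := σ 1)) c1
    (SG.isOpen_rel (f := G) (g := id) G.continuous continuous_id)
    (fun q hq => by
      obtain ⟨h1, h2⟩ := hq
      rw [mem_singleton_iff] at h1
      change G q.1 - q.2 ∉ Λ
      rw [h1]; exact hB1 _ h2)
  obtain ⟨V2, N2, oV2, oN2, hV2, hN2, hNV2⟩ := generalized_tube_lemma c1 (isCompact_singleton (x := σ 1))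
    (SG.isOpen_rel (f := fun u => G (G u)) (g := id) (G.continuous.comp G.continuous) continuous_id)
    (fun q hq => by
      obtain ⟨h1, h2⟩ := hq
      rw [mem_singleton_iff] at h2
      change G (G q.1) - q.2 ∉ Λ
      rw [h2]; exact hC1 _ h1)
  obtain ⟨B, oB, hBz, hBO, eB⟩ := ef_nhds SG isCompact_singleton (ef_singleton SG (σ 1))
    (oN1.inter oN2) (subset_inter hN1 hN2)
  obtain ⟨ε, hε, hb⟩ := Metric.isOpen_iff.1 oB _ (singleton_subset_iff.1 hBz)
  set N := Metric.ball (σ 1) ε with hN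
  obtain ⟨δ, hδ, hδb⟩ := Metric.isOpen_iff.1 ((Metric.isOpen_ball (x := σ 1) (ε := ε)).preimage cσ) 1
    (Metric.mem_ball_self hε)
  set s' := max s (1 - δ / 2) with hs'
  have hs'1 : s' < 1 := max_lt hs1 (by linarith)
  have hs'0 : 0 ≤ s' := hs0.trans (le_max_left _ _)
  have hs'N : σ s' ∈ N := by
    apply hδb
    rw [Metric.mem_ball, Real.dist_eq, abs_lt]
    have : 1 - δ / 2 ≤ s' := le_max_right _ _
    constructor <;> linarith
  have cs' : IsCompact (K ∪ σ '' Icc 0 s') := cK.union (isCompact_Icc.image cσ)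
  obtain ⟨U, oU, pU, hYU, hUO, eU⟩ := ef_nhds_conn SG cs'
    (pathConn_grow pK cσ σ0 hs'0).isConnected (ef s' hs'1) (oV1.inter oV2)
    ((mono _ _ hs'1.le).trans (subset_inter hV1 hV2))
  have base : St Λ G x U x N := by
    refine ⟨oU, pU, eU, hYU (Or.inl hx), hYU (Or.inl hx), Metric.isOpen_ball, convex_ball _ _,
      eB.mono hb, ?_, ?_, ⟨σ s', hs'N, hYU (Or.inr ⟨s', ⟨hs'0, le_rfl⟩, rfl⟩)⟩,
      p, hYU (mono _ _ (le_max_left _ _) hps), ?_⟩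
    · exact fun u hu v hv => hNV1 (show (u, v) ∈ N1 ×ˢ V1 from ⟨(hBO (hb hu)).1, (hUO hv).1⟩)
    · exact fun u hu v hv => hNV2 (show (u, v) ∈ V2 ×ˢ N2 from ⟨(hUO hu).2, (hBO (hb hv)).2⟩)
    · rw [hGp]; exact Metric.mem_ball_self hε
  have all : ∀ m : ℕ, ∀ O, IsOpen O → G^[m] x ∈ O → ∃ U N z, St Λ G x U z N ∧ z ∈ O := by
    intro m
    induction m with
    | zero => exact fun O oO hO => ⟨U, N, x, base, hO⟩
    | succ m ih =>
      intro O oO hO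
      obtain ⟨U, N, z, T, hz⟩ := ih (G ⁻¹' O) (oO.preimage G.continuous)
        (by rw [Function.iterate_succ_apply'] at hO; exact hO)
      exact T.step SG MG h2 oO hz
  obtain ⟨O, oO, hO, -, eO⟩ := ef_nhds SG isCompact_singleton (ef_singleton SG (G^[n] x))
    isOpen_univ (subset_univ _)
  obtain ⟨r, hr, hrb⟩ := Metric.isOpen_iff.1 oO _ (singleton_subset_iff.1 hO)
  obtain ⟨U', N', z, T, hz⟩ := all n (Metric.ball (G^[n] x) r) Metric.isOpen_ball
    (Metric.mem_ball_self hr)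
  have J1 := joined_open T.oU T.pU T.x0U T.zU
  have J2 := joined_open Metric.isOpen_ball (convex_ball (G^[n] x) r).isPreconnected hz
    (Metric.mem_ball_self hr)
  have J3 : JoinedIn ((fun z => z + (G^[n] x - y)) '' K) (G^[n] x) (x + (G^[n] x - y)) := by
    have := (pK.image (f := fun z => z + (G^[n] x - y)) (by fun_prop)).joinedIn
      _ ⟨y, hy, rfl⟩ _ ⟨x, hx, rfl⟩
    simpa using this
  have := MG _ _ _ T.eU (eO.mono hrb) (ef_translate SG eKG hxy) _ _ _ _ J1 J2 J3
    (by simpa using hxy)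
  have e : G^[n] x = y := by linear_combination this
  exact noRet_eq SG cK pK eKG hn hx hy e

end
end FB

open Set
open Filter

namespace FB
open Topology

def Lam : AddSubgroup ℂ where
  carrier := {z | Complex.exp z = 1}
  zero_mem' := by simp
  add_mem' := by
    intro a b ha hb
    simp only [mem_ofPred_eq] at *
    rw [Complex.exp_add, ha, hb, one_mul]
  neg_mem' := by
    intro a ha
    simp only [mem_ofPred_eq] at *
    rw [Complex.exp_neg, ha, inv_one]

lemma mem_Lam {z : ℂ} : z ∈ Lam ↔ Complex.exp z = 1 := Iff.rfl

lemma sub_mem_Lam {z w : ℂ} : z - w ∈ Lam ↔ Complex.exp z = Complex.exp w := by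
  rw [mem_Lam, Complex.exp_sub, div_eq_one_iff_eq (Complex.exp_ne_zero _)]

lemma isClosed_Lam : IsClosed (Lam : Set ℂ) :=
  isClosed_eq Complex.continuous_exp continuous_const

lemma lift_exists (h : ℂ ≃ₜ ℂ) (F : ℝ → ℂ → ℂ) (cF : Continuous (Function.uncurry F))
    (F0 : F 0 = id) (F1 : F 1 = h) (bF : ∀ t, Function.Injective (F t))
    (hfix : ∀ x : ℂ, h x = x ↔ x = 0) :
    ∃ H : ℂ ≃ₜ ℂ, Setup Lam H ∧ ∀ z, Complex.exp (H z) = h (Complex.exp z) := by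
  have h00 : h 0 = 0 := (hfix 0).2 rfl
  have cF' : ∀ {E : Type} [TopologicalSpace E] {a : E → ℝ} {b : E → ℂ}, Continuous a →
      Continuous b → Continuous (fun e => F (a e) (b e)) := fun ha hb =>
    cF.comp (ha.prodMk hb)
  obtain ⟨g, cg, hg⟩ := convex_log (E := ℝ × ℂ) (X := univ) convex_univ
    (f := fun p => F p.1 (Complex.exp p.2) - F p.1 0)
    (Continuous.continuousOn (by
      exact (cF' continuous_fst (Complex.continuous_exp.comp continuous_snd)).sub
        (cF' continuous_fst continuous_const)))
    (fun p _ => sub_ne_zero.2 (fun e => Complex.exp_ne_zero _ (bF _ e)))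
  rw [continuousOn_univ] at cg
  have hg00 : Complex.exp (g (0, 0)) = 1 := by rw [hg _ (mem_univ _)]; simp [F0]
  set L : ℝ × ℂ → ℂ := fun p => g p - g (0, 0) with hL
  have cL : Continuous L := cg.sub continuous_const
  have eL : ∀ t z, Complex.exp (L (t, z)) = F t (Complex.exp z) - F t 0 := by
    intro t z
    rw [hL]
    simp only
    rw [Complex.exp_sub, hg00, div_one, hg _ (mem_univ _)]
  have L0 : ∀ z, L (0, z) = z := by
    intro z
    have := exp_const (S := (univ : Set ℂ)) isPreconnected_univ (f := fun z => L (0, z))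
      (g := fun z => z) (by fun_prop) (by fun_prop) (fun z _ => by rw [eL, F0]; simp)
      (mem_univ z) (mem_univ 0)
    simp only [hL] at this ⊢
    linear_combination this
  have Leq : ∀ t z, ∀ l ∈ Lam, L (t, z + l) = L (t, z) + l := by
    intro t z l hl
    have := exp_const (S := (univ : Set (ℝ × ℂ))) isPreconnected_univ
      (f := fun p => L (p.1, p.2 + l)) (g := fun p => L (p.1, p.2))
      (by fun_prop) (by fun_prop)
      (fun z _ => by rw [eL, eL, Complex.exp_add, mem_Lam.1 hl, mul_one])
      (mem_univ (t, z)) (mem_univ (0, 0))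
    simp only [L0] at this
    linear_combination this
  have Linj : ∀ t z w, L (t, z) = L (t, w) → z = w := by
    intro t z w e
    have h1 : Complex.exp z = Complex.exp w := by
      apply bF t
      have := congrArg Complex.exp e
      rw [eL, eL] at this
      linear_combination this
    have h2 := Leq t w _ (sub_mem_Lam.2 h1)
    rw [add_sub_cancel, e] at h2
    linear_combination -h2
  have e1 : ∀ z, Complex.exp (L (1, z)) = h (Complex.exp z) := by
    intro z; rw [eL, F1, h00, sub_zero]
  obtain ⟨J, cJ, hJ⟩ := convex_log (E := ℂ) (X := univ) convex_univ
    (f := fun z => h.symm (Complex.exp z))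
    (Continuous.continuousOn (h.symm.continuous.comp Complex.continuous_exp))
    (fun z _ e => by
      have := congrArg h e
      rw [h.apply_symm_apply, h00] at this
      exact Complex.exp_ne_zero _ this)
  rw [continuousOn_univ] at cJ
  set c := J (L (1, 0)) with hc
  have JL : ∀ z, J (L (1, z)) - c = z := by
    intro z
    have := exp_const (S := (univ : Set ℂ)) isPreconnected_univ (f := fun z => J (L (1, z)))
      (g := fun z => z) (by fun_prop) (by fun_prop)
      (fun z _ => by rw [hJ _ (mem_univ _), e1, h.symm_apply_apply])
      (mem_univ z) (mem_univ 0)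
    simp only [sub_zero] at this
    linear_combination this
  have ec : Complex.exp c = 1 := by
    rw [hc, hJ _ (mem_univ _), e1, h.symm_apply_apply, Complex.exp_zero]
  have LJ : ∀ z, L (1, J z - c) = z := by
    intro z
    have := exp_const (S := (univ : Set ℂ)) isPreconnected_univ (f := fun z => L (1, J z - c))
      (g := fun z => z) (by fun_prop) (by fun_prop)
      (fun z _ => by
        rw [e1, Complex.exp_sub, ec, div_one, hJ _ (mem_univ _), h.apply_symm_apply])
      (mem_univ z) (mem_univ (L (1, 0)))
    simp only [JL] at this
    linear_combination this
  let H : ℂ ≃ₜ ℂ :=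
    { toFun := fun z => L (1, z)
      invFun := fun z => J z - c
      left_inv := JL
      right_inv := LJ
      continuous_toFun := by fun_prop
      continuous_invFun := by fun_prop }
  have hH : ∀ z, H z = L (1, z) := fun z => rfl
  refine ⟨H, ⟨isClosed_Lam, fun z l hl => by rw [hH, hH, Leq _ _ _ hl], fun z hz => ?_, ?_⟩,
    fun z => by rw [hH, e1]⟩
  · rw [sub_mem_Lam, hH, e1, hfix] at hz
    exact Complex.exp_ne_zero _ hz
  obtain ⟨r, cr, er, r0⟩ := homotopy_log (A := {p : ℂ × ℂ // p.1 ≠ p.2})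
    (fun q => (L ((q.1 : ℝ), q.2.1.1) - L ((q.1 : ℝ), q.2.1.2)) / (q.2.1.1 - q.2.1.2))
    (by
      refine Continuous.div (by fun_prop) (by fun_prop) ?_
      exact fun q => sub_ne_zero.2 q.2.2)
    (fun q => div_ne_zero (sub_ne_zero.2 fun e => q.2.2 (Linj _ _ _ e)) (sub_ne_zero.2 q.2.2))
    (fun _ => 0) continuous_const
    (fun a => by
      simp only [Set.Icc.coe_zero, L0, Complex.exp_zero]
      exact div_self (sub_ne_zero.2 a.2))
  classical
  refine ⟨fun z w => if hzw : z ≠ w then r (1, ⟨(z, w), hzw⟩) else 0, ?_, ?_, ?_⟩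
  · rw [continuousOn_iff_continuous_domRestrict]
    have : {p : ℂ × ℂ | p.1 ≠ p.2}.domRestrict (Function.uncurry
        (fun z w => if hzw : z ≠ w then r (1, ⟨(z, w), hzw⟩) else 0))
        = fun x : {p : ℂ × ℂ // p.1 ≠ p.2} => r (1, x) := by
      ext x
      have : x.1.1 ≠ x.1.2 := x.2
      simp [Function.uncurry, this]
    rw [this]
    fun_prop
  · intro z w
    by_cases hzw : z = w
    · simp [hzw]
    · have hwz : w ≠ z := fun e => hzw e.symm
      simp only [ne_eq, hzw, not_false_eq_true, dite_true, Ne.symm hzw]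
      have := exp_const (S := (univ : Set unitInterval)) isPreconnected_univ
        (f := fun t => r (t, ⟨(z, w), hzw⟩)) (g := fun t => r (t, ⟨(w, z), hwz⟩))
        (by fun_prop) (by fun_prop)
        (fun t _ => by
          rw [er, er]
          simp only
          rw [← neg_sub (L (_, w)) (L (_, z)), ← neg_sub w z, neg_div_neg_eq])
        (mem_univ 1) (mem_univ 0)
      simp only [r0] at this
      linear_combination this
  · intro z w hzw
    simp only [hzw, ne_eq, not_false_eq_true, dite_true]
    rw [er, hH, hH]
    simp only [Set.Icc.coe_one]
    exact div_mul_cancel₀ _ (sub_ne_zero.2 hzw)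

end FB

open Set
open Filter

namespace FB
open Topology

lemma loop_false {h H : ℂ ≃ₜ ℂ} (S : Setup Lam H)
    (eH : ∀ z, Complex.exp (H z) = h (Complex.exp z))
    (hmod : ∀ γ : ℝ → ℂ, IsLoopIn γ → HasDeg γ 1 → ∀ l : ℕ, Decomp (⇑h) γ l → 4 ≤ l)
    {ω : ℝ → ℂ} (cω : Continuous ω) (P : ℕ → Set ℂ) (eP : ∀ i < 3, EF Lam H (P i))
    (hP : ∀ i : ℕ, i < 3 → ∀ t ∈ Icc (i : ℝ) (i + 1), ω t ∈ P i)
    {a b : ℝ} (ha : 0 ≤ a) (hab : a < b) (hb : b ≤ 3)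
    (e : ω b = ω a + 2 * Real.pi * Complex.I) : False := by
  have hba : 0 < b - a := by linarith
  have := hmod (fun s => Complex.exp (ω (a + s * (b - a)))) ⟨?_, ?_, ?_⟩ ⟨fun s => ω (a + s * (b - a)), ?_, ?_, ?_⟩ 3
    ⟨fun i => max 0 (min 1 ((i - a) / (b - a))), ?_, ?_, ?_, ?_⟩
  · omega
  · exact Continuous.continuousOn (by fun_prop)
  · simp [e, Complex.exp_add, Complex.exp_two_pi_mul_I]
  · exact fun t _ => Complex.exp_ne_zero _
  · exact Continuous.continuousOn (by fun_prop)
  · exact fun t _ => rfl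
  · simp [e]
  · have : ((0:ℕ) - a) / (b - a) ≤ 0 := div_nonpos_of_nonpos_of_nonneg (by simpa using ha) hba.le
    exact max_eq_left ((min_le_right _ _).trans this)
  · have : 1 ≤ ((3:ℕ) - a) / (b - a) := by
      rw [le_div_iff₀ hba]; push_cast; linarith
    simp only
    rw [min_eq_left this]; norm_num
  · intro i _
    have : ((i:ℝ) - a) / (b - a) ≤ (((i + 1 : ℕ) : ℝ) - a) / (b - a) := by
      gcongr; simp
    exact max_le_max le_rfl (min_le_min le_rfl this)
  · intro i hi s hs s' hs' hh
    rw [← eH, ← sub_mem_Lam] at hh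
    rcases eq_or_ne s s' with rfl | hne
    · exact S.free _ hh
    have hlt : max 0 (min 1 (((i:ℕ) - a) / (b - a))) <
        max 0 (min 1 ((((i + 1 : ℕ) : ℝ) - a) / (b - a))) := by
      by_contra hcon
      exact hne (le_antisymm (by linarith [hs.2, hs'.1]) (by linarith [hs.1, hs'.2]))
    have r1 : ((i:ℕ) - a) / (b - a) < 1 := by
      by_contra hcon
      push Not at hcon
      rw [min_eq_left hcon] at hlt
      have : max 0 (min 1 ((((i + 1 : ℕ) : ℝ) - a) / (b - a))) ≤ 1 :=
        max_le zero_le_one (min_le_left _ _)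
      have h3 : max (0:ℝ) 1 = 1 := by norm_num
      linarith
    have r2 : 0 < (((i + 1 : ℕ) : ℝ) - a) / (b - a) := by
      by_contra hcon
      push Not at hcon
      rw [max_eq_left ((min_le_right _ _).trans hcon)] at hlt
      exact absurd hlt (not_lt.2 (le_max_left _ _))
    have key : ∀ s ∈ Icc (max 0 (min 1 (((i:ℕ) - a) / (b - a))))
        (max 0 (min 1 ((((i + 1 : ℕ) : ℝ) - a) / (b - a)))), ω (a + s * (b - a)) ∈ P i := by
      intro s hs
      apply hP i hi
      have h1 : ((i:ℕ) - a) / (b - a) ≤ s := by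
        have := (le_max_right _ _).trans hs.1
        rwa [min_eq_right r1.le] at this
      have h2 : s ≤ (((i + 1 : ℕ) : ℝ) - a) / (b - a) :=
        hs.2.trans (max_le r2.le (min_le_right _ _))
      rw [div_le_iff₀ hba] at h1
      rw [le_div_iff₀ hba] at h2
      push_cast at h2
      constructor <;> linarith
    exact eP i hi _ (key s hs) _ (key s' hs') hh

lemma setup_translate (c : ℂ) (hc : c ≠ 0) : Setup ⊥ (Homeomorph.addRight c) := by
  refine ⟨by simp, fun z l hl => ?_, fun z hz => ?_, fun _ _ => 0, continuousOn_const,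
    fun _ _ => rfl, fun z w _ => ?_⟩
  · rw [AddSubgroup.mem_bot] at hl; simp [hl]
  · rw [AddSubgroup.mem_bot] at hz
    simp at hz; exact hc hz
  · simp

lemma translate_iter (c : ℂ) (n : ℕ) (z : ℂ) : (Homeomorph.addRight c)^[n] z = z + n * c := by
  induction n generalizing z with
  | zero => simp
  | succ n ih => rw [Function.iterate_succ_apply, ih]; simp; ring

noncomputable def clamp (t : ℝ) : ℝ := max 0 (min 1 t)

lemma clamp_cont : Continuous clamp := by unfold clamp; fun_prop
lemma clamp_lo {t : ℝ} (h : t ≤ 0) : clamp t = 0 := max_eq_left ((min_le_right _ _).trans h)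
lemma clamp_hi {t : ℝ} (h : 1 ≤ t) : clamp t = 1 := by
  rw [clamp, min_eq_left h]; norm_num

lemma mod3 {h H : ℂ ≃ₜ ℂ} (S : Setup Lam H)
    (eH : ∀ z, Complex.exp (H z) = h (Complex.exp z))
    (hmod : ∀ γ : ℝ → ℂ, IsLoopIn γ → HasDeg γ 1 → ∀ l : ℕ, Decomp (⇑h) γ l → 4 ≤ l) :
    Mod3 Lam H := by
  intro S1 S2 S3 e1 e2 e3 w0 w1 w2 w3 j1 j2 j3 hw
  by_contra hne
  obtain ⟨α1, c1, a10, a11, m1⟩ := joinedIn_real j1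
  obtain ⟨α2, c2, a20, a21, m2⟩ := joinedIn_real j2
  obtain ⟨α3, c3, a30, a31, m3⟩ := joinedIn_real j3
  set ω : ℝ → ℂ := fun t => α1 (clamp t) + (α2 (clamp (t - 1)) - w1) + (α3 (clamp (t - 2)) - w2)
    with hω
  have cω : Continuous ω := by
    have := clamp_cont
    fun_prop
  have o1 : ∀ t ≤ 1, ω t ∈ S1 := by
    intro t ht
    simp only [hω]
    rw [clamp_lo (t := t - 1) (by linarith), clamp_lo (t := t - 2) (by linarith), a20, a30]
    simpa using m1 _
  have o2 : ∀ t, 1 ≤ t → t ≤ 2 → ω t ∈ S2 := by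
    intro t ht ht'
    simp only [hω]
    rw [clamp_hi ht, clamp_lo (t := t - 2) (by linarith), a11, a30]
    simpa using m2 _
  have o3 : ∀ t, 2 ≤ t → ω t ∈ S3 := by
    intro t ht
    simp only [hω]
    rw [clamp_hi (by linarith : 1 ≤ t), clamp_hi (by linarith : 1 ≤ t - 1), a11, a21]
    simpa using m3 _
  have w0' : ω 0 = w0 := by
    simp only [hω]
    rw [clamp_lo le_rfl, clamp_lo (t := 0 - 1) (by norm_num), clamp_lo (t := 0 - 2) (by norm_num),
      a20, a30, a10]; ring
  have w3' : ω 3 = w3 := by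
    simp only [hω]
    rw [clamp_hi (by norm_num : (1:ℝ) ≤ 3), clamp_hi (t := 3 - 1) (by norm_num),
      clamp_hi (t := 3 - 2) (by norm_num), a11, a21, a31]; ring
  set c : ℂ := 2 * Real.pi * Complex.I with hc
  have hc0 : c ≠ 0 := Complex.two_pi_I_ne_zero
  have cK : IsCompact (ω '' Icc 0 3) := isCompact_Icc.image cω
  have pK : IsPathConnected (ω '' Icc (0:ℝ) 3) :=
    ((convex_Icc 0 3).isPathConnected ⟨0, by norm_num, by norm_num⟩).image cω
  have m0 : w0 ∈ ω '' Icc 0 3 := ⟨0, by norm_num, w0'⟩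
  have m3' : w3 ∈ ω '' Icc 0 3 := ⟨3, by norm_num, w3'⟩
  have nEF : ¬ EF ⊥ (Homeomorph.addRight c) (ω '' Icc 0 3) := by
    intro ef
    obtain ⟨k, hk⟩ := Complex.exp_eq_one_iff.1 (mem_Lam.1 hw)
    have hk0 : k ≠ 0 := by
      rintro rfl
      simp at hk
      exact hne (by linear_combination hk)
    have hn : 1 ≤ k.natAbs := by omega
    have P := thmP k.natAbs (setup_translate c hc0) hn _ cK pK ef
    rcases le_total 0 k with hp | hp
    · apply P w0 m0 w3 m3'
      have : (k.natAbs : ℂ) = k := by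
        have : (k.natAbs : ℤ) = k := by omega
        have e := congrArg (Int.cast : ℤ → ℂ) this
        rw [Int.cast_natCast] at e
        exact e
      rw [translate_iter, AddSubgroup.mem_bot, this]
      linear_combination -hk
    · apply P w3 m3' w0 m0
      have : (k.natAbs : ℂ) = -k := by
        have : (k.natAbs : ℤ) = -k := by omega
        have e := congrArg (Int.cast : ℤ → ℂ) this
        rw [Int.cast_natCast] at e
        rw [e, Int.cast_neg]
      rw [translate_iter, AddSubgroup.mem_bot, this]
      linear_combination hk
  rw [EF] at nEF
  push Not at nEF
  obtain ⟨_, ⟨a, ha, rfl⟩, _, ⟨b, hb, rfl⟩, hab⟩ := nEF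
  rw [AddSubgroup.mem_bot] at hab
  have hab' : ω b = ω a + c := by
    have : Homeomorph.addRight c (ω a) = ω a + c := rfl
    rw [this] at hab
    linear_combination -hab
  rcases lt_trichotomy a b with hlt | rfl | hlt
  · refine loop_false S eH hmod cω (fun i => if i = 0 then S1 else if i = 1 then S2 else S3)
      ?_ ?_ ha.1 hlt hb.2 hab'
    · intro i hi
      interval_cases i <;> simpa
    · intro i hi t ht
      interval_cases i <;> norm_num at ht ⊢
      · exact o1 t ht.2
      · exact o2 t ht.1 ht.2
      · exact o3 t ht.1
  · exact hc0 (by linear_combination -hab')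
  · refine loop_false (ω := fun t => ω (3 - t)) (a := 3 - a) (b := 3 - b) S eH hmod (by fun_prop)
      (fun i => if i = 0 then S3 else if i = 1 then S2 else S1)
      ?_ ?_ (by linarith [ha.2]) (by linarith) (by linarith [hb.1]) (by simpa using hab')
    · intro i hi
      interval_cases i <;> simpa
    · intro i hi t ht
      interval_cases i <;> norm_num at ht ⊢
      · exact o3 _ (by linarith [ht.2])
      · exact o2 _ (by linarith [ht.2]) (by linarith [ht.1])
      · exact o1 _ (by linarith [ht.1])

end FB

open Set
open Filter

namespace FB
open Topology

lemma semi_iter {h H : ℂ ≃ₜ ℂ} (eH : ∀ z, Complex.exp (H z) = h (Complex.exp z)) (n : ℕ) (z : ℂ) :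
    Complex.exp (H^[n] z) = h^[n] (Complex.exp z) := by
  induction n generalizing z with
  | zero => rfl
  | succ n ih => rw [Function.iterate_succ_apply, Function.iterate_succ_apply, ih, eH]

lemma free_set {h H : ℂ ≃ₜ ℂ} (S : Setup Lam H) (M : Mod3 Lam H)
    (eH : ∀ z, Complex.exp (H z) = h (Complex.exp z)) {D : Set ℂ} (pD : IsPathConnected D)
    (h0 : (0:ℂ) ∉ D) (fr : ∀ u ∈ D, h u ∉ D) {n : ℕ} (hn : 1 ≤ n) : ∀ x ∈ D, h^[n] x ∉ D := by
  intro x hx hy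
  obtain ⟨α, cα, α0, α1, hα⟩ := joinedIn_real (pD.joinedIn x hx _ hy)
  obtain ⟨g, cg, hg⟩ := convex_log (E := ℝ) (X := univ) convex_univ (f := α) cα.continuousOn
    (fun t _ e => h0 (e ▸ hα t))
  rw [continuousOn_univ] at cg
  refine noRet S M hn (g '' Icc 0 1) (isCompact_Icc.image cg)
    (((convex_Icc (0:ℝ) 1).isPathConnected ⟨0, by simp⟩).image cg) ?_ (g 0)
    ⟨0, by simp, rfl⟩ (g 1) ⟨1, by simp, rfl⟩ ?_
  · rintro _ ⟨s, -, rfl⟩ _ ⟨t, -, rfl⟩ hst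
    rw [sub_mem_Lam, eH, hg _ (mem_univ _), hg _ (mem_univ _)] at hst
    exact fr _ (hα s) (hst ▸ hα t)
  · rw [sub_mem_Lam, semi_iter eH, hg _ (mem_univ _), hg _ (mem_univ _), α0, α1]

lemma symm_iter (h : ℂ ≃ₜ ℂ) (n : ℕ) (x : ℂ) : h^[n] (h.symm^[n] x) = x :=
  (Function.LeftInverse.iterate h.apply_symm_apply n) x

lemma wander {h H : ℂ ≃ₜ ℂ} (S : Setup Lam H) (M : Mod3 Lam H)
    (eH : ∀ z, Complex.exp (H z) = h (Complex.exp z)) (hfix : ∀ x : ℂ, h x = x ↔ x = 0)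
    {x : ℂ} (hx : x ≠ 0) : ∃ U : Set ℂ, IsOpen U ∧ x ∈ U ∧
      ∀ n : ℕ, n ≠ 0 → ∀ u ∈ U, h^[n] u ∉ U := by
  have hne : x ≠ h x := fun e => hx ((hfix x).1 e.symm)
  obtain ⟨A, B, oA, oB, hA, hB, hAB⟩ := t2_separation hne
  have oW : IsOpen (A ∩ h ⁻¹' B ∩ {0}ᶜ) :=
    (oA.inter (oB.preimage h.continuous)).inter isOpen_compl_singleton
  obtain ⟨r, hr, hb⟩ := Metric.isOpen_iff.1 oW x ⟨⟨hA, hB⟩, hx⟩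
  have pB : IsPathConnected (Metric.ball x r) :=
    (convex_ball x r).isPathConnected ⟨x, Metric.mem_ball_self hr⟩
  refine ⟨Metric.ball x r, Metric.isOpen_ball, Metric.mem_ball_self hr, fun n hn => ?_⟩
  refine free_set S M eH pB (fun h0 => (hb h0).2 rfl) ?_ (Nat.one_le_iff_ne_zero.2 hn)
  exact fun u hu hu' => disjoint_left.1 hAB (hb hu').1.1 (hb hu).1.2

lemma orbit {k : ℂ ≃ₜ ℂ} (k0 : k 0 = 0)
    (W : ∀ x : ℂ, x ≠ 0 → ∃ U : Set ℂ, IsOpen U ∧ x ∈ U ∧ ∀ n : ℕ, n ≠ 0 → ∀ u ∈ U, k^[n] u ∉ U)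
    (x : ℂ) : Tendsto (fun n => k^[n] x) atTop (nhds 0) ∨
      Tendsto (fun n => k^[n] x) atTop (cocompact ℂ) := by
  have claim : ∀ C : Set ℂ, IsCompact C → (0:ℂ) ∉ C → ∀ᶠ n in atTop, k^[n] x ∉ C := by
    intro C cC h0
    refine cC.induction_on (p := fun s => ∀ᶠ n in atTop, k^[n] x ∉ s) ?_ ?_ ?_ ?_
    · simp
    · exact fun s t hst h => h.mono fun n hn hn' => hn (hst hn')
    · intro s t h1 h2
      filter_upwards [h1, h2] with n a b
      rintro (h | h)
      · exact a h
      · exact b h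
    · intro c hc
      obtain ⟨U, oU, hcU, hU⟩ := W c (fun e => h0 (e ▸ hc))
      refine ⟨U, mem_nhdsWithin_of_mem_nhds (oU.mem_nhds hcU), ?_⟩
      by_cases hm : ∃ m, k^[m] x ∈ U
      · obtain ⟨m, hm⟩ := hm
        filter_upwards [eventually_gt_atTop m] with n hn hn'
        apply hU (n - m) (by omega) _ hm
        rw [← Function.iterate_add_apply, Nat.sub_add_cancel hn.le]
        exact hn'
      · push Not at hm
        exact Eventually.of_forall hm
  by_cases ht : Tendsto (fun n => k^[n] x) atTop (nhds 0)
  · exact Or.inl ht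
  right
  rw [Metric.tendsto_nhds] at ht
  push Not at ht
  obtain ⟨ε, hε, hf⟩ := ht
  simp only [dist_zero_right] at hf
  obtain ⟨r', hr', hrb⟩ := Metric.continuous_iff.1 k.continuous 0 ε hε
  rw [← Metric.cobounded_eq_cocompact, ← tendsto_norm_atTop_iff_cobounded, tendsto_atTop]
  intro R
  set r := min r' ε with hr
  have hr0 : 0 < r := lt_min hr' hε
  set Q := max R ε
  have ev := claim (Metric.closedBall 0 Q \ Metric.ball 0 r)
    ((isCompact_closedBall _ _).diff Metric.isOpen_ball) (by simp [hr0])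
  rw [eventually_atTop] at ev
  obtain ⟨N, hN⟩ := ev
  have alt : ∀ n ≥ N, ‖k^[n] x‖ < r ∨ Q < ‖k^[n] x‖ := by
    intro n hn
    by_contra hcon
    push Not at hcon
    exact hN n hn ⟨by simpa using hcon.2, by simpa using hcon.1⟩
  have big : ∀ n ≥ N, Q < ‖k^[n] x‖ := by
    intro n hn
    refine (alt n hn).resolve_left fun hlt => ?_
    have stay : ∀ j, ‖k^[n + j] x‖ < r := by
      intro j
      induction j with
      | zero => exact hlt
      | succ j ih =>
        refine (alt (n + (j + 1)) (by omega)).resolve_right fun hq => ?_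
        have := hrb (k^[n + j] x) (by rw [dist_zero_right]; exact ih.trans_le (min_le_left _ _))
        rw [k0, dist_zero_right, ← Function.iterate_succ_apply' (f := k)] at this
        have h2 : ε ≤ Q := le_max_right _ _
        have h3 : (n + j).succ = n + (j + 1) := rfl
        rw [h3] at this
        linarith
    obtain ⟨m, hm, hme⟩ := (frequently_atTop.1 hf) n
    have := stay (m - n)
    rw [Nat.add_sub_cancel' hm] at this
    have h2 : r ≤ ε := min_le_right _ _
    simp only [ge_iff_le] at *
    linarith
  filter_upwards [eventually_ge_atTop N] with n hn
  exact (le_max_left _ _).trans (big n hn).le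

lemma disk_path {D : Set ℂ} (hD : IsClosedDisk D) : IsPathConnected D := by
  obtain ⟨φ⟩ := hD
  have : PathConnectedSpace ↥(Metric.closedBall (0:ℂ) 1) :=
    isPathConnected_iff_pathConnectedSpace.1
      ((convex_closedBall (0:ℂ) 1).isPathConnected ⟨0, by simp⟩)
  have h1 : range (fun z => (φ z : ℂ)) = D := by
    ext w
    constructor
    · rintro ⟨z, rfl⟩; exact (φ z).2
    · exact fun hw => ⟨φ.symm ⟨w, hw⟩, by simp⟩
  rw [← h1]
  exact isPathConnected_range (by fun_prop)

end FB

/-- An orientation-preserving homeomorphism of the plane fixing only `0` with module at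
least `4` is free in the sense of M. Brown: every closed topological disk in
`ℝ² ∖ {0}` disjoint from its image is disjoint from all its iterates. Consequently
every point of `ℝ² ∖ {0}` is wandering, and every forward and backward orbit converges
to `0` or to infinity. -/
theorem stmt8 (h : ℂ ≃ₜ ℂ) (hor : IsotopicToId ⇑h)
    (hfix : ∀ x : ℂ, h x = x ↔ x = 0)
    (hmod : ∀ γ : ℝ → ℂ, IsLoopIn γ → HasDeg γ 1 → ∀ l : ℕ, Decomp (⇑h) γ l → 4 ≤ l) :
    (∀ D : Set ℂ, IsClosedDisk D → (0:ℂ) ∉ D → Disjoint (⇑h '' D) D →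
      ∀ n : ℕ, n ≠ 0 → Disjoint ((⇑h)^[n] '' D) D ∧ Disjoint ((⇑h.symm)^[n] '' D) D) ∧
    (∀ x : ℂ, x ≠ 0 → ∃ U : Set ℂ, IsOpen U ∧ x ∈ U ∧
      ∀ n : ℕ, n ≠ 0 → Disjoint ((⇑h)^[n] '' U) U) ∧
    (∀ x : ℂ, x ≠ 0 →
      (Tendsto (fun n => (⇑h)^[n] x) atTop (nhds 0) ∨
        Tendsto (fun n => (⇑h)^[n] x) atTop (cocompact ℂ)) ∧
      (Tendsto (fun n => (⇑h.symm)^[n] x) atTop (nhds 0) ∨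
        Tendsto (fun n => (⇑h.symm)^[n] x) atTop (cocompact ℂ))) := by
  obtain ⟨F, cF, F0, F1, bF⟩ := hor
  obtain ⟨H, S, eH⟩ := FB.lift_exists h F cF F0 F1 (fun t => (bF t).1) hfix
  have M := FB.mod3 S eH hmod
  have W : ∀ x : ℂ, x ≠ 0 → ∃ U : Set ℂ, IsOpen U ∧ x ∈ U ∧
      ∀ n : ℕ, n ≠ 0 → ∀ u ∈ U, h^[n] u ∉ U := fun x hx => FB.wander S M eH hfix hx
  have W' : ∀ x : ℂ, x ≠ 0 → ∃ U : Set ℂ, IsOpen U ∧ x ∈ U ∧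
      ∀ n : ℕ, n ≠ 0 → ∀ u ∈ U, h.symm^[n] u ∉ U := by
    intro x hx
    obtain ⟨U, oU, hxU, hU⟩ := W x hx
    refine ⟨U, oU, hxU, fun n hn u hu hu' => hU n hn _ hu' ?_⟩
    rw [FB.symm_iter]; exact hu
  have h0 : h 0 = 0 := (hfix 0).2 rfl
  have h0' : h.symm 0 = 0 := by rw [Homeomorph.symm_apply_eq, h0]
  refine ⟨fun D hD hD0 hfr n hn => ?_, fun x hx => ?_, fun x _ =>
    ⟨FB.orbit h0 W x, FB.orbit h0' W' x⟩⟩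
  · have key := FB.free_set S M eH (FB.disk_path hD) hD0
      (fun u hu => disjoint_left.1 hfr ⟨u, hu, rfl⟩) (Nat.one_le_iff_ne_zero.2 hn)
    constructor
    · rw [disjoint_left]
      rintro _ ⟨u, hu, rfl⟩
      exact key u hu
    · rw [disjoint_left]
      rintro _ ⟨u, hu, rfl⟩ hu'
      apply key _ hu'
      rw [FB.symm_iter]; exact hu
  · obtain ⟨U, oU, hxU, hU⟩ := W x hx
    refine ⟨U, oU, hxU, fun n hn => ?_⟩
    rw [disjoint_left]
    rintro _ ⟨u, hu, rfl⟩
    exact hU n hn u hu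
end

section
/- Let H be a Brouwer homeomorphism (a fixed-point-free orientation-preserving homeomorphism of the plane) with associated integer-valued distance d_H. Let (x, y) be a singular pair for H or for H^{-1}, and let x', y' be points with d_H(x', x) ≤ 1 and d_H(y, y') ≤ 1. Then d_H(x', y') ≤ 2. -/
open Set

/-- A free arc for `H`: a continuous curve on `[0,1]` whose image is disjoint from its
image under `H`. -/
def FreeArc (H : ℂ → ℂ) (γ : ℝ → ℂ) : Prop :=
  ContinuousOn γ (Icc 0 1) ∧ ∀ s ∈ Icc (0:ℝ) 1, ∀ s' ∈ Icc (0:ℝ) 1, H (γ s) ≠ γ s'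

/-- `ArcChain H x y n` expresses that `x` can be connected to `y` by a chain of `n`
free arcs for `H`; thus `d_H(x, y) ≤ n`. -/
def ArcChain (H : ℂ → ℂ) (x y : ℂ) (n : ℕ) : Prop :=
  ∃ p : ℕ → ℂ, p 0 = x ∧ p n = y ∧
    ∀ i < n, ∃ γ : ℝ → ℂ, FreeArc H γ ∧ γ 0 = p i ∧ γ 1 = p (i + 1)

/-- A pair `(x, y)` is singular for `H` if every pair of neighborhoods of `x` and `y`
is connected by some positive iterate of `H`. -/
def Singular (H : ℂ → ℂ) (x y : ℂ) : Prop :=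
  ∀ U V : Set ℂ, IsOpen U → x ∈ U → IsOpen V → y ∈ V →
    ∃ n : ℕ, 0 < n ∧ ((H^[n] '' U) ∩ V).Nonempty


lemma lift_log {X : Type} [TopologicalSpace X] (Q : ℝ × X → ℂ) (hQ : Continuous Q)
    (h0 : ∀ x, Q (0, x) = 1) (hne : ∀ t x, Q (t, x) ≠ 0) :
    ∃ L : X → ℂ, Continuous L ∧ (∀ x, Complex.exp (L x) = Q (1, x)) ∧
      ∀ x x', (∀ t, Q (t, x) = Q (t, x')) → L x = L x' := by
  let cov := Complex.isCoveringMap_exp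
  let K : C(unitInterval × X, {z : ℂ // z ≠ 0}) :=
    ⟨fun q => ⟨Q (q.1, q.2), hne _ _⟩, by
      refine Continuous.subtype_mk (hQ.comp ?_) _
      fun_prop⟩
  have K0 : ∀ x, K (0, x) = (⟨_, Complex.exp_ne_zero ((0 : C(X, ℂ)) x)⟩ : {z : ℂ // z ≠ 0}) := by
    intro x
    apply Subtype.ext
    simp [K, h0]
  let LL := cov.liftHomotopy K (0 : C(X, ℂ)) K0
  refine ⟨fun x => LL (1, x), by fun_prop, ?_, ?_⟩
  · intro x
    have := congrFun (cov.liftHomotopy_lifts K (0 : C(X, ℂ)) K0) (1, x)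
    have := congrArg Subtype.val this
    simpa [K, LL] using this
  · intro x x' h
    have hc : K.comp ((ContinuousMap.id unitInterval).prodMk (.const _ x)) =
      K.comp ((ContinuousMap.id unitInterval).prodMk (.const _ x')) := by
      ext t
      simp [K, h]
    let Γ : C(unitInterval, ℂ) := LL.comp ((ContinuousMap.id unitInterval).prodMk (.const _ x))
    let Γ' : C(unitInterval, ℂ) := LL.comp ((ContinuousMap.id unitInterval).prodMk (.const _ x'))
    have e0 : (K.comp ((ContinuousMap.id unitInterval).prodMk (.const _ x))) 0 =
      (⟨_, Complex.exp_ne_zero 0⟩ : {z : ℂ // z ≠ 0}) := by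
      simpa using K0 x
    have hL := cov.liftHomotopy_lifts K (0 : C(X, ℂ)) K0
    have hz := cov.liftHomotopy_zero K (0 : C(X, ℂ)) K0
    have h1 : Γ = cov.liftPath _ 0 e0 := by
      rw [cov.eq_liftPath_iff']
      constructor
      · ext t
        exact congrArg Subtype.val (congrFun hL (t, x))
      · exact hz x
    have h2 : Γ' = cov.liftPath _ 0 e0 := by
      rw [cov.eq_liftPath_iff']
      constructor
      · ext t
        rw [hc]
        exact congrArg Subtype.val (congrFun hL (t, x'))
      · exact hz x'
    have h3 : Γ = Γ' := h1.trans h2.symm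
    exact congrArg (fun f : C(unitInterval, ℂ) => f 1) h3

/-- `G` preserves winding of pairs: the quotient of differences has a symmetric logarithm. -/
def PairLog (G : ℂ → ℂ) : Prop :=
  ∃ L : ℂ × ℂ → ℂ, ContinuousOn L {p | p.1 ≠ p.2} ∧ (∀ z w, z ≠ w → L (z, w) = L (w, z)) ∧
    ∀ z w, z ≠ w → G z - G w = (z - w) * Complex.exp (L (z, w))

lemma pairLog_of_isotopic {h : ℂ → ℂ} (hi : IsotopicToId h) : PairLog h := by
  obtain ⟨F, hF, F0, F1, hb⟩ := hi
  have hsub : ∀ x : {p : ℂ × ℂ // p.1 ≠ p.2}, x.1.1 - x.1.2 ≠ 0 := fun x => sub_ne_zero.2 x.2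
  obtain ⟨L, Lc, Le, Ls⟩ := lift_log (X := {p : ℂ × ℂ // p.1 ≠ p.2})
    (fun q => (F q.1 q.2.1.1 - F q.1 q.2.1.2) / (q.2.1.1 - q.2.1.2)) (by
      refine Continuous.div ?_ (by fun_prop) (fun q => hsub q.2)
      have h1 : Continuous fun q : ℝ × {p : ℂ × ℂ // p.1 ≠ p.2} => Function.uncurry F (q.1, q.2.1.1) :=
        hF.comp (by fun_prop)
      have h2 : Continuous fun q : ℝ × {p : ℂ × ℂ // p.1 ≠ p.2} => Function.uncurry F (q.1, q.2.1.2) :=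
        hF.comp (by fun_prop)
      exact h1.sub h2) (by
      intro x
      simp only [F0, id]
      exact div_self (hsub x)) (by
      intro t x
      exact div_ne_zero (sub_ne_zero.2 fun e => x.2 ((hb t).1 e)) (hsub x))
  classical
  refine ⟨fun p => if hp : p.1 ≠ p.2 then L ⟨p, hp⟩ else 0, ?_, ?_, ?_⟩
  · rw [continuousOn_iff_continuous_domRestrict]
    refine Lc.congr ?_
    intro x
    have hx : x.1.1 ≠ x.1.2 := x.2
    simp [hx]
  · intro z w hzw
    have hwz := hzw.symm
    simp only [ne_eq, hzw, hwz, not_false_eq_true, dite_true]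
    apply Ls
    intro t
    simp only
    rw [← neg_sub (F t w), ← neg_sub w z, neg_div_neg_eq]
  · intro z w hzw
    simp only [ne_eq, hzw, not_false_eq_true, dite_true]
    rw [Le]
    simp only [F1]
    rw [mul_div_cancel₀ _ (sub_ne_zero.2 hzw)]

lemma PairLog.inj {G : ℂ → ℂ} (h : PairLog G) : Function.Injective G := by
  obtain ⟨L, -, -, hL⟩ := h
  intro z w e
  by_contra hne
  have := hL z w hne
  rw [e, sub_self] at this
  exact mul_ne_zero (sub_ne_zero.2 hne) (Complex.exp_ne_zero _) this.symm

lemma PairLog.comp {G K : ℂ → ℂ} (hG : PairLog G) (hK : PairLog K) (cK : Continuous K) :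
    PairLog (G ∘ K) := by
  have iK := hK.inj
  obtain ⟨L, Lc, Ls, hL⟩ := hG
  obtain ⟨M, Mc, Ms, hM⟩ := hK
  refine ⟨fun p => L (K p.1, K p.2) + M p, ?_, ?_, ?_⟩
  · refine ContinuousOn.add (Lc.comp (f := fun p : ℂ × ℂ => (K p.1, K p.2)) (by fun_prop) ?_) Mc
    intro p hp
    exact fun e => hp (iK e)
  · intro z w hzw
    simp only
    rw [Ls _ _ (fun e => hzw (iK e)), Ms _ _ hzw]
  · intro z w hzw
    simp only [Function.comp]
    rw [hL _ _ (fun e => hzw (iK e)), hM _ _ hzw, Complex.exp_add]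
    ring

lemma PairLog.symm {G : ℂ ≃ₜ ℂ} (hG : PairLog G) : PairLog G.symm := by
  obtain ⟨L, Lc, Ls, hL⟩ := hG
  have iK := G.symm.injective
  refine ⟨fun p => - L (G.symm p.1, G.symm p.2), ?_, ?_, ?_⟩
  · refine (Lc.comp (f := fun p : ℂ × ℂ => (G.symm p.1, G.symm p.2)) (by fun_prop) ?_).neg
    intro p hp
    exact fun e => hp (iK e)
  · intro z w hzw
    simp only
    rw [Ls _ _ (fun e => hzw (iK e))]
  · intro z w hzw
    have := hL _ _ (fun e => hzw (iK e))
    simp only [Homeomorph.apply_symm_apply] at this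
    simp only
    rw [this, Complex.exp_neg, mul_assoc, mul_inv_cancel₀ (Complex.exp_ne_zero _), mul_one]

lemma PairLog.id : PairLog (fun z => z) :=
  ⟨fun _ => 0, continuousOn_const, by simp, by simp⟩

lemma no_period_two {G : ℂ → ℂ} (cG : Continuous G) (hf : ∀ z, G z ≠ z) (hP : PairLog G) (p : ℂ) :
    G (G p) ≠ p := by
  obtain ⟨L, Lc, Ls, hL⟩ := hP
  intro hp
  have hv : ∀ z, G z - z ≠ 0 := fun z => sub_ne_zero.2 (hf z)
  obtain ⟨ψ, ψc, ψe, -⟩ := lift_log (X := ℂ)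
    (fun q => (G (q.1 * q.2) - q.1 * q.2) / (G 0 - 0))
    (by fun_prop) (by intro x; simp only [Complex.ofReal_zero, zero_mul]; exact div_self (hv 0))
    (by intro t x; exact div_ne_zero (hv _) (hv 0))
  have ψv : ∀ z, G z - z = (G 0 - 0) * Complex.exp (ψ z) := by
    intro z
    rw [ψe]
    simp only [Complex.ofReal_one, one_mul]
    rw [mul_div_cancel₀ _ (hv 0)]
  let g : ℂ → ℂ := fun z => ψ (G z) - ψ z - L (G z, z)
  have gc : Continuous g := by
    refine ((ψc.comp cG).sub ψc).sub ?_
    exact Lc.comp_continuous (f := fun z => (G z, z)) (by fun_prop) (fun z => hf z)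
  have ge : ∀ z, Complex.exp (g z) = 1 := by
    intro z
    have h1 := ψv (G z)
    rw [hL _ _ (hf z), ψv z] at h1
    have h2 : Complex.exp (ψ z) * Complex.exp (L (G z, z)) = Complex.exp (ψ (G z)) := by
      apply mul_left_cancel₀ (hv 0)
      rw [← h1]; ring
    simp only [g]
    rw [Complex.exp_sub, Complex.exp_sub, ← h2]
    field_simp
  have hgm : ∀ z, g z ∈ (AddSubgroup.zmultiples (2 * Real.pi * Complex.I) : Set ℂ) := by
    intro z
    obtain ⟨n, hn⟩ := Complex.exp_eq_one_iff.1 (ge z)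
    exact ⟨n, by simp [hn]⟩
  have hdisc : DiscreteTopology (AddSubgroup.zmultiples (2 * Real.pi * Complex.I) : Set ℂ) :=
    NormedSpace.discreteTopology_zmultiples _
  obtain hgg : g p = g (G p) := isPreconnected_univ.constant_of_mapsTo
    (T := (AddSubgroup.zmultiples (2 * Real.pi * Complex.I) : Set ℂ)) ⟨hdisc⟩ gc.continuousOn
    (fun z _ => hgm z) (mem_univ _) (mem_univ _)
  simp only [g, hp] at hgg
  rw [Ls _ _ (hf p)] at hgg
  have h3 : ψ (G p) = ψ p := by linear_combination hgg / 2
  have h4 := ψv (G p)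
  rw [h3, ← ψv p, hp] at h4
  apply hv p
  linear_combination -h4 / 2

/-- A homeomorphism supported in `D` which preserves winding of pairs. -/
def Push (D : Set ℂ) (φ : ℂ ≃ₜ ℂ) : Prop := (∀ z, z ∉ D → φ z = z) ∧ PairLog φ

lemma Push.trans {D : Set ℂ} {φ χ : ℂ ≃ₜ ℂ} (h : Push D φ) (k : Push D χ) :
    Push D (φ.trans χ) := by
  refine ⟨fun z hz => ?_, ?_⟩
  · simp [h.1 z hz, k.1 z hz]
  · exact k.2.comp h.2 φ.continuous

lemma Push.symm {D : Set ℂ} {φ : ℂ ≃ₜ ℂ} (h : Push D φ) : Push D φ.symm := by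
  refine ⟨fun z hz => ?_, h.2.symm⟩
  rw [Homeomorph.symm_apply_eq, h.1 z hz]

lemma Push.mono {D E : Set ℂ} {φ : ℂ ≃ₜ ℂ} (h : Push D φ) (hs : D ⊆ E) : Push E φ :=
  ⟨fun z hz => h.1 z (fun hh => hz (hs hh)), h.2⟩

lemma Push.mem {D : Set ℂ} {φ : ℂ ≃ₜ ℂ} (h : Push D φ) {z : ℂ} (hz : z ∈ D) : φ z ∈ D := by
  by_contra hn
  have := φ.injective (h.1 _ hn)
  rw [this] at hn
  exact hn hz

lemma Push.refl (D : Set ℂ) : Push D (Homeomorph.refl ℂ) := ⟨fun _ _ => rfl, PairLog.id⟩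

lemma ball_push (c : ℂ) (r : ℝ) (v : ℂ) (hv : v ∈ Metric.ball c r) :
    ∃ φ, Push (Metric.ball c r) φ ∧ φ c = v := by
  have hr : 0 < r := Metric.pos_of_mem_ball hv
  set w : ℂ := (v - c) / r with hw
  have hw1 : ‖w‖ < 1 := by
    rw [hw, norm_div, Complex.norm_real, Real.norm_eq_abs, abs_of_pos hr, div_lt_one hr]
    simpa [dist_eq_norm] using hv
  let g : ℂ → ℝ := fun z => max 0 (r - ‖z - c‖)
  have gl : ∀ z u, |g z - g u| ≤ ‖z - u‖ := by
    intro z u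
    refine (abs_max_sub_max_le_max _ _ _ _).trans ?_
    simp only [sub_self, abs_zero]
    refine max_le (norm_nonneg _) ?_
    have := abs_norm_sub_norm_le (u - c) (z - c)
    rw [show u - c - (z - c) = -(z - u) by ring, norm_neg] at this
    rwa [show r - ‖z - c‖ - (r - ‖u - c‖) = ‖u - c‖ - ‖z - c‖ by ring]
  have gc : Continuous g := by fun_prop
  let f : ℂ → ℂ := fun z => z + g z * w
  have key : ∀ z u, ‖((g z - g u : ℝ) : ℂ) * w‖ ≤ ‖w‖ * ‖z - u‖ := by
    intro z u
    rw [norm_mul, Complex.norm_real, Real.norm_eq_abs, mul_comm]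
    exact mul_le_mul_of_nonneg_left (gl z u) (norm_nonneg _)
  have happ : ApproximatesLinearOn f ((ContinuousLinearEquiv.refl ℂ ℂ : ℂ ≃L[ℂ] ℂ) : ℂ →L[ℂ] ℂ)
      univ ‖w‖₊ := by
    intro z _ u _
    have : f z - f u - ((ContinuousLinearEquiv.refl ℂ ℂ : ℂ ≃L[ℂ] ℂ) : ℂ →L[ℂ] ℂ) (z - u)
        = ((g z - g u : ℝ) : ℂ) * w := by
      simp [f]; ring
    rw [this]
    exact key z u
  let φ : ℂ ≃ₜ ℂ := happ.toHomeomorph _ (Or.inr (by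
    have : ‖((ContinuousLinearEquiv.refl ℂ ℂ).symm : ℂ →L[ℂ] ℂ)‖₊ = 1 := by
      simp
    rw [this, inv_one]
    exact hw1))
  have φf : ∀ z, φ z = f z := fun z => rfl
  refine ⟨φ, ⟨?_, ?_⟩, ?_⟩
  · intro z hz
    have : r ≤ ‖z - c‖ := by simpa [dist_eq_norm] using hz
    rw [φf]
    simp [f, g, this]
  · have lt1 : ∀ z u, z ≠ u → ‖((g z - g u : ℝ) : ℂ) * w / (z - u)‖ < 1 := by
      intro z u hne
      have hp : 0 < ‖z - u‖ := norm_pos_iff.2 (sub_ne_zero.2 hne)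
      rw [norm_div, div_lt_one hp]
      refine (key z u).trans_lt ?_
      nlinarith
    have slit : ∀ z u, z ≠ u → 1 + ((g z - g u : ℝ) : ℂ) * w / (z - u) ∈ Complex.slitPlane := by
      intro z u hne
      exact Complex.mem_slitPlane_of_norm_lt_one (lt1 z u hne)
    refine ⟨fun p => Complex.log (1 + ((g p.1 - g p.2 : ℝ) : ℂ) * w / (p.1 - p.2)), ?_, ?_, ?_⟩
    · refine ContinuousOn.clog ?_ (fun p hp => slit _ _ hp)
      refine continuousOn_const.add (ContinuousOn.div ?_ (by fun_prop) ?_)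
      · exact Continuous.continuousOn (by fun_prop)
      · intro p hp
        exact sub_ne_zero.2 hp
    · intro z u hne
      simp only
      congr 2
      rw [← neg_sub u z, div_neg, ← neg_div]
      congr 1
      push_cast
      ring
    · intro z u hne
      simp only
      rw [Complex.exp_log (Complex.slitPlane_ne_zero (slit z u hne)), φf, φf]
      have := sub_ne_zero.2 hne
      field_simp
      simp only [f]
      push_cast
      ring
  · rw [φf]
    have : (r : ℂ) ≠ 0 := by exact_mod_cast hr.ne'
    simp only [f, g, sub_self, norm_zero, sub_zero, max_eq_right hr.le, hw]
    field_simp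
    ring

lemma push_trans {D : Set ℂ} (hD : IsOpen D) (hc : IsPreconnected D) {u v : ℂ} (hu : u ∈ D)
    (hv : v ∈ D) : ∃ φ, Push D φ ∧ φ u = v := by
  let S : Set ℂ := {v | v ∈ D ∧ ∃ φ, Push D φ ∧ φ u = v}
  let T : Set ℂ := {v | v ∈ D ∧ ¬ ∃ φ, Push D φ ∧ φ u = v}
  have hS : IsOpen S := by
    rw [Metric.isOpen_iff]
    rintro x ⟨hx, φ, hφ, e⟩
    obtain ⟨r, hr, hb⟩ := Metric.isOpen_iff.1 hD x hx
    refine ⟨r, hr, fun y hy => ⟨hb hy, ?_⟩⟩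
    obtain ⟨χ, hχ, e'⟩ := ball_push x r y hy
    exact ⟨φ.trans χ, hφ.trans (hχ.mono hb), by simp [e, e']⟩
  have hT : IsOpen T := by
    rw [Metric.isOpen_iff]
    rintro x ⟨hx, hn⟩
    obtain ⟨r, hr, hb⟩ := Metric.isOpen_iff.1 hD x hx
    refine ⟨r, hr, fun y hy => ⟨hb hy, ?_⟩⟩
    rintro ⟨φ, hφ, e⟩
    obtain ⟨χ, hχ, e'⟩ := ball_push x r y hy
    exact hn ⟨φ.trans χ.symm, hφ.trans (hχ.mono hb).symm, by simp [e, ← e']⟩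
  have : D ⊆ S := hc.subset_left_of_subset_union hS hT
    (by rw [Set.disjoint_left]; rintro x ⟨_, h⟩ ⟨_, h'⟩; exact h' h)
    (by intro x hx; by_cases h : ∃ φ, Push D φ ∧ φ u = x
        · exact Or.inl ⟨hx, h⟩
        · exact Or.inr ⟨hx, h⟩)
    ⟨u, hu, hu, _, Push.refl D, rfl⟩
  exact (this hv).2

lemma punctured_ball (p : ℂ) (r : ℝ) (hr : 0 < r) : IsPreconnected (Metric.ball p r \ {p}) := by
  have h1 : IsPreconnected {w : ℂ | w.re < Real.log r} :=
    (convex_halfSpace_re_lt _).isPreconnected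
  have h2 := h1.image (fun w => p + Complex.exp w) (by fun_prop)
  convert h2 using 1
  ext z
  simp only [mem_sdiff, Metric.mem_ball, mem_singleton_iff, mem_image, mem_ofPred_eq]
  constructor
  · rintro ⟨hz, hne⟩
    refine ⟨Complex.log (z - p), ?_, ?_⟩
    · rw [Complex.log_re]
      apply Real.log_lt_log (norm_pos_iff.2 (sub_ne_zero.2 hne))
      rwa [← dist_eq_norm]
    · rw [Complex.exp_log (sub_ne_zero.2 hne)]; ring
  · rintro ⟨w, hw, rfl⟩
    refine ⟨?_, by simp⟩
    rw [dist_eq_norm, add_sub_cancel_left, Complex.norm_exp]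
    exact (Real.lt_log_iff_exp_lt hr).1 hw

lemma punctured {D : Set ℂ} (hD : IsOpen D) (hc : IsPreconnected D) (p : ℂ) :
    IsPreconnected (D \ {p}) := by
  by_cases hp : p ∈ D
  swap
  · rwa [sdiff_singleton_eq_self hp]
  obtain ⟨r, hr, hb⟩ := Metric.isOpen_iff.1 hD p hp
  have main : ∀ u v, IsOpen u → IsOpen v → D \ {p} ⊆ u ∪ v → D \ {p} ∩ (u ∩ v) = ∅ →
      Metric.ball p r \ {p} ⊆ u → D \ {p} ⊆ u := by
    intro u v hu hv hs hd hbu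
    have h := isPreconnected_iff_subset_of_disjoint.1 hc (u ∪ Metric.ball p r) (v \ {p})
      (hu.union Metric.isOpen_ball) (hv.sdiff isClosed_singleton) (by
        intro x hx
        by_cases hxp : x = p
        · exact Or.inl (Or.inr (by rw [hxp]; exact Metric.mem_ball_self hr))
        · rcases hs ⟨hx, hxp⟩ with h | h
          · exact Or.inl (Or.inl h)
          · exact Or.inr ⟨h, hxp⟩) (by
        rw [Set.eq_empty_iff_forall_notMem] at hd ⊢
        rintro x ⟨hx, h1, h2, hxp⟩
        refine hd x ⟨⟨hx, hxp⟩, ?_, h2⟩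
        rcases h1 with h1 | h1
        · exact h1
        · exact hbu ⟨h1, hxp⟩)
    rcases h with h | h
    · rintro x ⟨hx, hxp⟩
      rcases h hx with h1 | h1
      · exact h1
      · exact hbu ⟨h1, hxp⟩
    · exact absurd rfl (h hp).2
  rw [isPreconnected_iff_subset_of_disjoint]
  intro u v hu hv hs hd
  have hsub : Metric.ball p r \ {p} ⊆ D \ {p} := fun x hx => ⟨hb hx.1, hx.2⟩
  rcases isPreconnected_iff_subset_of_disjoint.1 (punctured_ball p r hr) u v hu hv
    (hsub.trans hs) (by
      rw [← Set.subset_empty_iff, ← hd]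
      exact inter_subset_inter_left _ hsub) with h | h
  · exact Or.inl (main u v hu hv hs hd h)
  · exact Or.inr (main v u hv hu (by rwa [union_comm]) (by rwa [inter_comm v u]) h)

lemma push_two {D : Set ℂ} (hD : IsOpen D) (hc : IsPreconnected D) {a' p a b : ℂ}
    (ha' : a' ∈ D) (hp : p ∈ D) (ha : a ∈ D) (hb : b ∈ D) (h1 : a' ≠ p) (h2 : a ≠ b) :
    ∃ φ, Push D φ ∧ φ a' = a ∧ φ p = b := by
  have hinf : D.Infinite := infinite_of_mem_nhds a' (hD.mem_nhds ha')
  obtain ⟨m, hm, hm'⟩ := (hinf.sdiff (Set.toFinite {a', a})).nonempty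
  simp only [mem_insert_iff, mem_singleton_iff, not_or] at hm'
  have hop : ∀ x, IsOpen (D \ {x}) := fun x => hD.sdiff isClosed_singleton
  obtain ⟨φ₁, P1, e1⟩ := push_trans (hop a') (punctured hD hc a') (u := p) (v := m)
    ⟨hp, h1.symm⟩ ⟨hm, hm'.1⟩
  obtain ⟨φ₂, P2, e2⟩ := push_trans (hop m) (punctured hD hc m) (u := a') (v := a)
    ⟨ha', fun e => hm'.1 e.symm⟩ ⟨ha, fun e => hm'.2 e.symm⟩
  obtain ⟨φ₃, P3, e3⟩ := push_trans (hop a) (punctured hD hc a) (u := m) (v := b)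
    ⟨hm, hm'.2⟩ ⟨hb, h2.symm⟩
  refine ⟨(φ₁.trans φ₂).trans φ₃, ((P1.mono sdiff_subset).trans (P2.mono sdiff_subset)).trans
    (P3.mono sdiff_subset), ?_, ?_⟩
  · simp [P1.1 a' (by simp), e2, P3.1 a (by simp)]
  · simp [e1, P2.1 m (by simp), e3]

/-- Free sets. -/
def Free (H : ℂ → ℂ) (D : Set ℂ) : Prop := ∀ z ∈ D, H z ∉ D

lemma franks_two {H : ℂ ≃ₜ ℂ} (hf : ∀ z, H z ≠ z) (hP : PairLog H) {D : Set ℂ}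
    (hD : IsOpen D) (hc : IsPreconnected D) (hfr : Free H D) :
    ∀ z ∈ D, H (H z) ∉ D := by
  intro z hz hzz
  obtain ⟨φ, hφ, e⟩ := push_trans hD hc hzz hz
  refine no_period_two (G := φ ∘ H) (by fun_prop) ?_ (hφ.2.comp hP H.continuous) z ?_
  · intro x hx
    simp only [Function.comp] at hx
    by_cases h : H x ∈ D
    · have := hφ.mem h
      rw [hx] at this
      exact hfr x this h
    · rw [hφ.1 _ h] at hx
      exact hf x hx
  · simp only [Function.comp]
    rw [hφ.1 (H z) (hfr z hz), e]

lemma Free.mono {H : ℂ → ℂ} {D E : Set ℂ} (h : Free H E) (hs : D ⊆ E) : Free H D :=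
  fun z hz hz' => h z (hs hz) (hs hz')

lemma Free.symm {H : ℂ ≃ₜ ℂ} {D : Set ℂ} (h : Free H D) : Free H.symm D := by
  intro z hz hz'
  have := h _ hz'
  rw [Homeomorph.apply_symm_apply] at this
  exact this hz

lemma free_thicken {H : ℂ ≃ₜ ℂ} {K O : Set ℂ} (hK : IsCompact K) (hc : IsPreconnected K)
    (hn : K.Nonempty) (hf : Free H K) (hO : IsOpen O) (hKO : K ⊆ O) :
    ∃ D, IsOpen D ∧ IsPreconnected D ∧ K ⊆ D ∧ D ⊆ O ∧ Free H D := by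
  have hd : Disjoint K (H '' K) := by
    rw [Set.disjoint_left]
    rintro _ hx ⟨y, hy, rfl⟩
    exact hf y hy hx
  obtain ⟨U, V, hU, hV, hKU, hKV, hUV⟩ :=
    SeparatedNhds.of_isCompact_isCompact hK (hK.image H.continuous) hd
  let W := O ∩ U ∩ H ⁻¹' V
  have hW : IsOpen W := (hO.inter hU).inter (hV.preimage H.continuous)
  have hKW : K ⊆ W := fun z hz => ⟨⟨hKO hz, hKU hz⟩, hKV ⟨z, hz, rfl⟩⟩
  have hWf : Free H W := by
    intro z hz hz'
    exact Set.disjoint_left.1 hUV hz'.1.2 hz.2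
  obtain ⟨x, hx⟩ := hn
  have hsub : connectedComponentIn W x ⊆ W := connectedComponentIn_subset _ _
  exact ⟨connectedComponentIn W x, hW.connectedComponentIn, isPreconnected_connectedComponentIn,
    hc.subset_connectedComponentIn hx hKW, fun z hz => (hsub hz).1.1, hWf.mono hsub⟩

/-- `a` and `b` lie in a common connected free open set. -/
def Fr (H : ℂ → ℂ) (a b : ℂ) : Prop :=
  ∃ D, IsOpen D ∧ IsPreconnected D ∧ Free H D ∧ a ∈ D ∧ b ∈ D

lemma Fr.swap {H : ℂ → ℂ} {a b : ℂ} (h : Fr H a b) : Fr H b a := by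
  obtain ⟨D, h1, h2, h3, h4, h5⟩ := h
  exact ⟨D, h1, h2, h3, h5, h4⟩

lemma Fr.inv {H : ℂ ≃ₜ ℂ} {a b : ℂ} (h : Fr H a b) : Fr H.symm a b := by
  obtain ⟨D, h1, h2, h3, h4, h5⟩ := h
  exact ⟨D, h1, h2, h3.symm, h4, h5⟩

lemma Fr.map {H : ℂ ≃ₜ ℂ} {a b : ℂ} (h : Fr H a b) : Fr H (H a) (H b) := by
  obtain ⟨D, h1, h2, h3, h4, h5⟩ := h
  refine ⟨H '' D, H.isOpenMap _ h1, h2.image _ H.continuous.continuousOn, ?_, ⟨a, h4, rfl⟩,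
    ⟨b, h5, rfl⟩⟩
  rintro _ ⟨z, hz, rfl⟩ ⟨w, hw, e⟩
  rw [H.injective e] at hw
  exact h3 z hz hw

lemma isOpen_Fr (H : ℂ → ℂ) (a : ℂ) : IsOpen {b | Fr H a b} := by
  rw [isOpen_iff_mem_nhds]
  rintro b ⟨D, h1, h2, h3, h4, h5⟩
  filter_upwards [h1.mem_nhds h5] with z hz
  exact ⟨D, h1, h2, h3, h4, hz⟩

lemma Fr.joined {H : ℂ → ℂ} {a b : ℂ} (h : Fr H a b) :
    ∃ γ : ℝ → ℂ, FreeArc H γ ∧ γ 0 = a ∧ γ 1 = b := by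
  obtain ⟨D, h1, h2, h3, h4, h5⟩ := h
  have hpc : IsPathConnected D := h1.isConnected_iff_isPathConnected.1 ⟨⟨a, h4⟩, h2⟩
  obtain ⟨γ, hγ⟩ := hpc.joinedIn a h4 b h5
  have hm : ∀ s, γ.extend s ∈ D := by
    intro s
    have : γ.extend s ∈ range γ := by
      rw [← γ.extend_range]
      exact mem_range_self s
    obtain ⟨t, ht⟩ := this
    rw [← ht]
    exact hγ t
  refine ⟨γ.extend, ⟨γ.continuous_extend.continuousOn, ?_⟩, γ.extend_zero, γ.extend_one⟩
  intro s _ s' _ e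
  exact h3 _ (hm s) (by rw [e]; exact hm s')

lemma fr_of_arc {H : ℂ ≃ₜ ℂ} {γ : ℝ → ℂ} (h : FreeArc H γ) : Fr H (γ 0) (γ 1) := by
  obtain ⟨hc, hf⟩ := h
  have h0 : γ 0 ∈ γ '' Icc 0 1 := ⟨0, by simp, rfl⟩
  obtain ⟨D, h1, h2, h3, -, h5⟩ := free_thicken (H := H) (K := γ '' Icc 0 1) (O := univ)
    (isCompact_Icc.image_of_continuousOn hc) (isPreconnected_Icc.image _ hc) ⟨_, h0⟩
    (by
      rintro _ ⟨s, hs, rfl⟩ ⟨s', hs', e⟩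
      exact hf s hs s' hs' e.symm) isOpen_univ (subset_univ _)
  exact ⟨D, h1, h2, h5, h3 h0, h3 ⟨1, by simp, rfl⟩⟩

lemma core {H : ℂ ≃ₜ ℂ} (hf : ∀ z, H z ≠ z) (hP : PairLog H) {A : Set ℂ} (hA : IsCompact A)
    (hAc : IsPreconnected A) {σ : ℝ → ℂ} (hσ : Continuous σ) (h0 : σ 0 ∈ A) {T : ℝ}
    (hfr : ∀ t, 0 ≤ t → t < T → Free H (A ∪ σ '' Icc 0 t)) {t₀ : ℝ} (ht₀ : 0 ≤ t₀) (ht₀T : t₀ < T)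
    {p : ℂ} (hp : p ∈ A ∪ σ '' Icc 0 t₀) (hpq : H p = σ T) {a b : ℂ} (ha : a ∈ A) (hb : b ∈ A)
    (hab : a ≠ b) : Fr H a (H b) := by
  let K : ℝ → Set ℂ := fun t => A ∪ σ '' Icc 0 t
  have Kcomp : ∀ t, IsCompact (K t) := fun t => hA.union (isCompact_Icc.image hσ)
  have Kmono : ∀ s t, s ≤ t → K s ⊆ K t := fun s t hst =>
    union_subset_union_right _ (image_mono (Icc_subset_Icc_right hst))
  have Kconn : ∀ t, 0 ≤ t → IsPreconnected (K t) := fun t ht =>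
    IsPreconnected.union (σ 0) h0 ⟨0, by simp [ht], rfl⟩ hAc
      (isPreconnected_Icc.image _ hσ.continuousOn)
  have Kne : ∀ t, (K t).Nonempty := fun t => ⟨_, Or.inl h0⟩
  have hK2 : ∀ t, 0 ≤ t → t < T → ∀ z ∈ K t, H (H z) ∉ K t := by
    intro t h1 h2 z hz hzz
    obtain ⟨D, d1, d2, d3, -, d5⟩ := free_thicken (Kcomp t) (Kconn t h1) (Kne t) (hfr t h1 h2)
      isOpen_univ (subset_univ _)
    exact franks_two hf hP d1 d2 d5 z (d3 hz) (d3 hzz)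
  have Ksplit : ∀ z ∈ K T, z = σ T ∨ ∃ t, t₀ ≤ t ∧ t < T ∧ z ∈ K t := by
    rintro z (hz | ⟨s, hs, rfl⟩)
    · exact Or.inr ⟨t₀, le_rfl, ht₀T, Or.inl hz⟩
    · rcases hs.2.eq_or_lt with h | h
      · exact Or.inl (by rw [h])
      · exact Or.inr ⟨max t₀ s, le_max_left _ _, max_lt ht₀T h, Or.inr ⟨s, ⟨hs.1, le_max_right _ _⟩, rfl⟩⟩
  have q1 : ∀ z ∈ K T, H (H z) ≠ σ T := by
    intro z hz e
    rcases Ksplit z hz with rfl | ⟨t, h1, h2, h3⟩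
    · exact no_period_two H.continuous hf hP _ e
    · rw [← hpq] at e
      have e' := H.injective e
      have := hfr t (ht₀.trans h1) h2 z h3
      rw [e'] at this
      exact this (Kmono _ _ h1 hp)
  have q2 : ∀ z ∈ K T, H (σ T) ≠ z := by
    rintro z hz rfl
    rcases Ksplit _ hz with h | ⟨t, h1, h2, h3⟩
    · exact hf _ h
    · rw [← hpq] at h3
      exact hK2 t (ht₀.trans h1) h2 p (Kmono _ _ h1 hp) h3
  let C : Set ℂ := (fun z => H (H z)) '' K T ∪ H.symm '' K T ∪ {p}
  have hC : IsClosed C :=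
    ((((Kcomp T).image (by fun_prop)).union ((Kcomp T).image H.symm.continuous)).union
      isCompact_singleton).isClosed
  have qC : σ T ∉ C := by
    rintro ((⟨z, hz, e⟩ | ⟨z, hz, e⟩) | h)
    · exact q1 z hz e
    · exact q2 z hz (by rw [← e, Homeomorph.apply_symm_apply])
    · rw [mem_singleton_iff] at h
      rw [h] at hpq
      exact hf p hpq
  obtain ⟨B, hB, -, hqB, hBC, hBf⟩ := free_thicken (H := H) (K := {σ T}) (O := Cᶜ)
    isCompact_singleton isPreconnected_singleton (singleton_nonempty _)
    (by
      rintro _ rfl h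
      exact hf _ h) hC.isOpen_compl (by simpa using qC)
  have hqB : σ T ∈ B := hqB rfl
  obtain ⟨δ, hδ, hball⟩ := Metric.isOpen_iff.1 (hB.preimage hσ) T hqB
  let t₁ := max t₀ (T - δ / 2)
  have ht₁ : t₀ ≤ t₁ := le_max_left _ _
  have ht₁T : t₁ < T := max_lt ht₀T (by linarith)
  have ht₁0 : 0 ≤ t₁ := ht₀.trans ht₁
  let τ : Set ℂ := σ '' Icc t₁ T
  have τB : τ ⊆ B := by
    rintro _ ⟨s, hs, rfl⟩
    apply hball
    rw [Metric.mem_ball, Real.dist_eq, abs_lt]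
    have : T - δ / 2 ≤ t₁ := le_max_right _ _
    constructor <;> linarith [hs.1, hs.2]
  have τC : ∀ z ∈ τ, z ∉ C := fun z hz => hBC (τB hz)
  have τcomp : IsCompact τ := isCompact_Icc.image hσ
  let O : Set ℂ := ((fun z => H (H z)) ⁻¹' τ ∪ H.symm ⁻¹' τ)ᶜ
  have hO : IsOpen O := by
    apply IsClosed.isOpen_compl (self := ?_)
    exact (τcomp.isClosed.preimage (by fun_prop)).union
      (τcomp.isClosed.preimage H.symm.continuous)
  obtain ⟨D, hD, hDc, hKD, hDO, hDf⟩ := free_thicken (Kcomp t₁) (Kconn t₁ ht₁0) (Kne t₁)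
    (hfr t₁ ht₁0 ht₁T) hO (by
      intro z hz h
      have hzT := Kmono _ _ ht₁T.le hz
      rcases h with h | h
      · exact τC _ h (Or.inl (Or.inl ⟨z, hzT, rfl⟩))
      · exact τC _ h (Or.inl (Or.inr ⟨z, hzT, rfl⟩)))
  have τD1 : ∀ s ∈ τ, H s ∉ D := by
    intro s hs h
    apply hDO h
    right
    simpa using hs
  have τD2 : ∀ s ∈ D, H (H s) ∉ τ := fun s hs h => hDO hs (Or.inl h)
  have D2 := franks_two hf hP hD hDc hDf
  have a'τ : σ t₁ ∈ τ := ⟨t₁, ⟨le_rfl, ht₁T.le⟩, rfl⟩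
  have a'D : σ t₁ ∈ D := hKD (Or.inr ⟨t₁, ⟨ht₁0, le_rfl⟩, rfl⟩)
  have pD : p ∈ D := hKD (Kmono _ _ ht₁ hp)
  have a'p : σ t₁ ≠ p := fun e => τC _ a'τ (Or.inr e)
  have aD : a ∈ D := hKD (Or.inl ha)
  have bD : b ∈ D := hKD (Or.inl hb)
  obtain ⟨φ, hφ, φa, φp⟩ := push_two hD hDc a'D pD aD bD a'p hab
  let ψ : ℂ → ℂ := fun z => φ (H (φ (H.symm z)))
  have ψc : Continuous ψ := by fun_prop
  have ψi : Function.Injective ψ := φ.injective.comp (H.injective.comp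
    (φ.injective.comp H.symm.injective))
  have ψout : ∀ z, H.symm z ∉ D → ψ z = φ z := by
    intro z hz
    simp only [ψ]
    rw [hφ.1 _ hz, Homeomorph.apply_symm_apply]
  have ψa : ψ (σ t₁) = a := by
    rw [ψout, φa]
    exact hDf.symm _ a'D
  have ψb : ψ (σ T) = H b := by
    simp only [ψ]
    rw [← hpq, Homeomorph.symm_apply_apply, φp, hφ.1 _ (hDf b bD)]
  have hfree : Free H (ψ '' τ) := by
    rintro _ ⟨s', hs', rfl⟩ ⟨s, hs, e⟩
    by_cases h : H.symm s' ∈ D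
    · have hz := hφ.mem h
      have e1 : ψ s' = H (φ (H.symm s')) := by
        simp only [ψ]
        rw [hφ.1 _ (hDf _ hz)]
      have e2 : ψ (H (H (φ (H.symm s')))) = H (H (φ (H.symm s'))) := by
        rw [ψout _ (by simpa using hDf _ hz), hφ.1 _ (D2 _ hz)]
      rw [e1, ← e2] at e
      have := ψi e
      rw [this] at hs
      exact τD2 _ hz hs
    · have e1 : H (ψ s') = ψ (H s') := by
        rw [ψout _ h]
        simp only [ψ]
        rw [Homeomorph.symm_apply_apply, hφ.1 (H (φ s'))]
        by_cases h' : s' ∈ D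
        · exact hDf _ (hφ.mem h')
        · rw [hφ.1 _ h']
          exact τD1 _ hs'
      rw [e1] at e
      have := ψi e
      rw [this] at hs
      exact hBf _ (τB hs') (τB hs)
  obtain ⟨E, e1, e2, e3, -, e5⟩ := free_thicken (τcomp.image ψc)
    ((isPreconnected_Icc.image _ hσ.continuousOn).image _ ψc.continuousOn) ⟨_, _, a'τ, rfl⟩ hfree
    isOpen_univ (subset_univ _)
  refine ⟨E, e1, e2, e5, e3 ⟨_, a'τ, ψa⟩, e3 ⟨σ T, ⟨T, ⟨ht₁T.le, le_rfl⟩, rfl⟩, ψb⟩⟩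

lemma Fr.step {H : ℂ ≃ₜ ℂ} (hf : ∀ z, H z ≠ z) (hP : PairLog H) {a b : ℂ} (h : Fr H a b)
    (hab : a ≠ b) : Fr H a (H b) := by
  obtain ⟨γ, ⟨γc, γf⟩, γ0, γ1⟩ := h.joined
  let A : Set ℂ := γ '' Icc 0 1
  have hA : IsCompact A := isCompact_Icc.image_of_continuousOn γc
  have hAc : IsPreconnected A := isPreconnected_Icc.image _ γc
  have aA : a ∈ A := ⟨0, by simp, γ0⟩
  have bA : b ∈ A := ⟨1, by simp, γ1⟩
  have hAf : Free H A := by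
    rintro _ ⟨s, hs, rfl⟩ ⟨s', hs', e⟩
    exact γf s hs s' hs' e.symm
  let σ : ℝ → ℂ := fun t => a + t * (H a - a)
  have hσ : Continuous σ := by fun_prop
  have σ0 : σ 0 = a := by simp [σ]
  have σ1 : σ 1 = H a := by simp [σ]
  have h0 : σ 0 ∈ A := by rw [σ0]; exact aA
  let K : ℝ → Set ℂ := fun t => A ∪ σ '' Icc 0 t
  have Kmono : ∀ s t, s ≤ t → K s ⊆ K t := fun s t hst =>
    union_subset_union_right _ (image_mono (Icc_subset_Icc_right hst))
  let N : Set ℝ := {t | 0 ≤ t ∧ ¬ Free H (K t)}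
  have hN1 : (1 : ℝ) ∈ N := by
    refine ⟨zero_le_one, fun hh => ?_⟩
    exact hh a (Or.inl aA) (Or.inr ⟨1, by simp, σ1⟩)
  have hNb : BddBelow N := ⟨0, fun t ht => ht.1⟩
  let T := sInf N
  have T0 : 0 ≤ T := le_csInf ⟨1, hN1⟩ (fun t ht => ht.1)
  have hfr : ∀ t, 0 ≤ t → t < T → Free H (K t) := by
    intro t ht htT
    by_contra hn
    exact absurd (csInf_le hNb (show t ∈ N from ⟨ht, hn⟩)) (not_le.2 htT)
  have hT : ¬ Free H (K T) := by
    intro hh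
    have hconn : IsPreconnected (K T) := IsPreconnected.union (σ 0) h0 ⟨0, by simp [T0], rfl⟩ hAc
      (isPreconnected_Icc.image _ hσ.continuousOn)
    obtain ⟨W, w1, -, w3, -, w5⟩ := free_thicken (hA.union (isCompact_Icc.image hσ)) hconn
      ⟨_, Or.inl aA⟩ hh isOpen_univ (subset_univ _)
    have hTW : σ T ∈ W := w3 (Or.inr ⟨T, ⟨T0, le_rfl⟩, rfl⟩)
    obtain ⟨δ, hδ, hball⟩ := Metric.isOpen_iff.1 (w1.preimage hσ) T hTW
    obtain ⟨t, htN, htT⟩ := exists_lt_of_csInf_lt ⟨1, hN1⟩ (show sInf N < T + δ by linarith)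
    apply htN.2
    apply w5.mono
    rintro z (hz | ⟨s, hs, rfl⟩)
    · exact w3 (Or.inl hz)
    · by_cases hsT : s ≤ T
      · exact w3 (Or.inr ⟨s, ⟨hs.1, hsT⟩, rfl⟩)
      · apply hball
        rw [Metric.mem_ball, Real.dist_eq, abs_lt]
        constructor <;> linarith [hs.2]
  have Tpos : 0 < T := by
    rcases T0.eq_or_lt with h | h
    · exfalso
      apply hT
      rw [← h]
      apply hAf.mono
      rintro z (hz | ⟨s, hs, rfl⟩)
      · exact hz
      · rw [le_antisymm hs.2 hs.1]
        exact h0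
    · exact h
  have Ksplit : ∀ z ∈ K T, z = σ T ∨ ∃ t, 0 ≤ t ∧ t < T ∧ z ∈ K t := by
    rintro z (hz | ⟨s, hs, rfl⟩)
    · exact Or.inr ⟨0, le_rfl, Tpos, Or.inl hz⟩
    · rcases hs.2.eq_or_lt with h | h
      · exact Or.inl (by rw [h])
      · exact Or.inr ⟨s, hs.1, h, Or.inr ⟨s, ⟨hs.1, le_rfl⟩, rfl⟩⟩
  obtain ⟨z, hz, hHz⟩ : ∃ z ∈ K T, H z ∈ K T := by
    by_contra hn
    push Not at hn
    exact hT hn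
  rcases Ksplit z hz with e | ⟨t, t1, t2, t3⟩
  · rcases Ksplit _ hHz with e' | ⟨t', t1', t2', t3'⟩
    · exact absurd (e'.trans e.symm) (hf z)
    · have hf' : ∀ z, H.symm z ≠ z := by
        intro z hz
        rw [Homeomorph.symm_apply_eq] at hz
        exact hf z hz.symm
      have := core (H := H.symm) hf' hP.symm hA hAc hσ h0
        (fun t h1 h2 => (hfr t h1 h2).symm) t1' t2' t3' (by simpa using e) bA aA hab.symm
      have := (this.inv).map (H := H.symm.symm)
      simpa using this.swap
  · rcases Ksplit _ hHz with e' | ⟨t', t1', t2', t3'⟩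
    · exact core hf hP hA hAc hσ h0 hfr t1 t2 t3 e' aA bA hab
    · exfalso
      exact hfr (max t t') (le_max_of_le_left t1) (max_lt t2 t2') z
        (Kmono _ _ (le_max_left _ _) t3) (Kmono _ _ (le_max_right _ _) t3')

lemma Fr.iter {H : ℂ ≃ₜ ℂ} (hf : ∀ z, H z ≠ z) (hP : PairLog H) {a b : ℂ} (h : Fr H a b)
    (n : ℕ) (hab : ∀ k < n, H^[k] b ≠ a) : Fr H a (H^[n] b) := by
  induction n with
  | zero => exact h
  | succ n ih =>
    rw [Function.iterate_succ_apply']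
    exact (ih fun k hk => hab k (hk.trans n.lt_succ_self)).step hf hP
      (hab n n.lt_succ_self).symm

lemma meet {H : ℂ ≃ₜ ℂ} (hf : ∀ z, H z ≠ z) (hP : PairLog H) {x y x' y' : ℂ}
    (hs : Singular H x y) (hx : Fr H x' x) (hy : Fr H y' y) : ∃ m, Fr H x' m ∧ Fr H y' m := by
  obtain ⟨n, -, v, ⟨u, hu, rfl⟩, hv⟩ := hs _ _ (isOpen_Fr H x') hx (isOpen_Fr H y') hy
  have hO : IsOpen ({b | Fr H x' b} ∩ H^[n] ⁻¹' {b | Fr H y' b}) :=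
    (isOpen_Fr H x').inter ((isOpen_Fr H y').preimage (H.continuous.iterate n))
  have hinf := infinite_of_mem_nhds u (hO.mem_nhds ⟨hu, hv⟩)
  have hfin : (⋃ k ∈ Finset.range n, H^[k] ⁻¹' {x'}).Finite := by
    apply Set.Finite.biUnion (Finset.finite_toSet _)
    intro k _
    exact (finite_singleton x').preimage (H.injective.iterate k).injOn
  obtain ⟨w, ⟨hw1, hw2⟩, hw3⟩ := (hinf.sdiff hfin).nonempty
  refine ⟨H^[n] w, Fr.iter hf hP hw1 n ?_, hw2⟩
  intro k hk e
  apply hw3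
  simp only [mem_iUnion]
  exact ⟨k, Finset.mem_range.2 hk, e⟩

lemma chain_two {H : ℂ → ℂ} {a b m : ℂ} (h1 : Fr H a m) (h2 : Fr H b m) : ArcChain H a b 2 := by
  refine ⟨fun i => if i = 0 then a else if i = 1 then m else b, by simp, by simp, ?_⟩
  intro i hi
  interval_cases i
  · simpa using h1.joined
  · simpa using h2.swap.joined

/-- Deviation of geodesics: if `H` is a Brouwer homeomorphism, `(x, y)` is a singular
pair for `H` or `H⁻¹`, `d_H(x', x) ≤ 1` and `d_H(y, y') ≤ 1`, then `d_H(x', y') ≤ 2`. -/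
theorem stmt9 (H : ℂ ≃ₜ ℂ) (hfree : ∀ x : ℂ, H x ≠ x) (hor : IsotopicToId ⇑H)
    (x y x' y' : ℂ)
    (hsing : Singular ⇑H x y ∨ Singular ⇑H.symm x y)
    (hx : ArcChain ⇑H x' x 1) (hy : ArcChain ⇑H y y' 1) :
    ArcChain ⇑H x' y' 2 := by
  have hP := pairLog_of_isotopic hor
  obtain ⟨p, p0, p1, hp⟩ := hx
  obtain ⟨r, r0, r1, hr⟩ := hy
  obtain ⟨γ, hγ, γ0, γ1⟩ := hp 0 (by norm_num)
  obtain ⟨β, hβ, β0, β1⟩ := hr 0 (by norm_num)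
  have hx : Fr H x' x := by
    have := fr_of_arc hγ
    rwa [γ0, γ1, p0, zero_add, p1] at this
  have hy : Fr H y' y := by
    have := (fr_of_arc hβ).swap
    rwa [β0, β1, r0, zero_add, r1] at this
  rcases hsing with h | h
  · obtain ⟨m, h1, h2⟩ := meet hfree hP h hx hy
    exact chain_two h1 h2
  · have hf' : ∀ z, H.symm z ≠ z := by
      intro z hz
      rw [Homeomorph.symm_apply_eq] at hz
      exact hfree z hz.symm
    obtain ⟨m, h1, h2⟩ := meet hf' hP.symm h hx.inv hy.inv
    exact chain_two (H := H) (by simpa using h1.inv) (by simpa using h2.inv)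
end
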